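/- Let N ≥ 3 and let (u,K) be a global Mumford–Shah minimizer in ℝ^N such that K (1) satisfies the topological condition (T), (2) is contained in a rectifiable cone, and (3) satisfies the γ-Wirtinger condition for some γ > 0. Set α = √((N−2)² + 4γ) − (N−2) and ω_N = H^{N-1}(S^{N-1}). Then for every r > 0, ∫_{B_r ∖ K} |∇u(x)|² |x|^{2−N} dx ≤ α^{−1} 2^{N−1} ω_N r. -/

import Mathlib

open MeasureTheory Metric Set Filter
open scoped ENNReal NNReal Topology

noncomputable section

/-- `ℝ^N` as a Euclidean space. -/
abbrev Rn (N : ℕ) := EuclideanSpace ℝ (Fin N)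

/-- `u` is locally Lipschitz on the set `s` (neighborhoods taken within `s`). -/
def LocLipOn (N : ℕ) (u : Rn N → ℝ) (s : Set (Rn N)) : Prop :=
  ∀ x ∈ s, ∃ t ∈ nhdsWithin x s, ∃ C : ℝ≥0, LipschitzOnWith C u t

/-- An admissible pair `(u, K)`: `K ⊆ ℝ^N` closed, `u` locally Lipschitz on `ℝ^N ∖ K`
with `∫_{B_R ∖ K} (u² + |∇u|²) < ∞` for every `R > 0`. -/
structure MSPair (N : ℕ) where
  K : Set (Rn N)
  u : Rn N → ℝ
  closed : IsClosed K
  lip : LocLipOn N u Kᶜ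
  integ : ∀ R : ℝ, 0 < R →
    IntegrableOn (fun x => (u x) ^ 2 + ‖gradient u x‖ ^ 2) (ball 0 R \ K) volume

/-- The Mumford–Shah energy `∫_{B ∖ K} |∇u|² + H^{N-1}(K ∩ B)` of a pair in a set `B`. -/
def MSEnergy (N : ℕ) (P : MSPair N) (B : Set (Rn N)) : ℝ≥0∞ :=
  (∫⁻ x in B \ P.K, ENNReal.ofReal (‖gradient P.u x‖ ^ 2)) + μH[(N : ℝ) - 1] (P.K ∩ B)

/-- `Q = (v, L)` is a competitor for `P = (u, K)` in the open ball `B`: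
`L ∖ B = K ∖ B`, `v = u` outside `B ∪ K ∪ L`, and the topological separation condition. -/
def Competitor (N : ℕ) (P Q : MSPair N) (B : Set (Rn N)) : Prop :=
  Q.K \ B = P.K \ B ∧
  (∀ x, x ∉ B ∪ P.K ∪ Q.K → Q.u x = P.u x) ∧
  ∀ x, x ∉ B ∪ P.K → ∀ y, y ∉ B ∪ P.K →
    connectedComponentIn P.Kᶜ x ≠ connectedComponentIn P.Kᶜ y →
    connectedComponentIn Q.Kᶜ x ≠ connectedComponentIn Q.Kᶜ y

/-- Global Mumford–Shah minimizer in `ℝ^N`. -/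
def IsGlobalMin (N : ℕ) (P : MSPair N) : Prop :=
  ∀ (c : Rn N) (R : ℝ), 0 < R → ∀ Q : MSPair N,
    Competitor N P Q (ball c R) → MSEnergy N P (ball c R) ≤ MSEnergy N Q (ball c R)

/-- Reduced global minimizer: no competitor with smaller singular set and the same
function off `K` exists. -/
def MSIsReduced (N : ℕ) (P : MSPair N) : Prop :=
  ∀ (c : Rn N) (R : ℝ), 0 < R → ∀ Q : MSPair N,
    Competitor N P Q (ball c R) → Q.K ⊆ P.K →
    (∀ x, x ∉ P.K → Q.u x = P.u x) → Q.K = P.K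

/-- Topological condition (T): for a.e. `r > 0` such that `∂B_r ∖ K` is not connected,
every connected component `U` of `∂B_r ∖ K` admits an open set `D ⊆ B_r ∖ K` with
`∂D ∖ U ⊆ K`. -/
def CondT (N : ℕ) (K : Set (Rn N)) : Prop :=
  ∀ᵐ r : ℝ ∂volume, 0 < r → ¬ IsConnected (sphere (0 : Rn N) r \ K) →
    ∀ x₀ ∈ sphere (0 : Rn N) r \ K,
      ∃ D : Set (Rn N), IsOpen D ∧ D ⊆ ball (0 : Rn N) r \ K ∧
        frontier D \ connectedComponentIn (sphere (0 : Rn N) r \ K) x₀ ⊆ K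

/-- `E` is `k`-rectifiable: up to an `H^k`-null set, `E` is covered by countably many
Lipschitz images of `ℝ^k`. -/
def KRectifiable (N k : ℕ) (E : Set (Rn N)) : Prop :=
  ∃ f : ℕ → (EuclideanSpace ℝ (Fin k) → Rn N),
    (∀ i, ∃ C : ℝ≥0, LipschitzWith C (f i)) ∧
    μH[(k : ℝ)] (E \ ⋃ i, Set.range (f i)) = 0

/-- `K` is contained in a closed cone `C` whose trace on the unit sphere
is `(N-2)`-rectifiable. -/
def InRectCone (N : ℕ) (K : Set (Rn N)) : Prop :=
  ∃ C : Set (Rn N), IsClosed C ∧ K ⊆ C ∧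
    (∀ t : ℝ, 0 ≤ t → ∀ x ∈ C, t • x ∈ C) ∧
    KRectifiable N (N - 2) (C ∩ sphere (0 : Rn N) 1)

/-- The open cone (with vertex removed) over a set `U`. -/
def coneOverN (N : ℕ) (U : Set (Rn N)) : Set (Rn N) :=
  {z | ∃ t : ℝ, 0 < t ∧ ∃ y ∈ U, z = t • y}

/-- The Wirtinger (Poincaré) inequality with constant `c` on a subset `U` of a sphere:
every locally Lipschitz function on `U` (encoded by its radially `0`-homogeneous
extension `g`, whose ambient gradient on `U` is the tangential gradient `∇_τ`) with
finite tangential energy satisfies `∫_U (g - m_g)² ≤ c ∫_U |∇_τ g|²` w.r.t. `H^{N-1}`. -/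
def WirtingerIneqOn (N : ℕ) (U : Set (Rn N)) (c : ℝ) : Prop :=
  ∀ g : Rn N → ℝ, (∀ (y : Rn N) (t : ℝ), 0 < t → g (t • y) = g y) →
    LocLipOn N g (coneOverN N U) →
    (∫⁻ y in U, ENNReal.ofReal (‖gradient g y‖ ^ 2) ∂μH[(N : ℝ) - 1]) < ⊤ →
    (∫⁻ y in U, ENNReal.ofReal ((g y - ⨍ z in U, g z ∂μH[(N : ℝ) - 1]) ^ 2) ∂μH[(N : ℝ) - 1]) ≤
      ENNReal.ofReal c * ∫⁻ y in U, ENNReal.ofReal (‖gradient g y‖ ^ 2) ∂μH[(N : ℝ) - 1]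

/-- The `γ`-Wirtinger condition: for a.e. `r > 0`, every connected component of
`∂B_r ∖ K` satisfies the Wirtinger inequality with constant `r²/γ` (i.e. the first
nonzero Neumann eigenvalue of the Laplace–Beltrami operator there is `≥ γ/r²`). -/
def WirtingerCond (N : ℕ) (K : Set (Rn N)) (γ : ℝ) : Prop :=
  ∀ᵐ r : ℝ ∂volume, 0 < r → ∀ x₀ ∈ sphere (0 : Rn N) r \ K,
    WirtingerIneqOn N (connectedComponentIn (sphere (0 : Rn N) r \ K) x₀) (r ^ 2 / γ)

/-- The weighted energy `∫_{B_r ∖ K} |∇u(x)|² |x|^{2-N} dx` (as an extended real). -/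
def Phi (N : ℕ) (K : Set (Rn N)) (u : Rn N → ℝ) (r : ℝ) : ℝ≥0∞ :=
  ∫⁻ x in ball (0 : Rn N) r \ K,
    ENNReal.ofReal (‖gradient u x‖ ^ 2 * ‖x‖ ^ ((2 : ℝ) - N))

section
open scoped Pointwise
local notation "oR" => ENNReal.ofReal
section
abbrev Sph (N : ℕ) := sphere (0 : Rn N) 1

theorem polar_mp {N : ℕ} (μ : Measure (Rn N)) (d : ℕ) (hd : 0 < d)
    (hs : ∀ r : ℝ, 0 < r → ∀ s : Set (Rn N), μ (r • s) = oR (r ^ d) * μ s)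
    (ν : Measure (Sph N)) [SigmaFinite ν]
    (hν : ∀ s : Set (Sph N), MeasurableSet s → ν s = d * μ (Ioo (0 : ℝ) 1 • ((↑) '' s))) :
    MeasurePreserving (homeomorphUnitSphereProd (Rn N)) (μ.comap (↑))
      (ν.prod (Measure.volumeIoiPow (d - 1))) := by
  refine ⟨(homeomorphUnitSphereProd _).measurable, .symm ?_⟩
  refine Measure.prod_eq_generateFrom MeasurableSpace.generateFrom_measurableSet
    ((borel_eq_generateFrom_Iio _).symm.trans BorelSpace.measurable_eq.symm)
    MeasurableSpace.isPiSystem_measurableSet isPiSystem_Iio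
    ν.toFiniteSpanningSetsIn (Measure.finiteSpanningSetsIn_volumeIoiPow_range_Iio _)
    fun s hs' ↦ forall_mem_range.2 fun r ↦ ?_
  have : Ioo (0 : ℝ) r = r.1 • Ioo (0 : ℝ) 1 := by simp [LinearOrderedField.smul_Ioo r.2.out]
  rw [(Homeomorph.measurableEmbedding _).map_apply, hν _ hs', Measure.volumeIoiPow_apply_Iio,
    comap_subtype_coe_apply (measurableSet_singleton _).compl, Measure.toSphere_apply_aux, this,
    smul_assoc, hs _ r.2.out, Nat.sub_add_cancel hd, Nat.cast_pred hd,
    sub_add_cancel, mul_right_comm, ← ENNReal.ofReal_natCast, ← ENNReal.ofReal_mul, mul_div_cancel₀]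
  exacts [(Nat.cast_pos.2 hd).ne', Nat.cast_nonneg _]

theorem polar_lint {N : ℕ} (μ : Measure (Rn N)) (d : ℕ) (hd : 0 < d)
    (hs : ∀ r : ℝ, 0 < r → ∀ s : Set (Rn N), μ (r • s) = oR (r ^ d) * μ s)
    (ν : Measure (Sph N)) [SigmaFinite ν]
    (hν : ∀ s : Set (Sph N), MeasurableSet s → ν s = d * μ (Ioo (0 : ℝ) 1 • ((↑) '' s)))
    (f : Rn N → ℝ≥0∞) (hf : Measurable f) :
    ∫⁻ x in {0}ᶜ, f x ∂μ = ∫⁻ r in Ioi (0:ℝ), oR (r ^ (d-1)) *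
      ∫⁻ y : Sph N, f (r • (y : Rn N)) ∂ν := by
  have hmp := (polar_mp μ d hd hs ν hν).symm
    (homeomorphUnitSphereProd (Rn N)).toMeasurableEquiv
  have h1 : ∫⁻ x in {0}ᶜ, f x ∂μ = ∫⁻ x : ({0}ᶜ : Set (Rn N)), f x ∂(μ.comap (↑)) := by
    rw [lintegral_subtype_comap (measurableSet_singleton _).compl]
  rw [h1, ← hmp.lintegral_comp (f := fun x => f x) (hf.comp measurable_subtype_coe)]
  have hm : Measurable (fun p : Sph N × Ioi (0:ℝ) => f ((p.2 : ℝ) • (p.1 : Rn N))) :=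
    hf.comp (by fun_prop)
  have h2 : ∀ a : Sph N × Ioi (0:ℝ),
      f (((homeomorphUnitSphereProd (Rn N)).toMeasurableEquiv.symm a : ({0}ᶜ : Set (Rn N))) : Rn N)
        = f ((a.2 : ℝ) • (a.1 : Rn N)) := fun a => rfl
  simp only [h2]
  rw [lintegral_prod_symm _ hm.aemeasurable, Measure.volumeIoiPow]
  have hm2 : Measurable (fun r : ℝ => ∫⁻ y : Sph N, f (r • (y : Rn N)) ∂ν) :=
    Measurable.lintegral_prod_right' (f := fun p : ℝ × Sph N => f (p.1 • (p.2 : Rn N)))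
      (hf.comp (by fun_prop))
  refine (lintegral_withDensity_eq_lintegral_mul _ (by fun_prop)
    (hm2.comp measurable_subtype_coe)).trans ?_
  exact lintegral_subtype_comap measurableSet_Ioi
    (fun r : ℝ => oR (r ^ (d-1)) * ∫⁻ y : Sph N, f (r • (y : Rn N)) ∂ν)

abbrev sg (N : ℕ) : Measure (Sph N) := (volume : Measure (Rn N)).toSphere

theorem polar_vol {N : ℕ} (hN : 0 < N) (f : Rn N → ℝ≥0∞) (hf : Measurable f) :
    ∫⁻ x, f x = ∫⁻ r in Ioi (0:ℝ), oR (r ^ (N-1)) *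
      ∫⁻ y : Sph N, f (r • (y : Rn N)) ∂(sg N) := by
  have : Nonempty (Fin N) := ⟨⟨0, hN⟩⟩
  rw [← polar_lint volume N hN _ (sg N) _ f hf]
  · rw [setLIntegral_congr (t := univ), setLIntegral_univ]
    rw [ae_eq_univ]; simp
  · intro r hr s
    rw [Measure.addHaar_smul_of_nonneg _ hr.le]; simp
  · intro s hs
    rw [Measure.toSphere_apply' _ hs]; simp
end
section
theorem christensen {X : Type*} [MetricSpace X] [SecondCountableTopology X] [MeasurableSpace X]
    [BorelSpace X] (μ ν : Measure X) [IsFiniteMeasure μ] [IsFiniteMeasure ν]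
    [ν.IsOpenPosMeasure] [Nonempty X]
    (hμ : ∀ x y ε, μ (ball x ε) = μ (ball y ε)) (hν : ∀ x y ε, ν (ball x ε) = ν (ball y ε)) :
    μ = (μ univ / ν univ) • ν := by
  obtain ⟨x0⟩ := ‹Nonempty X›
  have hνu0 : ν univ ≠ 0 := isOpen_univ.measure_ne_zero ν ⟨x0, trivial⟩
  have hνut : ν univ ≠ ⊤ := measure_ne_top _ _
  have fub : ∀ (U : Set X), IsOpen U → ∀ ε : ℝ,
      ∫⁻ x, ν (U ∩ ball x ε) ∂μ = μ (ball x0 ε) * ν U := by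
    intro U hU ε
    have hms : MeasurableSet {p : X × X | p.2 ∈ U ∧ dist p.1 p.2 < ε} :=
      (measurable_snd hU.measurableSet).inter
        (isOpen_lt (continuous_dist) continuous_const).measurableSet
    have h1 := Measure.prod_apply (μ := μ) (ν := ν) hms
    have h2 := Measure.prod_apply_symm (μ := μ) (ν := ν) hms
    have h3 : ∀ x, ν (U ∩ ball x ε) = ν (Prod.mk x ⁻¹' {p : X × X | p.2 ∈ U ∧ dist p.1 p.2 < ε}) := by
      intro x; congr 1; ext y; simp [dist_comm]
    simp_rw [h3]
    rw [← h1, h2]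
    have h4 : ∀ y, μ ((fun x => (x, y)) ⁻¹' {p : X × X | p.2 ∈ U ∧ dist p.1 p.2 < ε})
        = U.indicator (fun _ => μ (ball x0 ε)) y := by
      intro y
      by_cases hy : y ∈ U
      · rw [indicator_of_mem hy, ← hμ y x0 ε]; congr 1; ext x; simp [hy]
      · rw [indicator_of_notMem hy]; convert measure_empty (μ := μ); ext x; simp [hy]
    simp_rw [h4]
    rw [lintegral_indicator hU.measurableSet, lintegral_const]; simp
  have hb0 : ∀ ε : ℝ, 0 < ε → ν (ball x0 ε) ≠ 0 := fun ε hε =>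
    isOpen_ball.measure_ne_zero ν ⟨x0, by simpa⟩
  have hrat : ∀ ε : ℝ, 0 < ε → μ (ball x0 ε) = (μ univ / ν univ) * ν (ball x0 ε) := by
    intro ε hε
    have := fub univ isOpen_univ ε
    simp only [univ_inter] at this
    simp_rw [fun x => hν x x0 ε] at this
    rw [lintegral_const] at this
    rw [ENNReal.div_eq_inv_mul, mul_assoc, mul_comm (μ univ), this, mul_comm (μ (ball x0 ε)), ← mul_assoc,
      ENNReal.inv_mul_cancel hνu0 hνut, one_mul]
  have hopen : ∀ U, IsOpen U → μ U ≤ (μ univ / ν univ) * ν U := by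
    intro U hU
    set F : ℕ → X → ℝ≥0∞ := fun k x => ν (U ∩ ball x (1/((k:ℝ)+1))) / ν (ball x0 (1/((k:ℝ)+1)))
    have hpos : ∀ k : ℕ, (0:ℝ) < 1/((k:ℝ)+1) := fun k => by positivity
    have hle : μ U ≤ ∫⁻ x in U, liminf (fun k => F k x) atTop ∂μ := by
      rw [← setLIntegral_one]
      apply setLIntegral_mono' hU.measurableSet
      intro x hx
      obtain ⟨δ, hδ, hδU⟩ := Metric.isOpen_iff.1 hU x hx
      apply le_liminf_of_le
      · isBoundedDefault
      have ht : Tendsto (fun k : ℕ => 1/((k:ℝ)+1)) atTop (𝓝 0) := tendsto_one_div_add_atTop_nhds_zero_nat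
      filter_upwards [ht.eventually (gt_mem_nhds hδ)] with k hk
      have : U ∩ ball x (1/((k:ℝ)+1)) = ball x (1/((k:ℝ)+1)) :=
        inter_eq_right.2 ((ball_subset_ball hk.le).trans hδU)
      simp only [F]
      rw [this, hν x x0, ENNReal.div_self (hb0 _ (hpos k)) (measure_ne_top _ _)]
    have hmeas : ∀ k, Measurable (F k) := by
      intro k
      apply Measurable.div_const
      have hms : MeasurableSet {p : X × X | p.2 ∈ U ∧ dist p.1 p.2 < 1/((k:ℝ)+1)} :=
        (measurable_snd hU.measurableSet).inter
          (isOpen_lt (continuous_dist) continuous_const).measurableSet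
      convert measurable_measure_prodMk_left (ν := ν) hms using 3 with x
      ext y; simp [dist_comm]
    refine hle.trans ((lintegral_liminf_le hmeas).trans ?_)
    apply liminf_le_of_le
    · isBoundedDefault
    intro b hb
    obtain ⟨k, hk⟩ := hb.exists
    refine hk.trans ((setLIntegral_le_lintegral _ _).trans ?_)
    simp only [F, ENNReal.div_eq_inv_mul]
    rw [lintegral_const_mul', fub U hU, hrat _ (hpos k)]
    · rw [← mul_assoc, mul_comm _ (ν (ball x0 _)), ← mul_assoc,
        ENNReal.inv_mul_cancel (hb0 _ (hpos k)) (measure_ne_top _ _), one_mul, ENNReal.div_eq_inv_mul]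
    · exact ENNReal.inv_ne_top.2 (hb0 _ (hpos k))
  have hct : μ univ / ν univ ≠ ⊤ := ENNReal.div_ne_top (measure_ne_top _ _) hνu0
  apply Measure.eq_of_le_of_measure_univ_eq
  · apply Measure.le_intro
    intro A hA _
    rw [Measure.smul_apply, smul_eq_mul, A.measure_eq_iInf_isOpen ν]
    have : ((μ univ / ν univ) * ⨅ U, ⨅ (_ : A ⊆ U), ⨅ (_ : IsOpen U), ν U) =
      ⨅ U, ⨅ (_ : A ⊆ U), ⨅ (_ : IsOpen U), (μ univ / ν univ) * ν U := by
      by_cases h0 : μ univ / ν univ = 0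
      · simp only [h0, zero_mul]; symm; apply le_antisymm _ bot_le
        exact iInf_le_of_le univ (by simp)
      simp_rw [ENNReal.mul_iInf_of_ne h0 hct]
    rw [this]
    exact le_iInf fun U => le_iInf fun hAU => le_iInf fun hU => (measure_mono hAU).trans (hopen U hU)
  · rw [Measure.smul_apply, smul_eq_mul, ENNReal.div_mul_cancel hνu0 hνut]

theorem sph_trans {N : ℕ} (x y : Sph N) : ∃ e : Rn N ≃ₗᵢ[ℝ] Rn N, e x = y := by
  refine ⟨Submodule.reflection (ℝ ∙ ((x : Rn N) - y))ᗮ, ?_⟩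
  apply Submodule.reflection_sub
  have := x.2; have := y.2; simp_all

theorem image_ball_sph {N : ℕ} (e : Rn N ≃ₗᵢ[ℝ] Rn N) (x y : Sph N) (h : e x = y) (ε : ℝ) :
    ((↑) '' ball y ε : Set (Rn N)) = e '' ((↑) '' ball x ε) := by
  ext z
  simp only [mem_image, mem_ball, Subtype.exists, exists_and_right, exists_eq_right, Subtype.dist_eq]
  constructor
  · rintro ⟨hz, hd⟩
    refine ⟨e.symm z, ⟨by simpa using hz, ?_⟩, by simp⟩
    rw [← e.dist_map, h]; simpa using hd
  · rintro ⟨w, ⟨hw, hd⟩, rfl⟩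
    refine ⟨by simpa using hw, ?_⟩
    rw [← h, e.dist_map]; exact hd

theorem sg_ball {N : ℕ} (x y : Sph N) (ε : ℝ) : sg N (ball x ε) = sg N (ball y ε) := by
  obtain ⟨e, he⟩ := sph_trans x y
  rw [Measure.toSphere_apply' _ isOpen_ball.measurableSet, Measure.toSphere_apply' _ isOpen_ball.measurableSet,
    image_ball_sph e x y he]
  congr 1
  have : Ioo (0:ℝ) 1 • (e '' ((↑) '' ball x ε)) = e '' (Ioo (0:ℝ) 1 • ((↑) '' ball x ε)) := by
    ext z
    simp only [Set.mem_smul, mem_image]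
    constructor
    · rintro ⟨t, ht, _, ⟨w, hw, rfl⟩, rfl⟩
      exact ⟨t • w, ⟨t, ht, w, hw, rfl⟩, by simp⟩
    · rintro ⟨_, ⟨t, ht, w, hw, rfl⟩, rfl⟩
      exact ⟨t, ht, e w, ⟨w, hw, rfl⟩, by simp⟩
  rw [this]
  rw [← e.measurePreserving.measure_preimage_emb e.toHomeomorph.measurableEmbedding (e '' _),
    preimage_image_eq _ e.injective]

def omH (N : ℕ) : ℝ≥0∞ := μH[(N:ℝ)-1] (sphere (0 : Rn N) 1)

theorem muH_sub {N : ℕ} (hN : 1 ≤ N) (s : Set (Sph N)) :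
    (μH[(N:ℝ)-1] : Measure (Sph N)) s = (μH[(N:ℝ)-1] : Measure (Rn N)) ((↑) '' s) := by
  rw [isometry_subtype_coe.hausdorffMeasure_image]
  left
  have : (1:ℝ) ≤ N := by exact_mod_cast hN
  linarith

def cS (N : ℕ) : ℝ≥0∞ := omH N / sg N univ

theorem muH_sph {N : ℕ} (hN : 1 ≤ N) (hfin : omH N ≠ ⊤) :
    (μH[(N:ℝ)-1] : Measure (Sph N)) = cS N • sg N := by
  have hu : (μH[(N:ℝ)-1] : Measure (Sph N)) univ = omH N := by
    rw [muH_sub hN, image_univ, Subtype.range_coe, omH]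
  have : IsFiniteMeasure (μH[(N:ℝ)-1] : Measure (Sph N)) := ⟨by rw [hu]; exact hfin.lt_top⟩
  have : Nonempty (Fin N) := ⟨⟨0, hN⟩⟩
  have : Nonempty (Sph N) := (NormedSpace.sphere_nonempty.2 zero_le_one).to_subtype
  rw [cS, ← hu]
  apply christensen _ _ _ sg_ball
  intro x y ε
  obtain ⟨e, he⟩ := sph_trans x y
  rw [muH_sub hN, muH_sub hN, image_ball_sph e x y he]
  exact (e.toIsometryEquiv.hausdorffMeasure_image _ _).symm

theorem muH_sphere_restrict {N : ℕ} (hN : 1 ≤ N) (hfin : omH N ≠ ⊤) {r : ℝ} (hr : 0 < r) :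
    (μH[(N:ℝ)-1] : Measure (Rn N)).restrict (sphere 0 r) =
      (cS N * oR (r ^ (N-1))) • (sg N).map (fun y : Sph N => r • (y : Rn N)) := by
  ext s hs
  have hms : Measurable (fun y : Sph N => r • (y : Rn N)) := by fun_prop
  rw [Measure.restrict_apply hs, Measure.smul_apply, Measure.map_apply hms hs, smul_eq_mul]
  have h1 : s ∩ sphere 0 r = r • ((↑) '' ((fun y : Sph N => r • (y : Rn N)) ⁻¹' s)) := by
    ext z
    simp only [mem_inter_iff, mem_sphere_zero_iff_norm, mem_smul_set, mem_image, mem_preimage,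
      Subtype.exists, exists_and_left, exists_prop, exists_eq_right_right]
    constructor
    · rintro ⟨hz, hz'⟩
      refine ⟨r⁻¹ • z, ⟨?_, ?_⟩, ?_⟩
      · rwa [smul_inv_smul₀ hr.ne']
      · rw [norm_smul, hz', norm_inv, Real.norm_of_nonneg hr.le, inv_mul_cancel₀ hr.ne']
      · rw [smul_inv_smul₀ hr.ne']
    · rintro ⟨w, ⟨h1, h2⟩, rfl⟩
      exact ⟨h1, by rw [norm_smul, h2, Real.norm_of_nonneg hr.le, mul_one]⟩
  have hd : (0:ℝ) ≤ (N:ℝ) - 1 := by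
    have : (1:ℝ) ≤ N := by exact_mod_cast hN
    linarith
  rw [h1, Measure.hausdorffMeasure_smul₀ hd hr.ne', ← muH_sub hN, muH_sph hN hfin]
  rw [Measure.smul_apply, smul_eq_mul, ENNReal.smul_def, smul_eq_mul]
  have : ((‖r‖₊ ^ ((N:ℝ)-1) : ℝ≥0) : ℝ≥0∞) = oR (r ^ (N-1)) := by
    have e1 : (N:ℝ) - 1 = ((N-1 : ℕ) : ℝ) := by push_cast [hN]; ring
    rw [e1, NNReal.rpow_natCast, ENNReal.ofReal_pow hr.le, ENNReal.coe_pow]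
    congr 1
    rw [ENNReal.ofReal, ENNReal.coe_inj]; ext; simp [abs_of_pos hr, hr.le]
  rw [this]; ring

theorem lint_sphere {N : ℕ} (hN : 1 ≤ N) (hfin : omH N ≠ ⊤) {r : ℝ} (hr : 0 < r)
    (f : Rn N → ℝ≥0∞) (hf : Measurable f) :
    ∫⁻ x in sphere 0 r, f x ∂μH[(N:ℝ)-1] =
      (cS N * oR (r ^ (N-1))) * ∫⁻ y : Sph N, f (r • (y : Rn N)) ∂(sg N) := by
  rw [muH_sphere_restrict hN hfin hr, lintegral_smul_measure, lintegral_map hf (by fun_prop), smul_eq_mul]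
end
section
theorem exists_split {n : ℕ} (ν : Rn (n+1)) (hν : ‖ν‖ = 1) :
    ∃ Ψ : (ℝ × Rn n) ≃ₗ[ℝ] Rn (n+1), MeasurePreserving Ψ ∧
      (∀ t z, inner ℝ (Ψ (t, z)) ν = t) ∧ ∀ t z, ‖Ψ (t, z)‖ ^ 2 = t ^ 2 + ‖z‖ ^ 2 := by
  let c : (ℝ × Rn n) ≃ₗ[ℝ] Rn (n+1) :=
    { toFun := fun p => WithLp.toLp 2 (Fin.cons p.1 (WithLp.ofLp p.2))
      invFun := fun x => (x 0, WithLp.toLp 2 (fun i => x i.succ))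
      left_inv := fun p => by ext <;> simp
      right_inv := fun x => by
        ext i; refine Fin.cases ?_ (fun j => ?_) i <;> simp
      map_add' := fun p p' => by
        ext i; refine Fin.cases ?_ (fun j => ?_) i <;> simp
      map_smul' := fun a p => by
        ext i; refine Fin.cases ?_ (fun j => ?_) i <;> simp }
  have hc0 : ∀ t z, (c (t, z)) 0 = t := fun t z => rfl
  have hcs : ∀ t z j, (c (t, z)) (Fin.succ j) = z j := fun t z j => rfl
  have hcn : ∀ t z, ‖c (t, z)‖ ^ 2 = t ^ 2 + ‖z‖ ^ 2 := by
    intro t z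
    rw [EuclideanSpace.norm_sq_eq, EuclideanSpace.norm_sq_eq, Fin.sum_univ_succ]
    simp [hc0, hcs]
  let e0 : Rn (n+1) := c (1, 0)
  have he0 : ‖e0‖ = 1 := by
    have := hcn 1 0
    simp only [one_pow, norm_zero, ne_eq, OfNat.ofNat_ne_zero, not_false_eq_true, zero_pow, add_zero] at this
    exact (pow_eq_one_iff_of_nonneg (norm_nonneg _) two_ne_zero).1 this
  obtain ⟨e, he⟩ := sph_trans (⟨e0, by simpa using he0⟩ : Sph (n+1)) ⟨ν, by simpa using hν⟩
  simp only at he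
  refine ⟨c.trans e.toLinearEquiv, ?_, ?_, ?_⟩
  · have h1 : MeasurePreserving c := by
      have a1 := (volume_preserving_piFinSuccAbove (fun _ : Fin (n + 1) => ℝ) 0).symm
      have a2 := PiLp.volume_preserving_toLp (Fin (n+1))
      have a3 : MeasurePreserving (fun p : ℝ × Rn n => (p.1, WithLp.ofLp p.2)) :=
        (MeasurePreserving.id volume).prod (PiLp.volume_preserving_ofLp (Fin n))
      have := (a2.comp a1).comp a3
      have hcc : (c : ℝ × Rn n → Rn (n+1)) = (WithLp.toLp 2 ∘ (MeasurableEquiv.piFinSuccAbove (fun _ : Fin (n + 1) => ℝ) 0).symm) ∘ fun p => (p.1, WithLp.ofLp p.2) := by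
        funext p; ext i
        refine Fin.cases ?_ (fun j => ?_) i <;> simp [c, MeasurableEquiv.piFinSuccAbove]
      rw [hcc]; exact this
    exact e.measurePreserving.comp h1
  · intro t z
    change inner ℝ (e (c (t, z))) ν = t
    rw [← he, e.inner_map_map]
    simp [e0, PiLp.inner_apply, Fin.sum_univ_succ, hc0, hcs]
  · intro t z
    change ‖e (c (t, z))‖ ^ 2 = _
    rw [e.norm_map, hcn]

def cH (n : ℕ) : ℝ≥0∞ := Measure.addHaarScalarFactor (μH[(n:ℝ)] : Measure (Rn n)) volume

instance muH_haar (n : ℕ) : (μH[(n:ℝ)] : Measure (Rn n)).IsAddHaarMeasure := by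
  have := isAddHaarMeasure_hausdorffMeasure (E := Rn n)
  simpa using this

theorem muH_flat (n : ℕ) : (μH[(n:ℝ)] : Measure (Rn n)) = cH n • volume := by
  conv_lhs => rw [Measure.isAddLeftInvariant_eq_smul (μH[(n:ℝ)] : Measure (Rn n)) volume]
  rfl

theorem cH_ne_top (n : ℕ) : cH n ≠ ⊤ := ENNReal.coe_ne_top
theorem cH_ne_zero (n : ℕ) : cH n ≠ 0 := by
  intro h
  have := muH_flat n
  rw [h, zero_smul] at this
  exact (Measure.IsAddHaarMeasure.toIsOpenPosMeasure (μ := (μH[(n:ℝ)] : Measure (Rn n)))).open_pos univ isOpen_univ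
    ⟨0, trivial⟩ (by rw [this]; simp)

theorem normalize_lip {E : Type*} [NormedAddCommGroup E] [InnerProductSpace ℝ E] {x y : E} (hx : 1 ≤ ‖x‖) (hy : 1 ≤ ‖y‖) :
    ‖‖x‖⁻¹ • x - ‖y‖⁻¹ • y‖ ≤ ‖x - y‖ := by
  have hx0 : 0 < ‖x‖ := by linarith
  have hy0 : 0 < ‖y‖ := by linarith
  apply le_of_sq_le_sq _ (norm_nonneg _)
  rw [norm_sub_sq_real, norm_sub_sq_real, norm_smul, norm_smul, inner_smul_left, inner_smul_right]
  simp only [norm_inv, norm_norm, conj_trivial]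
  rw [inv_mul_cancel₀ hx0.ne', inv_mul_cancel₀ hy0.ne']
  have hi := real_inner_le_norm x y
  set a := ‖x‖; set b := ‖y‖; set p := inner ℝ x y
  have h1 : a⁻¹ * (b⁻¹ * p) = p / (a*b) := by field_simp
  rw [h1]
  have hab : 1 ≤ a * b := by nlinarith
  have h2 : p / (a*b) ≤ 1 := by rw [div_le_one (by positivity)]; exact hi
  have h3 : p = p/(a*b) * (a*b) := by field_simp
  rw [show a^2 - 2*p + b^2 = a^2 - 2*(p/(a*b) * (a*b)) + b^2 by rw [← h3]]
  set s := p/(a*b)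
  nlinarith [sq_nonneg (a-b), mul_nonneg (sub_nonneg.2 h2) (sub_nonneg.2 hab)]

theorem cap_ineq {n : ℕ} (hfin : omH (n+1) ≠ ⊤) {ρ : ℝ} (hρ : 0 < ρ) :
    cS (n+1) * oR ((√(1+ρ^2))⁻¹ ^ (n+1)) ≤ cH n := by
  let e0 : Rn (n+1) := EuclideanSpace.single 0 1
  obtain ⟨Ψ, hmp, hin, hno⟩ := exists_split e0 (by simp [e0])
  have hΨc : Continuous Ψ := Ψ.toLinearMap.continuous_of_finiteDimensional
  set h := (√(1+ρ^2))⁻¹ with hh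
  have hsq : 0 < √(1+ρ^2) := by positivity
  have hpos : 0 < h := by positivity
  have hs2 : √(1+ρ^2)^2 = 1+ρ^2 := Real.sq_sqrt (by positivity)
  let cap : Set (Sph (n+1)) := {y | ∃ t z, 0 < t ∧ ‖z‖ < ρ * t ∧ (y : Rn (n+1)) = Ψ (t, z)}
  have hcapo : IsOpen cap := by
    have : cap = (fun y : Sph (n+1) => Ψ.symm y) ⁻¹' {p : ℝ × Rn n | 0 < p.1 ∧ ‖p.2‖ < ρ * p.1} := by
      ext y; constructor
      · rintro ⟨t, z, h1, h2, h3⟩; simp [h3, h1, h2]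
      · rintro ⟨h1, h2⟩; exact ⟨_, _, h1, h2, by simp⟩
    rw [this]
    refine IsOpen.preimage (Ψ.symm.toLinearMap.continuous_of_finiteDimensional.comp continuous_subtype_val) ?_
    exact (isOpen_lt continuous_const continuous_fst).inter
      (isOpen_lt (f := fun p : ℝ × Rn n => ‖p.2‖) (g := fun p => ρ * p.1) (by fun_prop) (by fun_prop))
  have hup : (μH[(n:ℝ)] : Measure (Rn (n+1))) ((↑) '' cap) ≤ μH[(n:ℝ)] (ball (0 : Rn n) ρ) := by
    have hl : LipschitzWith 1 (fun z : Rn n => ‖Ψ (1, z)‖⁻¹ • Ψ (1, z)) := by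
      apply LipschitzWith.of_dist_le_mul
      intro z w
      rw [dist_eq_norm, dist_eq_norm, NNReal.coe_one, one_mul]
      have h1 : ∀ z, 1 ≤ ‖Ψ (1, z)‖ := fun z => by
        have := hno 1 z
        nlinarith [norm_nonneg (Ψ (1,z)), sq_nonneg ‖z‖]
      refine (normalize_lip (h1 z) (h1 w)).trans ?_
      rw [← map_sub]
      have := hno 0 (z - w)
      simp only [Prod.mk_sub_mk, sub_self]
      exact le_of_sq_le_sq (by rw [this]; simp) (norm_nonneg _)
    have := hl.hausdorffMeasure_image_le (d := n) (by positivity) (ball 0 ρ)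
    simp only [ENNReal.coe_one, ENNReal.one_rpow, one_mul] at this
    refine le_trans (measure_mono ?_) this
    rintro _ ⟨y, ⟨t, z, ht, hz, hy⟩, rfl⟩
    refine ⟨t⁻¹ • z, ?_, ?_⟩
    · rw [mem_ball_zero_iff, norm_smul, norm_inv, Real.norm_of_nonneg ht.le]
      rw [inv_mul_lt_iff₀ ht]; linarith
    · have e1 : Ψ (1, t⁻¹ • z) = t⁻¹ • (y : Rn (n+1)) := by
        rw [hy, ← map_smul]; congr 1; ext <;> simp [ht.ne']
      have e2 : ‖(y : Rn (n+1))‖ = 1 := by simpa using y.2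
      simp only [e1]
      rw [norm_smul, e2, norm_inv, Real.norm_of_nonneg ht.le, mul_one, inv_inv, smul_smul, mul_inv_cancel₀ ht.ne', one_smul]
  have hlow : oR (h^(n+1)) * volume (ball (0 : Rn n) ρ) ≤ sg (n+1) cap := by
    rw [Measure.toSphere_apply' _ hcapo.measurableSet]
    let pyr : Set (ℝ × Rn n) := {p | 0 < p.1 ∧ p.1 < h ∧ ‖p.2‖ < ρ * p.1}
    have hpm : MeasurableSet pyr := ((isOpen_lt continuous_const continuous_fst).inter
      ((isOpen_lt continuous_fst continuous_const).inter
      (isOpen_lt (f := fun p : ℝ × Rn n => ‖p.2‖) (g := fun p => ρ * p.1) (by fun_prop) (by fun_prop)))).measurableSet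
    have hsub : pyr ⊆ Ψ ⁻¹' (Ioo (0:ℝ) 1 • ((↑) '' cap)) := by
      rintro ⟨t, z⟩ ⟨h1, h2, h3⟩
      simp only at h1 h2 h3
      have hN := hno t z
      have hn0 : 0 < ‖Ψ (t,z)‖ := by
        by_contra hcon
        have : ‖Ψ (t,z)‖ = 0 := le_antisymm (not_lt.1 hcon) (norm_nonneg _)
        rw [this] at hN; nlinarith [sq_nonneg ‖z‖]
      have hn1 : ‖Ψ (t,z)‖ < 1 := by
        have a1 : ‖z‖^2 ≤ (ρ*t)^2 := by gcongr
        have a2 : t * √(1+ρ^2) < 1 := by rw [hh, lt_inv_comm₀ h1 hsq] at h2; rw [← lt_inv_mul_iff₀ h1]; simpa using h2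
        have a3 : (t * √(1+ρ^2))^2 < 1 := by
          have : 0 < t * √(1+ρ^2) := by positivity
          nlinarith
        rw [mul_pow, hs2] at a3
        nlinarith
      refine ⟨‖Ψ (t,z)‖, ⟨hn0, hn1⟩, ‖Ψ (t,z)‖⁻¹ • Ψ (t,z), ?_, by simp [hn0.ne']⟩
      refine ⟨⟨‖Ψ (t,z)‖⁻¹ • Ψ (t,z), by simp [norm_smul, hn0.ne']⟩, ⟨‖Ψ (t,z)‖⁻¹ * t, ‖Ψ (t,z)‖⁻¹ • z, by positivity, ?_, ?_⟩, rfl⟩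
      · rw [norm_smul, norm_inv, norm_norm]
        calc ‖Ψ (t,z)‖⁻¹ * ‖z‖ < ‖Ψ (t,z)‖⁻¹ * (ρ * t) := by gcongr
          _ = _ := by ring
      · simp only [← map_smul]; rfl
    have hvp : volume pyr = oR (h^(n+1) / (n+1)) * volume (ball (0 : Rn n) ρ) := by
      rw [Measure.volume_eq_prod, Measure.prod_apply hpm]
      have e1 : ∀ t : ℝ, volume (Prod.mk t ⁻¹' pyr) =
          (Ioo 0 h).indicator (fun t => oR (t^n) * volume (ball (0 : Rn n) ρ)) t := by
        intro t
        by_cases ht : t ∈ Ioo 0 h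
        · rw [indicator_of_mem ht]
          have : Prod.mk t ⁻¹' pyr = ball (0 : Rn n) (t * ρ) := by
            ext z; simp [pyr, ht.1, ht.2, mul_comm]
          rw [this, Measure.addHaar_ball_mul_of_pos _ _ ht.1]; simp
        · rw [indicator_of_notMem ht]
          convert measure_empty (μ := (volume : Measure (Rn n)))
          ext z; simp only [pyr, mem_preimage, mem_ofPred_eq, mem_empty_iff_false, iff_false]
          rintro ⟨h1, h2, _⟩; exact ht ⟨h1, h2⟩
      simp_rw [e1]
      rw [lintegral_indicator measurableSet_Ioo, lintegral_mul_const _ (by fun_prop)]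
      congr 1
      rw [Measure.restrict_congr_set Ioo_ae_eq_Ioc, ← ofReal_integral_eq_lintegral_ofReal
        (intervalIntegral.intervalIntegrable_pow _).1, ← intervalIntegral.integral_of_le hpos.le]
      · simp
      · filter_upwards [ae_restrict_mem measurableSet_Ioc] with y hy
        exact pow_nonneg hy.1.le _
    have h3 := measure_mono (μ := volume) hsub
    rw [hmp.measure_preimage (by
      have : MeasurableSet (Ioo (0:ℝ) 1 • ((↑) '' cap : Set (Rn (n+1)))) :=
        (isOpen_Ioo.smul_sphere one_ne_zero (by simp) hcapo).measurableSet
      exact this.nullMeasurableSet), hvp] at h3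
    refine le_trans (le_of_eq ?_) (mul_le_mul_right h3 _)
    rw [← mul_assoc]; congr 1
    simp only [finrank_euclideanSpace, Fintype.card_fin]
    rw [← ENNReal.ofReal_natCast, ← ENNReal.ofReal_mul (by positivity)]
    congr 1; push_cast; field_simp
  have key : cS (n+1) * (oR (h^(n+1)) * volume (ball (0 : Rn n) ρ)) ≤ cH n * volume (ball (0 : Rn n) ρ) := by
    calc _ ≤ cS (n+1) * sg (n+1) cap := by gcongr
      _ = (μH[((n+1:ℕ):ℝ)-1] : Measure (Sph (n+1))) cap := by rw [muH_sph (by omega) hfin]; rfl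
      _ = (μH[(n:ℝ)] : Measure (Rn (n+1))) ((↑) '' cap) := by
        rw [muH_sub (by omega)]; congr 2; simp
      _ ≤ _ := hup
      _ = _ := by rw [muH_flat]; rfl
  rw [← mul_assoc] at key
  have hb0 : volume (ball (0 : Rn n) ρ) ≠ 0 := (isOpen_ball.measure_pos _ (by simpa)).ne'
  have hbt : volume (ball (0 : Rn n) ρ) ≠ ⊤ := measure_ball_lt_top.ne
  exact (ENNReal.mul_le_mul_iff_left hb0 hbt).1 key

theorem cS_le_cH {n : ℕ} (hfin : omH (n+1) ≠ ⊤) : cS (n+1) ≤ cH n := by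
  have ht : Tendsto (fun ρ : ℝ => cS (n+1) * oR ((√(1+ρ^2))⁻¹ ^ (n+1))) (𝓝[>] 0) (𝓝 (cS (n+1) * oR ((√(1+0^2))⁻¹ ^ (n+1)))) := by
    apply Tendsto.mono_left _ nhdsWithin_le_nhds
    apply ENNReal.Tendsto.const_mul
    · apply (ENNReal.continuous_ofReal.tendsto _).comp
      apply ContinuousAt.tendsto (f := fun ρ : ℝ => (√(1+ρ^2))⁻¹ ^ (n+1))
      apply ContinuousAt.pow
      apply ContinuousAt.inv₀ (by fun_prop) (by positivity)
    · left; simp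
  have := le_of_tendsto ht (by filter_upwards [self_mem_nhdsWithin] with ρ hρ using cap_ineq hfin hρ)
  simpa using this
end
section
theorem meas_grad {N : ℕ} (u : Rn N → ℝ) : Measurable (gradient u) := by
  unfold gradient
  exact (LinearIsometryEquiv.continuous _).measurable.comp (measurable_fderiv ℝ u)

theorem meas_e {N : ℕ} (u : Rn N → ℝ) : Measurable (fun x => oR (‖gradient u x‖ ^ 2)) :=
  ((meas_grad u).norm.pow_const 2).ennreal_ofReal

theorem lint_grad_fin {N : ℕ} (P : MSPair N) {R : ℝ} (hR : 0 < R) :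
    ∫⁻ x in ball 0 R \ P.K, oR (‖gradient P.u x‖ ^ 2) < ⊤ := by
  have h := (P.integ R hR).2
  rw [hasFiniteIntegral_iff_ofReal (by filter_upwards with x; positivity)] at h
  exact lt_of_le_of_lt (lintegral_mono fun x => ENNReal.ofReal_le_ofReal (by nlinarith [sq_nonneg (P.u x)])) h

section
variable {N : ℕ} (P : MSPair N) (z : Rn N) (ε r : ℝ)

def phiE (x : Rn N) : ℝ := ‖x‖ + ε * infDist x (P.K ∪ {z})

theorem phiE_cont : Continuous (phiE P z ε) := by
  unfold phiE
  exact continuous_norm.add (continuous_const.mul (continuous_infDist_pt _))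

theorem phiE_dist (x : Rn N) (hx : infDist x (P.K ∪ {z}) = 0) (hz : x ≠ z) : x ∈ P.K := by
  have hcl : IsClosed (P.K ∪ {z}) := P.closed.union isClosed_singleton
  have := (hcl.mem_iff_infDist_zero ⟨z, by simp⟩).2 hx
  rcases this with h | h
  · exact h
  · exact absurd h hz

theorem phiE_gt (hr : r < phiE P z ε x) (hL : x ∉ P.K \ ball 0 r) : x ∉ P.K := by
  intro hx
  have : infDist x (P.K ∪ {z}) = 0 := infDist_zero_of_mem (Or.inl hx)
  rw [phiE, this, mul_zero, add_zero] at hr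
  exact hL ⟨hx, by simp [hr.le]⟩

theorem phiE_out (hε : 0 < ε) (hr : 0 < r) (hz : ‖z‖ = 2 * r) {x : Rn N} (hx : x ∉ ball 0 r)
    (hφ : phiE P z ε x ≤ r) : x ∈ P.K := by
  have h0 : 0 ≤ infDist x (P.K ∪ {z}) := infDist_nonneg
  have h1 : r ≤ ‖x‖ := by simpa using hx
  unfold phiE at hφ
  have h2 : infDist x (P.K ∪ {z}) = 0 := by
    by_contra h
    have : 0 < ε * infDist x (P.K ∪ {z}) := mul_pos hε (lt_of_le_of_ne h0 (Ne.symm h))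
    linarith
  apply phiE_dist P z x h2
  rintro rfl
  rw [h2] at hφ; linarith

open Classical in
def sphV (x : Rn N) : ℝ := if phiE P z ε x < r then 0 else P.u x

def sphL : Set (Rn N) := (P.K \ ball 0 r) ∪ {x | phiE P z ε x = r}

theorem sphV_lt {x : Rn N} (h : phiE P z ε x < r) : sphV P z ε r =ᶠ[𝓝 x] fun _ => 0 := by
  filter_upwards [(phiE_cont P z ε).continuousAt.eventually (gt_mem_nhds h)] with y hy
  simp [sphV, hy]

theorem sphV_gt {x : Rn N} (h : r < phiE P z ε x) : sphV P z ε r =ᶠ[𝓝 x] P.u := by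
  filter_upwards [(phiE_cont P z ε).continuousAt.eventually (lt_mem_nhds h)] with y hy
  simp [sphV, not_lt.2 hy.le]

def sphPair : MSPair N where
  K := sphL P z ε r
  u := sphV P z ε r
  closed := (P.closed.sdiff isOpen_ball).union (isClosed_eq (phiE_cont P z ε) continuous_const)
  lip := by
    intro x hx
    simp only [sphL, mem_compl_iff, mem_union, not_or, mem_ofPred_eq] at hx
    rcases lt_or_gt_of_ne hx.2 with h | h
    · refine ⟨_, mem_nhdsWithin_of_mem_nhds (sphV_lt P z ε r h), 0, ?_⟩
      intro a ha b hb
      simp only [mem_ofPred_eq] at ha hb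
      simp [ha, hb]
    · have hxK := phiE_gt P z ε r h hx.1
      obtain ⟨t, ht, C, hC⟩ := P.lip x hxK
      rw [P.closed.isOpen_compl.nhdsWithin_eq hxK] at ht
      refine ⟨_, mem_nhdsWithin_of_mem_nhds (inter_mem ht (sphV_gt P z ε r h)), C, ?_⟩
      intro a ha b hb
      rw [show sphV P z ε r a = P.u a from ha.2, show sphV P z ε r b = P.u b from hb.2]
      exact hC ha.1 hb.1
  integ := by
    intro R hR
    have hm1 : MeasurableSet {x | phiE P z ε x < r} := (isOpen_lt (phiE_cont P z ε) continuous_const).measurableSet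
    have hm2 : MeasurableSet {x | r < phiE P z ε x} := (isOpen_lt continuous_const (phiE_cont P z ε)).measurableSet
    have hsub : ball 0 R \ sphL P z ε r ⊆ {x | phiE P z ε x < r} ∪ ({x | r < phiE P z ε x} ∩ (ball 0 R \ P.K)) := by
      rintro x ⟨hx, hxL⟩
      simp only [sphL, mem_union, not_or, mem_ofPred_eq] at hxL
      rcases lt_or_gt_of_ne hxL.2 with h | h
      · exact Or.inl h
      · exact Or.inr ⟨h, hx, phiE_gt P z ε r h hxL.1⟩
    refine IntegrableOn.mono_set ?_ hsub
    apply IntegrableOn.union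
    · apply (integrableOn_zero (ε' := ℝ)).congr_fun _ hm1
      intro x hx
      simp only
      rw [(sphV_lt P z ε r hx).gradient_eq, (sphV_lt P z ε r hx).eq_of_nhds]; simp
    · have := (P.integ R hR).mono_set (inter_subset_right (s := {x | r < phiE P z ε x}))
      apply this.congr_fun _ (hm2.inter (measurableSet_ball.diff P.closed.measurableSet))
      intro x hx
      simp only
      rw [(sphV_gt P z ε r hx.1).gradient_eq, (sphV_gt P z ε r hx.1).eq_of_nhds]

theorem sph_competitor (hε : 0 < ε) (hr : 0 < r) (hz : ‖z‖ = 2 * r) :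
    Competitor N P (sphPair P z ε r) (ball 0 r) := by
  refine ⟨?_, ?_, ?_⟩
  · ext x
    simp only [sphPair, sphL, Set.mem_sdiff, mem_union, mem_ofPred_eq]
    constructor
    · rintro ⟨h | h, hb⟩
      · exact h
      · exact ⟨phiE_out P z ε r hε hr hz hb h.le, hb⟩
    · rintro ⟨h, hb⟩; exact ⟨Or.inl ⟨h, hb⟩, hb⟩
  · intro x hx
    simp only [mem_union, not_or] at hx
    have : ¬ phiE P z ε x < r := fun h => hx.1.2 (phiE_out P z ε r hε hr hz hx.1.1 h.le)
    simp [sphPair, sphV, this]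
  · intro x hx y hy hne heq
    apply hne
    simp only [mem_union, not_or] at hx hy
    have hgt : ∀ w, w ∉ ball (0 : Rn N) r ∧ w ∉ P.K → r < phiE P z ε w := by
      intro w hw
      by_contra h
      exact hw.2 (phiE_out P z ε r hε hr hz hw.1 (not_lt.1 h))
    have hmem : ∀ w, w ∉ ball (0 : Rn N) r ∧ w ∉ P.K → w ∈ (sphPair P z ε r).Kᶜ := by
      intro w hw
      simp only [sphPair, sphL, mem_compl_iff, mem_union, mem_ofPred_eq, not_or]
      exact ⟨fun h => hw.2 h.1, (hgt w hw).ne'⟩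
    set C := connectedComponentIn (sphPair P z ε r).Kᶜ x with hC
    have hyC : y ∈ C := by rw [heq]; exact mem_connectedComponentIn (hmem y hy)
    have hxC : x ∈ C := mem_connectedComponentIn (hmem x hx)
    have hpre : IsPreconnected C := isPreconnected_connectedComponentIn
    have hCs : C ⊆ (sphPair P z ε r).Kᶜ := connectedComponentIn_subset _ _
    have hCO : C ⊆ {w | r < phiE P z ε w} := by
      have o1 : IsOpen {w | r < phiE P z ε w} := isOpen_lt continuous_const (phiE_cont P z ε)
      have o2 : IsOpen {w | phiE P z ε w < r} := isOpen_lt (phiE_cont P z ε) continuous_const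
      refine hpre.subset_left_of_subset_union o1 o2 ?_ ?_ ⟨x, hxC, hgt x hx⟩
      · rw [Set.disjoint_left]; intro a ha hb; exact lt_asymm (show r < phiE P z ε a from ha) hb
      · intro w hw
        have := hCs hw
        simp only [sphPair, sphL, mem_compl_iff, mem_union, mem_ofPred_eq, not_or] at this
        rcases lt_or_gt_of_ne this.2 with h | h
        · exact Or.inr h
        · exact Or.inl h
    have hCK : C ⊆ P.Kᶜ := by
      intro w hw
      have := hCs hw
      simp only [sphPair, sphL, mem_compl_iff, mem_union, mem_ofPred_eq, not_or] at this
      exact phiE_gt P z ε r (hCO hw) this.1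
    exact connectedComponentIn_eq (hpre.subset_connectedComponentIn hxC hCK hyC)

theorem sph_gamma (hN : 1 ≤ N) (hε : 0 < ε) (hε2 : ε < 1/2) (hr : 0 < r) (hz : ‖z‖ = 2 * r) :
    μH[(N:ℝ)-1] {x | phiE P z ε x = r} ≤ oR ((1-ε)⁻¹ ^ (N-1)) *
      (oR (r^(N-1)) * omH N) := by
  have e1 : (N:ℝ) - 1 = ((N-1 : ℕ) : ℝ) := by push_cast [hN]; ring
  set G := {x | phiE P z ε x = r}
  have h0 : ∀ x ∈ G, 0 < ‖x‖ := by
    intro x hx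
    by_contra h
    have : x = 0 := by simpa using h
    subst this
    have hx' : ‖(0 : Rn N)‖ + ε * infDist (0 : Rn N) (P.K ∪ {z}) = r := hx
    have : infDist (0 : Rn N) (P.K ∪ {z}) ≤ dist 0 z := infDist_le_dist_of_mem (by simp)
    rw [dist_zero_left, hz] at this
    simp only [norm_zero, zero_add] at hx'
    nlinarith
  let f : G → Rn N := fun x => (r / ‖(x : Rn N)‖) • (x : Rn N)
  have hanti : AntilipschitzWith (Real.toNNReal (1-ε)⁻¹) f := by
    apply AntilipschitzWith.of_le_mul_dist
    rintro ⟨x, hx⟩ ⟨y, hy⟩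
    have hpx := h0 x hx
    have hpy := h0 y hy
    have hx' : ‖x‖ + ε * infDist x (P.K ∪ {z}) = r := hx
    have hy' : ‖y‖ + ε * infDist y (P.K ∪ {z}) = r := hy
    have hd : |infDist x (P.K ∪ {z}) - infDist y (P.K ∪ {z})| ≤ ‖x - y‖ := by
      have := (lipschitz_infDist_pt (P.K ∪ {z})).dist_le_mul x y
      simpa [Real.dist_eq, dist_eq_norm] using this
    have hn : |‖x‖ - ‖y‖| ≤ ε * ‖x - y‖ := by
      have : ‖x‖ - ‖y‖ = ε * -(infDist x (P.K ∪ {z}) - infDist y (P.K ∪ {z})) := by linarith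
      rw [this, abs_mul, abs_neg, abs_of_pos hε]; gcongr
    have hle : ‖x‖ ≤ r := by
      have : 0 ≤ ε * infDist x (P.K ∪ {z}) := mul_nonneg hε.le infDist_nonneg
      linarith
    simp only [f, Subtype.dist_eq, dist_eq_norm]
    rw [Real.coe_toNNReal _ (by rw [inv_nonneg]; linarith), le_inv_mul_iff₀ (by linarith)]
    have hid : x - y = (‖x‖ / r) • ((r / ‖x‖) • x - (r / ‖y‖) • y) + ((‖x‖ - ‖y‖) / r) • ((r / ‖y‖) • y) := by
      rw [smul_sub, smul_smul, smul_smul, smul_smul]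
      have a1 : ‖x‖ / r * (r / ‖x‖) = 1 := by field_simp
      have a2 : (‖x‖ - ‖y‖) / r * (r / ‖y‖) = ‖x‖ / r * (r / ‖y‖) - 1 := by field_simp
      rw [a1, a2, sub_smul]; simp
    have hb : ‖x - y‖ ≤ ‖(r / ‖x‖) • x - (r / ‖y‖) • y‖ + |‖x‖ - ‖y‖| := by
      conv_lhs => rw [hid]
      refine (norm_add_le _ _).trans ?_
      rw [norm_smul, norm_smul, norm_smul, Real.norm_of_nonneg (by positivity : 0 ≤ ‖x‖/r), Real.norm_of_nonneg (by positivity : 0 ≤ r/‖y‖)]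
      apply add_le_add
      · apply mul_le_of_le_one_left (norm_nonneg _); rw [div_le_one hr]; exact hle
      · rw [Real.norm_eq_abs, abs_div, abs_of_pos hr]
        apply le_of_eq; field_simp
    linarith
  have h2 := hanti.le_hausdorffMeasure_image (d := ((N-1:ℕ):ℝ)) (by positivity) univ
  have h3 : (μH[((N-1:ℕ):ℝ)] : Measure G) univ = μH[((N-1:ℕ):ℝ)] G := by
    rw [← isometry_subtype_coe.hausdorffMeasure_image (Or.inl (by positivity)), image_univ, Subtype.range_coe]
  rw [e1, ← h3]
  refine h2.trans ?_
  have e2 : ((Real.toNNReal (1-ε)⁻¹ : ℝ≥0∞)) ^ (((N-1:ℕ):ℝ)) = oR ((1-ε)⁻¹ ^ (N-1)) := by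
    rw [ENNReal.rpow_natCast, ENNReal.ofReal_pow (by rw [inv_nonneg]; linarith)]; rfl
  rw [e2]
  gcongr
  have h4 : f '' univ ⊆ r • sphere (0 : Rn N) 1 := by
    rintro _ ⟨⟨x, hx⟩, -, rfl⟩
    refine ⟨‖x‖⁻¹ • x, ?_, ?_⟩
    · simp [norm_smul, (h0 x hx).ne']
    · simp only [f, smul_smul]; rfl
  refine (measure_mono h4).trans ?_
  rw [Measure.hausdorffMeasure_smul₀ (by positivity) hr.ne', omH, e1, ENNReal.smul_def, smul_eq_mul]
  gcongr
  rw [NNReal.rpow_natCast, ENNReal.ofReal_pow hr.le, ENNReal.coe_pow]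
  gcongr
  rw [ENNReal.ofReal, ENNReal.coe_le_coe]; apply le_of_eq; ext; simp [abs_of_pos hr, hr.le]
end

theorem sphere_comp {N : ℕ} (hN : 1 ≤ N) (P : MSPair N) (hmin : IsGlobalMin N P) {r : ℝ} (hr : 0 < r) :
    MSEnergy N P (ball 0 r) ≤ oR (r^(N-1)) * omH N := by
  have : Nonempty (Fin N) := ⟨⟨0, hN⟩⟩
  obtain ⟨z, hz⟩ : ∃ z : Rn N, ‖z‖ = 2 * r := by
    have := (NormedSpace.sphere_nonempty (E := Rn N) (x := 0) (r := 2 * r)).2 (by positivity)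
    obtain ⟨z, hz⟩ := this
    exact ⟨z, by simpa using hz⟩
  let ε : ℕ → ℝ := fun k => 1 / ((k:ℝ) + 3)
  have hε : ∀ k, 0 < ε k := fun k => by positivity
  have hε2 : ∀ k, ε k < 1/2 := fun k => by
    simp only [ε]; apply one_div_lt_one_div_of_lt (by norm_num)
    have : (0:ℝ) ≤ k := by positivity
    linarith
  have hεt : Tendsto ε atTop (𝓝 0) := by
    have := tendsto_one_div_add_atTop_nhds_zero_nat (𝕜 := ℝ)
    have h2 := this.comp (tendsto_add_atTop_nat 2)
    refine h2.congr fun k => ?_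
    simp only [ε, Function.comp]; push_cast; ring
  let F : ℕ → Rn N → ℝ≥0∞ := fun k => {x | r < phiE P z (ε k) x}.indicator (fun x => oR (‖gradient P.u x‖ ^ 2))
  have hmS : ∀ k, MeasurableSet {x | r < phiE P z (ε k) x} := fun k => (isOpen_lt continuous_const (phiE_cont P z (ε k))).measurableSet
  have hb : ∀ k, MSEnergy N P (ball 0 r) ≤ (∫⁻ x in ball 0 r \ P.K, F k x) + oR ((1-ε k)⁻¹ ^ (N-1)) *
      (oR (r^(N-1)) * omH N) := by
    intro k
    refine (hmin 0 r hr (sphPair P z (ε k) r) (sph_competitor P z _ r (hε k) hr hz)).trans ?_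
    refine add_le_add ?_ ?_
    · rw [← lintegral_indicator (measurableSet_ball.diff (sphPair P z (ε k) r).closed.measurableSet),
        ← lintegral_indicator (measurableSet_ball.diff P.closed.measurableSet)]
      apply lintegral_mono
      intro x
      by_cases hx : x ∈ ball 0 r \ (sphPair P z (ε k) r).K
      · simp only
        rw [indicator_of_mem hx]
        have hxL := hx.2
        simp only [sphPair, sphL, mem_union, not_or, mem_ofPred_eq] at hxL
        rcases lt_or_gt_of_ne hxL.2 with h | h
        · have : gradient (sphPair P z (ε k) r).u x = 0 := by
            have e := (sphV_lt P z (ε k) r h).gradient_eq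
            change gradient (sphV P z (ε k) r) x = 0
            rw [e]; simp
          rw [this]; simp
        · have hxK := phiE_gt P z _ r h hxL.1
          rw [indicator_of_mem (show x ∈ ball 0 r \ P.K from ⟨hx.1, hxK⟩)]
          simp only [F]
          rw [indicator_of_mem (show x ∈ {x | r < phiE P z (ε k) x} from h)]
          have e := (sphV_gt P z (ε k) r h).gradient_eq
          change oR (‖gradient (sphV P z (ε k) r) x‖^2) ≤ _
          rw [e]
      · simp only
        rw [indicator_of_notMem hx]; simp
    · refine (measure_mono ?_).trans (sph_gamma P z (ε k) r hN (hε k) (hε2 k) hr hz)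
      rintro x ⟨h | h, hb⟩
      · exact absurd hb h.2
      · exact h
  have ht1 : Tendsto (fun k => ∫⁻ x in ball 0 r \ P.K, F k x) atTop (𝓝 (∫⁻ x in ball 0 r \ P.K, 0)) := by
    apply tendsto_lintegral_of_dominated_convergence (fun x => oR (‖gradient P.u x‖ ^ 2))
    · exact fun k => (meas_e P.u).indicator (hmS k)
    · intro k; filter_upwards with x; exact indicator_le_self _ _ x
    · exact (lint_grad_fin P hr).ne
    · filter_upwards [ae_restrict_mem (measurableSet_ball.diff P.closed.measurableSet)] with x hx
      have hxr : ‖x‖ < r := by simpa using hx.1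
      apply tendsto_const_nhds.congr'
      have : Tendsto (fun k => phiE P z (ε k) x) atTop (𝓝 (‖x‖ + 0 * infDist x (P.K ∪ {z}))) :=
        tendsto_const_nhds.add (hεt.mul_const _)
      rw [zero_mul, add_zero] at this
      filter_upwards [this.eventually (gt_mem_nhds hxr)] with k hk
      simp only [F]
      rw [indicator_of_notMem]
      simp only [mem_ofPred_eq, not_lt]; exact hk.le
  have ht2 : Tendsto (fun k => oR ((1-ε k)⁻¹ ^ (N-1)) * (oR (r^(N-1)) * omH N)) atTop
      (𝓝 (oR ((1-0)⁻¹ ^ (N-1)) * (oR (r^(N-1)) * omH N))) := by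
    apply ENNReal.Tendsto.mul_const
    · apply (ENNReal.continuous_ofReal.tendsto _).comp
      exact (((tendsto_const_nhds.sub hεt).inv₀ (by norm_num)).pow _)
    · left; simp
  have := ge_of_tendsto' (ht1.add ht2) hb
  simpa using this
end
section
theorem cover_real {N : ℕ} (d : ℕ) (hd : 1 ≤ d) (Z : Set (Rn N)) (hZ : μH[(d:ℝ)] Z ≠ ⊤) {ρ : ℝ} (hρ : 0 < ρ) (hρ1 : ρ ≤ 1) :
    ∃ (t : ℕ → Set (Rn N)) (δ : ℕ → ℝ), (∀ i, 0 < δ i ∧ δ i ≤ 2 * ρ) ∧ Z ⊆ ⋃ i, t i ∧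
      (∀ i, ∀ x ∈ t i, ∀ y ∈ t i, dist x y ≤ δ i) ∧
      ∑' i, oR (δ i ^ d) ≤ 2 ^ d * (μH[(d:ℝ)] Z + oR (2 * ρ)) := by
  have hdr : (0:ℝ) < d := by exact_mod_cast hd
  have h1 : (⨅ (t : ℕ → Set (Rn N)) (_ : Z ⊆ ⋃ n, t n) (_ : ∀ n, ediam (t n) ≤ oR ρ),
          ∑' n, ⨆ _ : (t n).Nonempty, ediam (t n) ^ (d:ℝ)) < μH[(d:ℝ)] Z + oR ρ := by
    refine lt_of_le_of_lt ?_ (ENNReal.lt_add_right hZ (by simpa using hρ : oR ρ ≠ 0))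
    rw [Measure.hausdorffMeasure_apply]
    exact le_iSup₂ (f := fun (r : ℝ≥0∞) (_ : 0 < r) => ⨅ (t : ℕ → Set (Rn N)) (_ : Z ⊆ ⋃ n, t n) (_ : ∀ n, ediam (t n) ≤ r),
          ∑' n, ⨆ _ : (t n).Nonempty, ediam (t n) ^ (d:ℝ)) (oR ρ) (by simpa using hρ)
  simp only [iInf_lt_iff] at h1
  obtain ⟨t, hc, hdm, hs⟩ := h1
  have hfin : ∀ i, ediam (t i) ≠ ⊤ := fun i => ((hdm i).trans_lt ENNReal.ofReal_lt_top).ne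
  let b : ℕ → ℝ := fun i => ρ / 2 * (1/2)^i
  have hb0 : ∀ i, 0 < b i := fun i => by positivity
  have hb1 : ∀ i, b i ≤ ρ := fun i => by
    have : ((1:ℝ)/2)^i ≤ 1 := pow_le_one₀ (by norm_num) (by norm_num)
    simp only [b]; nlinarith
  have hD : ∀ i, (ediam (t i)).toReal ≤ ρ := fun i => ENNReal.toReal_le_of_le_ofReal hρ.le (hdm i)
  refine ⟨t, fun i => (ediam (t i)).toReal + b i, fun i => ⟨?_, ?_⟩, hc, ?_, ?_⟩
  · have := hb0 i; positivity
  · linarith [hD i, hb1 i]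
  · intro i x hx y hy
    have : edist x y ≤ ediam (t i) := edist_le_ediam_of_mem hx hy
    rw [edist_dist] at this
    have := (ENNReal.ofReal_le_iff_le_toReal (hfin i)).1 this
    linarith [hb0 i]
  · have key : ∀ i, oR (((ediam (t i)).toReal + b i) ^ d) ≤
        2 ^ d * (ediam (t i) ^ (d:ℝ)) + 2 ^ d * oR (b i) := by
      intro i
      have a0 : 0 ≤ (ediam (t i)).toReal := ENNReal.toReal_nonneg
      have hr : ((ediam (t i)).toReal + b i) ^ d ≤ 2^d * (ediam (t i)).toReal ^ d + 2^d * b i := by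
        have hbb : b i ^ d ≤ b i := pow_le_of_le_one (hb0 i).le ((hb1 i).trans hρ1) (by omega)
        rcases le_total (ediam (t i)).toReal (b i) with h | h
        · calc _ ≤ (2 * b i)^d := by gcongr; linarith
            _ = 2^d * b i^d := by rw [mul_pow]
            _ ≤ 2^d * b i := by gcongr
            _ ≤ _ := by have : 0 ≤ 2^d * (ediam (t i)).toReal ^ d := by positivity
                        linarith
        · calc _ ≤ (2 * (ediam (t i)).toReal)^d := by gcongr; linarith
            _ = 2^d * (ediam (t i)).toReal^d := by rw [mul_pow]
            _ ≤ _ := by have : 0 ≤ 2^d * b i := by have := hb0 i; positivity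
                        linarith
      refine (ENNReal.ofReal_le_ofReal hr).trans ?_
      rw [ENNReal.ofReal_add (by positivity) (by have := hb0 i; positivity), ENNReal.ofReal_mul (by positivity),
        ENNReal.ofReal_mul (by positivity), ENNReal.ofReal_pow a0, ENNReal.ofReal_toReal (hfin i), ENNReal.rpow_natCast,
        ENNReal.ofReal_pow (by norm_num)]
      simp
    refine (ENNReal.tsum_le_tsum key).trans ?_
    rw [ENNReal.tsum_add, ENNReal.tsum_mul_left, ENNReal.tsum_mul_left, ← mul_add]
    gcongr 2^d * ?_
    have e1 : ∑' i, ediam (t i) ^ (d:ℝ) ≤ μH[(d:ℝ)] Z + oR ρ := by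
      refine le_trans (ENNReal.tsum_le_tsum fun i => ?_) hs.le
      rcases (t i).eq_empty_or_nonempty with h | h
      · simp [h]; omega
      · simp [h]
    have e2 : ∑' i, oR (b i) = oR ρ := by
      rw [← ENNReal.ofReal_tsum_of_nonneg (fun i => (hb0 i).le) (summable_geometric_two.mul_left (ρ/2)), tsum_mul_left, tsum_geometric_two]
      congr 1; ring
    have e3 : oR (2*ρ) = oR ρ + oR ρ := by
      rw [← ENNReal.ofReal_add hρ.le hρ.le, two_mul]
    rw [e2, e3, ← add_assoc]
    gcongr

theorem sweep {N : ℕ} (d : ℕ) (hd : 1 ≤ d) (Z : Set (Rn N)) (F : ℝ → Rn N → Rn N) {C s : ℝ} (hC : 0 < C) (hs : 0 < s)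
    (hF : ∀ t ∈ Icc 0 s, ∀ t' ∈ Icc 0 s, ∀ x ∈ Z, ∀ x' ∈ Z, dist (F t x) (F t' x') ≤ C * (|t - t'| + dist x x')) :
    μH[((d+1:ℕ):ℝ)] {w | ∃ t ∈ Icc 0 s, ∃ x ∈ Z, w = F t x} ≤ oR ((4*C)^(d+1) * s) * μH[(d:ℝ)] Z := by
  by_cases hZ : μH[(d:ℝ)] Z = ⊤
  · rw [hZ, ENNReal.mul_top]
    · exact le_top
    · simp; positivity
  let ρ : ℕ → ℝ := fun k => 1 / ((k:ℝ) + 1)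
  have hρ0 : ∀ k, 0 < ρ k := fun k => by positivity
  have hρ1 : ∀ k, ρ k ≤ 1 := fun k => by
    simp only [ρ]; rw [div_le_one (by positivity)]; linarith [(Nat.cast_nonneg k : (0:ℝ) ≤ k)]
  have hρt : Tendsto ρ atTop (𝓝 0) := tendsto_one_div_add_atTop_nhds_zero_nat
  choose T δ hδ hcov hdist hsum using fun k => cover_real d hd Z hZ (hρ0 k) (hρ1 k)
  let m : ℕ → ℕ → ℕ := fun k i => ⌊s / δ k i⌋₊ + 1
  let t : ∀ k : ℕ, (Σ i : ℕ, Fin (m k i)) → Set (Rn N) := fun k p =>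
    {w | ∃ τ ∈ Icc 0 s, (p.2 : ℝ) * δ k p.1 ≤ τ ∧ τ ≤ ((p.2 : ℝ) + 1) * δ k p.1 ∧ ∃ x ∈ Z, x ∈ T k p.1 ∧ w = F τ x}
  have hdi : ∀ k p, ediam (t k p) ≤ oR (2 * C * δ k p.1) := by
    intro k p
    apply ediam_le
    rintro _ ⟨τ, hτ, h1, h2, x, hx, hxT, rfl⟩ _ ⟨τ', hτ', h1', h2', x', hx', hxT', rfl⟩
    rw [edist_dist]
    apply ENNReal.ofReal_le_ofReal
    refine (hF τ hτ τ' hτ' x hx x' hx').trans ?_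
    have a1 : |τ - τ'| ≤ δ k p.1 := by rw [abs_le]; constructor <;> linarith
    have a2 := hdist k p.1 x hxT x' hxT'
    calc C * (|τ - τ'| + dist x x') ≤ C * (δ k p.1 + δ k p.1) := by gcongr
      _ = _ := by ring
  have hr : Tendsto (fun k => oR (2 * C * (2 * ρ k))) atTop (𝓝 0) := by
    have : Tendsto (fun k => 2 * C * (2 * ρ k)) atTop (𝓝 (2 * C * (2 * 0))) := (hρt.const_mul 2).const_mul _
    have := (ENNReal.continuous_ofReal.tendsto _).comp this
    simpa [Function.comp_def] using this
  have main := Measure.hausdorffMeasure_le_liminf_tsum ((d+1:ℕ):ℝ) {w | ∃ t ∈ Icc 0 s, ∃ x ∈ Z, w = F t x}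
    (l := atTop) (fun k => oR (2 * C * (2 * ρ k))) hr t
    (Eventually.of_forall fun k p => (hdi k p).trans (ENNReal.ofReal_le_ofReal (by have := (hδ k p.1).2; gcongr)))
    (Eventually.of_forall fun k => by
      rintro _ ⟨τ, hτ, x, hx, rfl⟩
      obtain ⟨i, hi⟩ := mem_iUnion.1 (hcov k hx)
      have hd0 := (hδ k i).1
      have hq : 0 ≤ τ / δ k i := div_nonneg hτ.1 hd0.le
      refine mem_iUnion.2 ⟨⟨i, ⟨⌊τ / δ k i⌋₊, ?_⟩⟩, τ, hτ, ?_, ?_, x, hx, hi, rfl⟩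
      · simp only [m]
        have : ⌊τ / δ k i⌋₊ ≤ ⌊s / δ k i⌋₊ := Nat.floor_le_floor (by gcongr; exact hτ.2)
        omega
      · have := Nat.floor_le hq
        simp only
        rwa [le_div_iff₀ hd0] at this
      · have := (Nat.lt_floor_add_one (τ / δ k i)).le
        simp only
        rwa [div_le_iff₀ hd0] at this)
  refine main.trans ?_
  have hbd : ∀ k, ∑' p, ediam (t k p) ^ (((d+1:ℕ):ℝ)) ≤
      oR ((2*C)^(d+1) * (s + 2 * ρ k)) * (2 ^ d * (μH[(d:ℝ)] Z + oR (2 * ρ k))) := by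
    intro k
    rw [ENNReal.tsum_sigma']
    refine le_trans ?_ (mul_le_mul_right (hsum k) _)
    rw [← ENNReal.tsum_mul_left]
    apply ENNReal.tsum_le_tsum
    intro i
    have hd0 := (hδ k i).1
    calc ∑' b : Fin (m k i), ediam (t k ⟨i, b⟩) ^ (((d+1:ℕ):ℝ)) ≤ ∑' b : Fin (m k i), oR ((2*C*δ k i)^(d+1)) := by
          apply ENNReal.tsum_le_tsum; intro b
          rw [ENNReal.rpow_natCast, ENNReal.ofReal_pow (by positivity)]
          gcongr; exact hdi k ⟨i, b⟩
      _ = (m k i) * oR ((2*C*δ k i)^(d+1)) := by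
          rw [tsum_fintype]; simp
      _ = oR ((m k i) * (2*C*δ k i)^(d+1)) := by
          rw [ENNReal.ofReal_mul (by positivity)]; simp
      _ ≤ oR ((2*C)^(d+1) * (s + 2 * ρ k) * δ k i ^ d) := by
          apply ENNReal.ofReal_le_ofReal
          have hm : (m k i : ℝ) ≤ s / δ k i + 1 := by
            simp only [m]; push_cast; linarith [Nat.floor_le (show 0 ≤ s / δ k i by positivity)]
          calc (m k i : ℝ) * (2*C*δ k i)^(d+1) ≤ (s / δ k i + 1) * (2*C*δ k i)^(d+1) := by gcongr
            _ = (2*C)^(d+1) * (s + δ k i) * δ k i ^ d := by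
                rw [mul_pow, pow_succ (δ k i)]; field_simp
            _ ≤ _ := by have := (hδ k i).2; gcongr
      _ = _ := by have := hρ0 k; rw [ENNReal.ofReal_mul (by positivity)]
  refine (liminf_le_liminf (Eventually.of_forall hbd)).trans ?_
  have ht2 : Tendsto (fun k => 2 * ρ k) atTop (𝓝 0) := by simpa using hρt.const_mul 2
  have : Tendsto (fun k => oR ((2*C)^(d+1) * (s + 2 * ρ k)) * (2 ^ d * (μH[(d:ℝ)] Z + oR (2 * ρ k)))) atTop
      (𝓝 (oR ((2*C)^(d+1) * (s + 0)) * (2 ^ d * (μH[(d:ℝ)] Z + oR 0)))) := by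
    apply ENNReal.Tendsto.mul
    · exact (ENNReal.continuous_ofReal.tendsto _).comp ((tendsto_const_nhds.add ht2).const_mul _)
    · right; apply ENNReal.mul_ne_top <;> simp [hZ]
    · apply ENNReal.Tendsto.const_mul
      · exact tendsto_const_nhds.add ((ENNReal.continuous_ofReal.tendsto _).comp ht2)
      · right; simp
    · right; simp
  rw [this.liminf_eq]
  simp only [add_zero, ENNReal.ofReal_zero]
  rw [← mul_assoc]
  gcongr
  rw [show (2:ℝ≥0∞)^d = oR (2^d) by rw [ENNReal.ofReal_pow (by norm_num)]; simp, ← ENNReal.ofReal_mul (by positivity)]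
  apply ENNReal.ofReal_le_ofReal
  calc (2*C)^(d+1) * s * 2^d ≤ (2*C)^(d+1) * s * 2^(d+1) := by gcongr <;> norm_num
    _ = (4*C)^(d+1)*s := by rw [show 4*C = 2*C*2 by ring, mul_pow (2*C) 2]; ring
end
section
theorem cone_le {k : ℕ} (hk : 1 ≤ k) (Z : Set (Rn (k+2))) (hZ : Z ⊆ sphere 0 1) :
    μH[((k+1:ℕ):ℝ)] (Ioo (0:ℝ) 1 • Z) ≤ oR (4^(k+1)) * μH[(k:ℝ)] Z := by
  have h := sweep k hk Z (fun t x => t • x) (C := 1) (s := 1) one_pos one_pos (by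
    intro t ht t' ht' x hx x' hx'
    have h1 : ‖x‖ = 1 := by simpa using hZ hx
    have e : t • x - t' • x' = (t - t') • x + t' • (x - x') := by module
    rw [dist_eq_norm, e, one_mul, dist_eq_norm]
    refine (norm_add_le _ _).trans ?_
    rw [norm_smul, norm_smul, h1, mul_one, Real.norm_eq_abs, Real.norm_of_nonneg ht'.1]
    gcongr
    exact mul_le_of_le_one_left (norm_nonneg _) ht'.2)
  simp only [mul_one] at h
  refine (measure_mono ?_).trans h
  rintro _ ⟨t, ht, x, hx, rfl⟩
  exact ⟨t, ⟨ht.1.le, ht.2.le⟩, x, hx, rfl⟩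

def nuC (k : ℕ) (C : Set (Rn (k+2))) : Measure (Sph (k+2)) :=
  ((k+2:ℕ):ℝ≥0∞)⁻¹ • ((μH[((k+1:ℕ):ℝ)] : Measure (Rn (k+2))).restrict C).toSphere

theorem nuC_apply {k : ℕ} {C : Set (Rn (k+2))} (hC : IsClosed C) {s : Set (Sph (k+2))} (hs : MeasurableSet s) :
    nuC k C s = μH[((k+1:ℕ):ℝ)] ((Ioo (0 : ℝ) 1 • ((↑) '' s : Set (Rn (k+2)))) ∩ C) := by
  rw [nuC, Measure.smul_apply, Measure.toSphere_apply' _ hs, Measure.restrict_apply' hC.measurableSet, finrank_euclideanSpace,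
    Fintype.card_fin, smul_eq_mul, ← mul_assoc, ENNReal.inv_mul_cancel, one_mul]
  · simp
  · exact ENNReal.natCast_ne_top _

theorem nuC_sigmaFinite {k : ℕ} (hk : 1 ≤ k) {C : Set (Rn (k+2))} (hC : IsClosed C)
    (hcone : ∀ t : ℝ, 0 ≤ t → ∀ x ∈ C, t • x ∈ C) (hrect : KRectifiable (k+2) k (C ∩ sphere 0 1)) :
    SigmaFinite (nuC k C) := by
  obtain ⟨f, hf, hnull⟩ := hrect
  let Y : ℕ × ℕ → Set (Sph (k+2)) := fun p => (↑) ⁻¹' (f p.1 '' closedBall 0 p.2)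
  have hYm : ∀ p, MeasurableSet (Y p) := by
    intro p
    obtain ⟨c, hc⟩ := hf p.1
    exact measurable_subtype_coe (((isCompact_closedBall _ _).image hc.continuous).measurableSet)
  have hR : ∀ i, MeasurableSet (range (f i)) := by
    intro i
    obtain ⟨c, hc⟩ := hf i
    obtain ⟨Q, hQ, e⟩ := isSigmaCompact_range hc.continuous
    rw [← e]; exact MeasurableSet.iUnion fun n => (hQ n).measurableSet
  let Z : Set (Sph (k+2)) := (↑) ⁻¹' ((C ∩ sphere (0 : Rn (k+2)) 1) \ ⋃ i, range (f i))
  have hZm : MeasurableSet Z := measurable_subtype_coe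
    ((hC.measurableSet.inter isClosed_sphere.measurableSet).diff (MeasurableSet.iUnion hR))
  let W : Set (Sph (k+2)) := (↑) ⁻¹' Cᶜ
  have hWm : MeasurableSet W := measurable_subtype_coe hC.isOpen_compl.measurableSet
  have himg : ∀ (s : Set (Rn (k+2))), ((↑) '' ((↑) ⁻¹' s : Set (Sph (k+2))) : Set (Rn (k+2))) = sphere 0 1 ∩ s :=
    fun s => Subtype.image_preimage_coe _ _
  apply Measure.sigmaFinite_of_countable (S := {W, Z} ∪ range Y) (((countable_singleton _).insert _).union (countable_range _))
  · rintro s ((rfl | rfl) | ⟨p, rfl⟩)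
    · rw [nuC_apply hC hWm, himg]
      convert (ENNReal.zero_lt_top) using 1
      convert measure_empty (μ := μH[((k+1:ℕ):ℝ)]) using 2
      rw [eq_empty_iff_forall_notMem]
      rintro _ ⟨⟨t, ht, x, hx, rfl⟩, hxC⟩
      apply hx.2
      have := hcone t⁻¹ (inv_nonneg.2 ht.1.le) _ hxC
      simpa [smul_smul, inv_mul_cancel₀ ht.1.ne'] using this
    · rw [nuC_apply hC hZm, himg]
      refine lt_of_le_of_lt ((measure_mono inter_subset_left).trans (cone_le hk _ inter_subset_left)) ?_
      rw [measure_mono_null inter_subset_right hnull]; simp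
    · rw [nuC_apply hC (hYm p), himg]
      refine lt_of_le_of_lt ((measure_mono inter_subset_left).trans (cone_le hk _ inter_subset_left)) ?_
      apply ENNReal.mul_lt_top ENNReal.ofReal_lt_top
      refine lt_of_le_of_lt (measure_mono inter_subset_right) ?_
      obtain ⟨c, hc⟩ := hf p.1
      refine lt_of_le_of_lt (hc.hausdorffMeasure_image_le (by positivity) _) ?_
      apply ENNReal.mul_lt_top
      · rw [ENNReal.rpow_natCast]; exact ENNReal.pow_lt_top ENNReal.coe_lt_top
      · exact (isCompact_closedBall _ _).measure_lt_top
  · rw [eq_univ_iff_forall]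
    intro y
    by_cases hy : (y : Rn (k+2)) ∈ C
    · by_cases hy2 : (y : Rn (k+2)) ∈ ⋃ i, range (f i)
      · obtain ⟨i, z, hz⟩ := mem_iUnion.1 hy2
        obtain ⟨j, hj⟩ := exists_nat_ge ‖z‖
        exact ⟨Y (i, j), Or.inr ⟨_, rfl⟩, z, by simpa using hj, hz⟩
      · exact ⟨Z, Or.inl (Or.inr rfl), ⟨hy, y.2⟩, hy2⟩
    · exact ⟨W, Or.inl (Or.inl rfl), hy⟩

theorem muH_cone_scale {k : ℕ} {C : Set (Rn (k+2))} (hC : IsClosed C)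
    (hcone : ∀ t : ℝ, 0 ≤ t → ∀ x ∈ C, t • x ∈ C) (r : ℝ) (hr : 0 < r) (s : Set (Rn (k+2))) :
    ((μH[((k+1:ℕ):ℝ)] : Measure (Rn (k+2))).restrict C) (r • s) = oR (r^(k+1)) * ((μH[((k+1:ℕ):ℝ)] : Measure (Rn (k+2))).restrict C) s := by
  rw [Measure.restrict_apply' hC.measurableSet, Measure.restrict_apply' hC.measurableSet]
  have : r • s ∩ C = r • (s ∩ C) := by
    rw [Set.smul_set_inter₀ hr.ne']
    congr 1
    apply Subset.antisymm
    · intro x hx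
      exact ⟨r⁻¹ • x, hcone _ (inv_nonneg.2 hr.le) x hx, by simp [smul_smul, hr.ne']⟩
    · rintro _ ⟨x, hx, rfl⟩; exact hcone _ hr.le x hx
  rw [this, Measure.hausdorffMeasure_smul₀ (by positivity) hr.ne', ENNReal.smul_def, smul_eq_mul]
  congr 1
  rw [NNReal.rpow_natCast, ENNReal.ofReal_pow hr.le, ENNReal.coe_pow]
  congr 1
  rw [ENNReal.ofReal, ENNReal.coe_inj]; ext; simp [abs_of_pos hr, hr.le]

theorem polar_cone {k : ℕ} (hk : 1 ≤ k) {C : Set (Rn (k+2))} (hC : IsClosed C)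
    (hcone : ∀ t : ℝ, 0 ≤ t → ∀ x ∈ C, t • x ∈ C) (hrect : KRectifiable (k+2) k (C ∩ sphere 0 1))
    {K : Set (Rn (k+2))} (hK : IsClosed K) (hKC : K ⊆ C) (R : ℝ) :
    Measurable (fun r : ℝ => nuC k C {y | r • (y : Rn (k+2)) ∈ K}) ∧
    μH[((k+1:ℕ):ℝ)] (K ∩ ball 0 R) = ∫⁻ r in Ioo (0:ℝ) R, oR (r^k) *
      (((k+1:ℕ):ℝ≥0∞) * nuC k C {y | r • (y : Rn (k+2)) ∈ K}) := by
  classical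
  have hsf := nuC_sigmaFinite hk hC hcone hrect
  have hsm : Measurable (fun p : ℝ × Sph (k+2) => p.1 • (p.2 : Rn (k+2))) := by fun_prop
  refine ⟨?_, ?_⟩
  · exact measurable_measure_prodMk_left (ν := nuC k C) (s := {p : ℝ × Sph (k+2) | p.1 • (p.2 : Rn (k+2)) ∈ K}) (hsm hK.measurableSet)
  have : SigmaFinite (((k+1:ℕ):ℝ≥0) • nuC k C) := inferInstance
  have h := polar_lint ((μH[((k+1:ℕ):ℝ)] : Measure (Rn (k+2))).restrict C) (k+1) (by omega) (muH_cone_scale hC hcone)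
    (((k+1:ℕ):ℝ≥0) • nuC k C) (by
      intro s hs
      rw [Measure.smul_apply, nuC_apply hC hs, Measure.restrict_apply' hC.measurableSet, ENNReal.smul_def, smul_eq_mul]; simp)
    ((K ∩ ball 0 R).indicator 1) (measurable_one.indicator (hK.measurableSet.inter measurableSet_ball))
  have hKm := hK.measurableSet.inter (measurableSet_ball (x := (0 : Rn (k+2))) (ε := R))
  have e1 : μH[((k+1:ℕ):ℝ)] (K ∩ ball 0 R) = ∫⁻ x in {0}ᶜ, (K ∩ ball 0 R).indicator 1 x ∂((μH[((k+1:ℕ):ℝ)] : Measure (Rn (k+2))).restrict C) := by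
    rw [lintegral_indicator_one hKm, Measure.restrict_restrict (measurableSet_singleton _).compl, Measure.restrict_apply hKm]
    have : NullSingletonClass (μH[((k+1:ℕ):ℝ)] : Measure (Rn (k+2))) := Measure.nullSingletonClass_hausdorff _ (by positivity)
    have e : K ∩ ball 0 R ∩ ({0}ᶜ ∩ C) = (K ∩ ball 0 R) \ {0} := by
      ext x
      constructor
      · rintro ⟨h1, h2, h3⟩; exact ⟨h1, h2⟩
      · rintro ⟨h1, h2⟩; exact ⟨h1, h2, hKC h1.1⟩
    rw [e, measure_sdiff_null (measure_singleton _)]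
  rw [e1, h, ← lintegral_indicator measurableSet_Ioi, ← lintegral_indicator measurableSet_Ioo]
  apply lintegral_congr
  intro r
  by_cases hr : 0 < r
  · rw [indicator_of_mem (show r ∈ Ioi (0:ℝ) from hr), Nat.add_sub_cancel]
    have e2 : ∀ y : Sph (k+2), ‖r • y.1‖ = r := fun y => by
      have : ‖(y : Rn (k+2))‖ = 1 := by simp
      rw [norm_smul, this, Real.norm_of_nonneg hr.le, mul_one]
    by_cases hR : r < R
    · rw [indicator_of_mem (show r ∈ Ioo (0:ℝ) R from ⟨hr, hR⟩)]
      congr 1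
      have e3 : ∀ y : Sph (k+2), (K ∩ ball 0 R).indicator (1 : Rn (k+2) → ℝ≥0∞) (r • y.1)
          = {y : Sph (k+2) | r • y.1 ∈ K}.indicator 1 y := by
        intro y
        simp only [indicator, mem_inter_iff, mem_ball_zero_iff, e2, hR, and_true, mem_ofPred_eq, Pi.one_apply]
      rw [lintegral_congr e3, lintegral_indicator_one, Measure.smul_apply, ENNReal.smul_def, smul_eq_mul]
      · simp
      · exact (measurable_const_smul r |>.comp measurable_subtype_coe) hK.measurableSet
    · rw [indicator_of_notMem (show r ∉ Ioo (0:ℝ) R from fun h => hR h.2)]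
      have e3 : ∀ y : Sph (k+2), (K ∩ ball 0 R).indicator (1 : Rn (k+2) → ℝ≥0∞) (r • y.1) = 0 := by
        intro y
        apply indicator_of_notMem
        rintro ⟨_, h⟩
        rw [mem_ball_zero_iff, e2] at h
        exact hR h
      rw [lintegral_congr e3]; simp
  · rw [indicator_of_notMem (show r ∉ Ioi (0:ℝ) from hr), indicator_of_notMem (show r ∉ Ioo (0:ℝ) R from fun h => hr h.1)]
end
section
theorem squeeze {k N : ℕ} (f : Rn k → Rn N) (A : Rn k →L[ℝ] Rn N) (v : Rn k) (hv : ‖v‖ = 1) (hA : A v = 0)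
    {L δ : ℝ} (hL : ‖A‖ ≤ L) (hδ : 0 < δ) (hδ1 : δ ≤ 1) (T : Set (Rn k))
    (hf : ∀ x ∈ T, ∀ y ∈ T, ‖f x - f y - A (x - y)‖ ≤ δ * ‖x - y‖) :
    μH[(k:ℝ)] (f '' T) ≤ oR ((L + 1)^k * δ) * cH k * volume T := by
  let S : Rn k →ₗ[ℝ] Rn k := LinearMap.transvection ((-(1-δ)) • ((innerSL ℝ v : Rn k →L[ℝ] ℝ) : Rn k →ₗ[ℝ] ℝ)) v
  have hS : ∀ x, S x = x - ((1-δ) * inner ℝ v x) • v := by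
    intro x; rw [LinearMap.transvection.apply, LinearMap.smul_apply, smul_eq_mul, neg_mul, neg_smul, ← sub_eq_add_neg]; rfl
  have hvv : inner ℝ v v = (1:ℝ) := by rw [real_inner_self_eq_norm_sq, hv]; norm_num
  have hdet : LinearMap.det S = δ := by
    rw [LinearMap.transvection.det]; simp [hv]
  have hn : ∀ x, ‖S x‖^2 = ‖x - (inner ℝ v x : ℝ) • v‖^2 + δ^2 * (inner ℝ v x : ℝ)^2 := by
    intro x
    have e1 := norm_sub_sq_real x (((1-δ) * inner ℝ v x) • v)
    have e2 := norm_sub_sq_real x ((inner ℝ v x : ℝ) • v)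
    rw [hS, e1, e2]
    simp only [inner_smul_right, norm_smul, hv, real_inner_comm v x, mul_pow, Real.norm_eq_abs, sq_abs, abs_mul]
    ring
  have hn2 : ∀ x, ‖x‖^2 = ‖x - (inner ℝ v x : ℝ) • v‖^2 + (inner ℝ v x : ℝ)^2 := by
    intro x
    have e2 := norm_sub_sq_real x ((inner ℝ v x : ℝ) • v)
    rw [e2]
    simp only [inner_smul_right, norm_smul, hv, real_inner_comm v x, mul_pow, Real.norm_eq_abs, sq_abs]
    ring
  have h1 : ∀ x, ‖x - (inner ℝ v x : ℝ) • v‖ ≤ ‖S x‖ := fun x => by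
    apply le_of_sq_le_sq _ (norm_nonneg _)
    rw [hn]; nlinarith [sq_nonneg (δ * (inner ℝ v x : ℝ))]
  have h2 : ∀ x, δ * ‖x‖ ≤ ‖S x‖ := fun x => by
    apply le_of_sq_le_sq _ (norm_nonneg _)
    rw [hn, mul_pow, hn2]
    nlinarith [sq_nonneg ‖x - (inner ℝ v x : ℝ) • v‖, mul_nonneg (sq_nonneg ‖x - (inner ℝ v x : ℝ) • v‖) (show 0 ≤ 1 - δ^2 by nlinarith)]
  have hinj : Function.Injective S := by
    rw [injective_iff_map_eq_zero]
    intro x hx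
    have := h2 x
    rw [hx, norm_zero] at this
    have : ‖x‖ ≤ 0 := by nlinarith [norm_nonneg x]
    simpa using this
  have hL0 : 0 ≤ L := (norm_nonneg _).trans hL
  have hlip : LipschitzOnWith (Real.toNNReal (L+1)) (f ∘ Function.invFun S) (S '' T) := by
    apply LipschitzOnWith.of_dist_le_mul
    rintro _ ⟨x, hx, rfl⟩ _ ⟨y, hy, rfl⟩
    rw [Function.comp, Function.comp, Function.leftInverse_invFun hinj, Function.leftInverse_invFun hinj,
      Real.coe_toNNReal _ (by positivity), dist_eq_norm, dist_eq_norm, ← map_sub]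
    have e : A (x - y) = A ((x - y) - (inner ℝ v (x-y) : ℝ) • v) := by
      rw [map_sub A (x-y), map_smul, hA, smul_zero, sub_zero]
    calc ‖f x - f y‖ = ‖(f x - f y - A (x-y)) + A (x - y)‖ := by congr 1; abel
      _ ≤ δ * ‖x - y‖ + L * ‖S (x-y)‖ := by
        refine (norm_add_le _ _).trans (add_le_add (hf x hx y hy) ?_)
        rw [e]
        refine (A.le_opNorm _).trans ?_
        gcongr
        exact h1 _
      _ ≤ (L+1) * ‖S (x-y)‖ := by nlinarith [h2 (x-y)]
  have := hlip.hausdorffMeasure_image_le (d := k) (by positivity)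
  rw [← image_comp, Function.comp_assoc, (Function.leftInverse_invFun hinj).comp_eq_id, Function.comp_id, muH_flat k,
    Measure.smul_apply, Measure.addHaar_image_linearMap, hdet, abs_of_pos hδ, ENNReal.rpow_natCast, smul_eq_mul] at this
  refine this.trans (le_of_eq ?_)
  rw [ENNReal.ofReal_mul (by positivity), ENNReal.ofReal_pow (by positivity)]
  change oR (L+1) ^ k * _ = _
  ring

theorem degenerate_null {k N : ℕ} (f : Rn k → Rn N) {L : ℝ≥0} (hf : LipschitzWith L f) :
    μH[(k:ℝ)] (f '' {x | DifferentiableAt ℝ f x ∧ ∃ v, v ≠ 0 ∧ fderiv ℝ f x v = 0}) = 0 := by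
  have key : ∀ R : ℕ, μH[(k:ℝ)] (f '' ({x | DifferentiableAt ℝ f x ∧ ∃ v, v ≠ 0 ∧ fderiv ℝ f x v = 0} ∩ ball 0 R)) = 0 := by
    intro R
    set s := {x | DifferentiableAt ℝ f x ∧ ∃ v, v ≠ 0 ∧ fderiv ℝ f x v = 0} ∩ ball 0 (R:ℝ) with hs
    rcases s.eq_empty_or_nonempty with h0 | hne
    · rw [h0]; simp
    have hfin : volume s ≠ ⊤ := measure_ne_top_of_subset inter_subset_right measure_ball_lt_top.ne
    have hb : ∀ δ : ℝ, 0 < δ → δ ≤ 1 → μH[(k:ℝ)] (f '' s) ≤ oR ((L+1)^k*δ) * cH k * volume s := by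
      intro δ hδ hδ1
      obtain ⟨t, A, hd, hm, hc, hap, hA⟩ := exists_partition_approximatesLinearOn_of_hasFDerivWithinAt f s (fderiv ℝ f)
        (fun x hx => hx.1.1.hasFDerivAt.hasFDerivWithinAt) (fun _ => δ.toNNReal) (fun _ => by simpa using hδ)
      have h1 : ∀ n, μH[(k:ℝ)] (f '' (s ∩ t n)) ≤ oR ((L+1)^k*δ) * cH k * volume (s ∩ t n) := by
        intro n
        obtain ⟨y, hy, e⟩ := hA hne n
        obtain ⟨v, hv, hv0⟩ := hy.1.2
        have hAL : ‖A n‖ ≤ L := by rw [e]; exact norm_fderiv_le_of_lipschitz ℝ hf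
        refine squeeze f (A n) (‖v‖⁻¹ • v) ?_ ?_ hAL hδ hδ1 _ ?_
        · rw [norm_smul, norm_inv, norm_norm, inv_mul_cancel₀ (norm_ne_zero_iff.2 hv)]
        · rw [e, map_smul, hv0, smul_zero]
        · intro x hx y hy
          have := hap n x hx y hy
          rwa [Real.coe_toNNReal _ hδ.le] at this
      calc μH[(k:ℝ)] (f '' s) ≤ μH[(k:ℝ)] (⋃ n, f '' (s ∩ t n)) := by
            apply measure_mono
            rw [← image_iUnion, ← inter_iUnion, inter_eq_left.2 hc]
        _ ≤ ∑' n, μH[(k:ℝ)] (f '' (s ∩ t n)) := measure_iUnion_le _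
        _ ≤ ∑' n, oR ((L+1)^k*δ) * cH k * volume (s ∩ t n) := ENNReal.tsum_le_tsum h1
        _ = oR ((L+1)^k*δ) * cH k * ∑' n, volume.restrict s (t n) := by
            rw [ENNReal.tsum_mul_left]; congr 1; congr 1; ext n
            rw [Measure.restrict_apply (hm n), inter_comm]
        _ ≤ _ := by
            gcongr
            rw [← measure_iUnion hd hm]
            exact (measure_mono (subset_univ _)).trans_eq (Measure.restrict_apply_univ s)
    have hlim : Tendsto (fun δ : ℝ => oR ((L+1)^k*δ) * cH k * volume s) (𝓝[>] 0) (𝓝 0) := by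
      have : Tendsto (fun δ : ℝ => oR ((L+1)^k*δ)) (𝓝[>] 0) (𝓝 0) := by
        have h : Tendsto (fun δ : ℝ => ((L:ℝ)+1)^k*δ) (𝓝 0) (𝓝 (((L:ℝ)+1)^k*0)) := tendsto_id.const_mul _
        rw [mul_zero] at h
        simpa using (ENNReal.tendsto_ofReal h).mono_left nhdsWithin_le_nhds
      have h2 := ENNReal.Tendsto.mul_const (b := cH k) this (Or.inr (cH_ne_top k))
      have h3 := ENNReal.Tendsto.mul_const (b := volume s) h2 (Or.inr hfin)
      simpa using h3
    refine le_antisymm (ge_of_tendsto hlim ?_) (zero_le)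
    filter_upwards [Ioc_mem_nhdsGT (show (0:ℝ) < 1 by norm_num)] with δ h
    exact hb δ h.1 h.2
  have : {x | DifferentiableAt ℝ f x ∧ ∃ v, v ≠ 0 ∧ fderiv ℝ f x v = 0} =
      ⋃ R : ℕ, ({x | DifferentiableAt ℝ f x ∧ ∃ v, v ≠ 0 ∧ fderiv ℝ f x v = 0} ∩ ball 0 (R:ℝ)) := by
    rw [← inter_iUnion, iUnion_ball_nat, inter_univ]
  rw [this, image_iUnion, measure_iUnion_null_iff]
  exact key

def Flat {N : ℕ} (δ : ℝ) (ν : Rn N) (Q : Set (Rn N)) : Prop :=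
  (∀ x ∈ Q, |inner ℝ x ν| ≤ δ * ‖x‖) ∧ ∀ x ∈ Q, ∀ y ∈ Q, |inner ℝ (x - y) ν| ≤ δ * ‖x - y‖

theorem Flat.closure {N : ℕ} {δ : ℝ} {ν : Rn N} {Q : Set (Rn N)} (h : Flat δ ν Q) : Flat δ ν (closure Q) := by
  constructor
  · exact fun x hx => closure_minimal (s := Q) (t := {x | |inner ℝ x ν| ≤ δ * ‖x‖}) h.1 (isClosed_le (by fun_prop) (by fun_prop)) hx
  · intro x hx y hy
    have h1 : ∀ x ∈ Q, ∀ y ∈ _root_.closure Q, |inner ℝ (x - y) ν| ≤ δ * ‖x - y‖ := fun x hx y hy =>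
      closure_minimal (s := Q) (t := {y | |inner ℝ (x - y) ν| ≤ δ * ‖x - y‖}) (fun y hy => h.2 x hx y hy) (isClosed_le (by fun_prop) (by fun_prop)) hy
    exact closure_minimal (s := Q) (t := {x | |inner ℝ (x - y) ν| ≤ δ * ‖x - y‖}) (fun x hx => h1 x hx y hy) (isClosed_le (by fun_prop) (by fun_prop)) hx

theorem Flat.cone {N : ℕ} {δ : ℝ} {ν : Rn N} {Q : Set (Rn N)} (hQ : Q ⊆ sphere 0 1) (h : Flat δ ν Q) (hδ : 0 ≤ δ) :
    Flat (3*δ) ν (Ioo (0:ℝ) 1 • Q) := by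
  have hn : ∀ x ∈ Q, ‖x‖ = 1 := fun x hx => by simpa using hQ hx
  constructor
  · rintro _ ⟨t, ht, x, hx, rfl⟩
    have := h.1 x hx
    simp only [inner_smul_left, norm_smul, abs_mul, hn x hx] at this ⊢
    simp only [RCLike.conj_to_real, Real.norm_eq_abs]
    nlinarith [abs_nonneg t]
  · rintro _ ⟨t, ht, x, hx, rfl⟩ _ ⟨t', ht', x', hx', rfl⟩
    simp only
    have e : t • x - t' • x' = t • (x - x') + (t - t') • x' := by module
    have e2 : t • (x - x') = (t • x - t' • x') - (t - t') • x' := by rw [e]; abel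
    have h1 : |t - t'| ≤ ‖t • x - t' • x'‖ := by
      have := abs_norm_sub_norm_le (t • x) (t' • x')
      rwa [norm_smul, norm_smul, hn x hx, hn x' hx', mul_one, mul_one, Real.norm_of_nonneg ht.1.le, Real.norm_of_nonneg ht'.1.le] at this
    have h2 : t * ‖x - x'‖ ≤ ‖t • x - t' • x'‖ + |t - t'| := by
      have : ‖t • (x - x')‖ ≤ ‖t • x - t' • x'‖ + ‖(t - t') • x'‖ := by rw [e2]; exact norm_sub_le _ _
      rwa [norm_smul t (x - x'), norm_smul (t - t'), hn x' hx', mul_one, Real.norm_of_nonneg ht.1.le, Real.norm_eq_abs] at this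
    have h3 := h.2 x hx x' hx'
    have h4 := h.1 x' hx'
    rw [hn x' hx', mul_one] at h4
    calc |inner ℝ (t • x - t' • x') ν| = |t * inner ℝ (x - x') ν + (t - t') * inner ℝ x' ν| := by
          rw [e, inner_add_left, inner_smul_left, inner_smul_left]; rfl
      _ ≤ t * (δ * ‖x - x'‖) + |t - t'| * δ := by
          refine (abs_add_le _ _).trans ?_
          rw [abs_mul, abs_mul, abs_of_pos ht.1]
          gcongr
          exact ht.1.le
      _ ≤ 3 * δ * ‖t • x - t' • x'‖ := by nlinarith

theorem exists_perp {k : ℕ} (A : Rn k →L[ℝ] Rn (k+2)) (p : Rn (k+2)) :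
    ∃ ν : Rn (k+2), ‖ν‖ = 1 ∧ inner ℝ p ν = 0 ∧ ∀ x, inner ℝ (A x) ν = 0 := by
  let V : Submodule ℝ (Rn (k+2)) := LinearMap.range (A : Rn k →ₗ[ℝ] Rn (k+2)) ⊔ Submodule.span ℝ {p}
  have hV : Module.finrank ℝ V < k + 2 := by
    have h1 := Submodule.finrank_add_le_finrank_add_finrank (LinearMap.range (A : Rn k →ₗ[ℝ] Rn (k+2))) (Submodule.span ℝ {p})
    have h2 := LinearMap.finrank_range_le (A : Rn k →ₗ[ℝ] Rn (k+2))
    have h3 := finrank_span_le_card (R := ℝ) ({p} : Set (Rn (k+2)))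
    simp at h2 h3
    change Module.finrank ℝ V ≤ _ at h1
    omega
  have hne : Vᗮ ≠ ⊥ := by
    intro h
    rw [Submodule.orthogonal_eq_bot_iff] at h
    rw [h, finrank_top] at hV
    simp at hV
  obtain ⟨w, hw, hw0⟩ := Submodule.exists_mem_ne_zero_of_ne_bot hne
  rw [Submodule.mem_orthogonal] at hw
  refine ⟨‖w‖⁻¹ • w, ?_, ?_, ?_⟩
  · rw [norm_smul, norm_inv, norm_norm, inv_mul_cancel₀ (norm_ne_zero_iff.2 hw0)]
  · rw [inner_smul_right, hw p (Submodule.mem_sup_right (Submodule.mem_span_singleton_self p)), mul_zero]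
  · intro x
    rw [inner_smul_right, hw (A x) (Submodule.mem_sup_left ⟨x, rfl⟩), mul_zero]
end
section
theorem flat_param {k : ℕ} (f : Rn k → Rn (k+2)) {L : ℝ≥0} (hf : LipschitzWith L f) {δ : ℝ} (hδ : 0 < δ) (hδ1 : δ ≤ 1) :
    ∃ E : ℕ × ℕ → Set (Rn (k+2)), (∀ p, E p ⊆ sphere 0 1 ∧ ∃ ν, ‖ν‖ = 1 ∧ Flat δ ν (E p)) ∧
      μH[(k:ℝ)] ((range f ∩ sphere 0 1) \ ⋃ p, E p) = 0 := by
  classical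
  set s := {x | DifferentiableAt ℝ f x ∧ ∀ v, fderiv ℝ f x v = 0 → v = 0} with hs
  let r : (Rn k →L[ℝ] Rn (k+2)) → ℝ≥0 := fun A =>
    if h : ∃ c : ℝ, 0 < c ∧ ∀ x, ‖x‖ ≤ c * ‖A x‖ then (δ / (2 * h.choose)).toNNReal else 1
  have hr : ∀ A, r A ≠ 0 := by
    intro A
    simp only [r]
    split_ifs with h
    · have := h.choose_spec.1
      simp only [ne_eq, Real.toNNReal_eq_zero, not_le]; positivity
    · exact one_ne_zero
  have hap0 : ∀ A : Rn k →L[ℝ] Rn (k+2), (∀ v, A v = 0 → v = 0) → ∃ c : ℝ, 0 < c ∧ (∀ x, ‖x‖ ≤ c * ‖A x‖) ∧ (r A : ℝ) = δ / (2*c) := by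
    intro A hA
    have h : ∃ c : ℝ, 0 < c ∧ ∀ x, ‖x‖ ≤ c * ‖A x‖ := by
      obtain ⟨K, hK, h⟩ := LinearMap.exists_antilipschitzWith (A : Rn k →ₗ[ℝ] Rn (k+2)) (LinearMap.ker_eq_bot'.2 hA)
      exact ⟨K, hK, fun x => by simpa using h.le_mul_dist x 0⟩
    refine ⟨h.choose, h.choose_spec.1, h.choose_spec.2, ?_⟩
    have := h.choose_spec.1
    simp only [r, dif_pos h]
    rw [Real.coe_toNNReal _ (by positivity)]
  obtain ⟨t, A, hd, hm, hc, hap, hA⟩ := exists_partition_approximatesLinearOn_of_hasFDerivWithinAt f s (fderiv ℝ f)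
        (fun x hx => hx.1.hasFDerivAt.hasFDerivWithinAt) r hr
  let q := TopologicalSpace.denseSeq (Rn (k+2))
  refine ⟨fun p => f '' (s ∩ t p.1) ∩ sphere 0 1 ∩ ball (q p.2) (δ/2), fun p => ⟨fun x hx => hx.1.2, ?_⟩, ?_⟩
  · rcases (f '' (s ∩ t p.1) ∩ sphere 0 1 ∩ ball (q p.2) (δ/2)).eq_empty_or_nonempty with h0 | ⟨b, hb⟩
    · obtain ⟨ν, h1, -⟩ := exists_perp (0 : Rn k →L[ℝ] Rn (k+2)) 0
      exact ⟨ν, h1, by beta_reduce; rw [h0]; exact ⟨fun _ h => h.elim, fun _ h => h.elim⟩⟩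
    · obtain ⟨ν, h1, h2, h3⟩ := exists_perp (A p.1) b
      obtain ⟨⟨⟨y0, hy0, -⟩, -⟩, -⟩ := id hb
      obtain ⟨y, hy, e⟩ := hA ⟨y0, hy0.1⟩ p.1
      obtain ⟨c, hc0, hc1, hc2⟩ := hap0 (A p.1) (by rw [e]; exact hy.2)
      refine ⟨ν, h1, ?_, ?_⟩
      · intro x hx
        have hx1 : ‖x‖ = 1 := by simpa using hx.1.2
        rw [hx1, mul_one]
        have : inner ℝ x ν = inner ℝ (x - b) ν := by rw [inner_sub_left, h2, sub_zero]
        rw [this]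
        refine (abs_real_inner_le_norm _ _).trans ?_
        rw [h1, mul_one, ← dist_eq_norm]
        have a1 := mem_ball.1 hx.2
        have a2 := mem_ball'.1 hb.2
        linarith [dist_triangle x (q p.2) b]
      · rintro _ ⟨⟨⟨x, hx, rfl⟩, -⟩, -⟩ _ ⟨⟨⟨x', hx', rfl⟩, -⟩, -⟩
        have a1 := hap p.1 x hx x' hx'
        rw [hc2] at a1
        have a2 := hc1 (x - x')
        have a3 : ‖x - x'‖ ≤ 2 * c * ‖f x - f x'‖ := by
          have b1 : ‖A p.1 (x - x')‖ ≤ ‖f x - f x'‖ + δ / (2*c) * ‖x - x'‖ := by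
            calc ‖A p.1 (x - x')‖ = ‖(f x - f x') - (f x - f x' - A p.1 (x - x'))‖ := by congr 1; abel
              _ ≤ _ := (norm_sub_le _ _).trans (by gcongr)
          have b2 : c * (δ / (2*c) * ‖x - x'‖) = δ/2 * ‖x - x'‖ := by field_simp
          have b3 : δ/2 * ‖x - x'‖ ≤ 1/2 * ‖x - x'‖ := by gcongr
          have b4 : ‖x - x'‖ ≤ c * (‖f x - f x'‖ + δ / (2*c) * ‖x - x'‖) := a2.trans (by gcongr)
          rw [mul_add, b2] at b4
          linarith
        have e1 : inner ℝ (f x - f x') ν = inner ℝ (f x - f x' - A p.1 (x - x')) ν := by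
          rw [inner_sub_left (f x - f x'), h3, sub_zero]
        rw [e1]
        refine (abs_real_inner_le_norm _ _).trans ?_
        rw [h1, mul_one]
        refine a1.trans ?_
        calc δ / (2*c) * ‖x - x'‖ ≤ δ / (2*c) * (2 * c * ‖f x - f x'‖) := by gcongr
          _ = δ * ‖f x - f x'‖ := by field_simp
  · have hsub : (range f ∩ sphere 0 1) \ ⋃ p : ℕ × ℕ, f '' (s ∩ t p.1) ∩ sphere 0 1 ∩ ball (q p.2) (δ/2) ⊆
        f '' {x | DifferentiableAt ℝ f x ∧ ∃ v, v ≠ 0 ∧ fderiv ℝ f x v = 0} ∪ f '' {x | ¬ DifferentiableAt ℝ f x} := by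
      rintro _ ⟨⟨⟨x, rfl⟩, hx1⟩, hx2⟩
      by_cases hdx : DifferentiableAt ℝ f x
      · by_cases hv : ∃ v, v ≠ 0 ∧ fderiv ℝ f x v = 0
        · exact Or.inl ⟨x, ⟨hdx, hv⟩, rfl⟩
        · exfalso
          apply hx2
          have hxs : x ∈ s := ⟨hdx, fun v h => by_contra fun h' => hv ⟨v, h', h⟩⟩
          obtain ⟨n, hn⟩ := mem_iUnion.1 (hc hxs)
          obtain ⟨j, hj1⟩ := (TopologicalSpace.denseRange_denseSeq (Rn (k+2))).exists_mem_open isOpen_ball ⟨f x, mem_ball_self (show 0 < δ/2 by positivity)⟩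
          exact mem_iUnion.2 ⟨(n, j), ⟨⟨x, ⟨hxs, hn⟩, rfl⟩, hx1⟩, mem_ball_comm.1 hj1⟩
      · exact Or.inr ⟨x, hdx, rfl⟩
    refine measure_mono_null hsub (measure_union_null (degenerate_null f hf) ?_)
    have h0 : volume {x | ¬ DifferentiableAt ℝ f x} = 0 := hf.ae_differentiableAt
    refine le_antisymm ((hf.hausdorffMeasure_image_le (by positivity) _).trans ?_) zero_le
    rw [muH_flat, Measure.smul_apply, h0]; simp

theorem flat_cover {k : ℕ} (hk : 1 ≤ k) {C : Set (Rn (k+2))}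
    (hcone : ∀ t : ℝ, 0 ≤ t → ∀ x ∈ C, t • x ∈ C) (hrect : KRectifiable (k+2) k (C ∩ sphere 0 1)) {δ : ℝ} (hδ : 0 < δ) (hδ1 : δ ≤ 1) :
    ∃ G : ℕ × ℕ × ℕ → Set (Rn (k+2)), (∀ p, IsClosed (G p) ∧ ∃ ν, ‖ν‖ = 1 ∧ Flat δ ν (G p)) ∧
      μH[((k+1:ℕ):ℝ)] ((C ∩ ball 0 1) \ ⋃ p, G p) = 0 := by
  obtain ⟨f, hf, hnull⟩ := hrect
  choose L hL using hf
  choose E hE1 hE2 using fun i => flat_param (f i) (hL i) (show 0 < δ/3 by positivity) (by linarith)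
  refine ⟨fun p => closure (Ioo (0:ℝ) 1 • E p.1 p.2), fun p => ⟨isClosed_closure, ?_⟩, ?_⟩
  · obtain ⟨h1, ν, h2, h3⟩ := hE1 p.1 p.2
    refine ⟨ν, h2, Flat.closure ?_⟩
    have := Flat.cone h1 h3 (by positivity)
    rwa [mul_div_cancel₀ δ (by norm_num : (3:ℝ) ≠ 0)] at this
  · let Z := (C ∩ sphere (0 : Rn (k+2)) 1) \ ⋃ p : ℕ × ℕ × ℕ, E p.1 p.2
    have hZ : μH[(k:ℝ)] Z = 0 := by
      refine measure_mono_null (t := ((C ∩ sphere 0 1) \ ⋃ i, range (f i)) ∪ ⋃ i, ((range (f i) ∩ sphere 0 1) \ ⋃ p, E i p)) ?_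
        (measure_union_null hnull (measure_iUnion_null hE2))
      rintro x ⟨h1, h2⟩
      by_cases h : x ∈ ⋃ i, range (f i)
      · obtain ⟨i, hi⟩ := mem_iUnion.1 h
        refine Or.inr (mem_iUnion.2 ⟨i, ⟨hi, h1.2⟩, fun h => h2 ?_⟩)
        obtain ⟨p, hp⟩ := mem_iUnion.1 h
        exact mem_iUnion.2 ⟨(i, p), hp⟩
      · exact Or.inl ⟨h1, h⟩
    have hcz : μH[((k+1:ℕ):ℝ)] (Ioo (0:ℝ) 1 • Z) = 0 := by
      refine le_antisymm ((cone_le hk Z fun x hx => hx.1.2).trans ?_) zero_le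
      rw [hZ, mul_zero]
    have : NullSingletonClass (μH[((k+1:ℕ):ℝ)] : Measure (Rn (k+2))) := Measure.nullSingletonClass_hausdorff _ (by positivity)
    refine measure_mono_null (t := (Ioo (0:ℝ) 1 • Z) ∪ {0}) ?_ (measure_union_null hcz (measure_singleton _))
    rintro x ⟨⟨hxC, hxb⟩, hx⟩
    by_cases h0 : x = 0
    · exact Or.inr h0
    left
    have hn : 0 < ‖x‖ := norm_pos_iff.2 h0
    have ex : ‖x‖ • (‖x‖⁻¹ • x) = x := by rw [smul_smul, mul_inv_cancel₀ hn.ne', one_smul]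
    refine ⟨‖x‖, ⟨hn, by simpa using hxb⟩, ‖x‖⁻¹ • x, ⟨⟨hcone _ (by positivity) x hxC, ?_⟩, fun h => hx ?_⟩, ex⟩
    · simp [norm_smul, inv_mul_cancel₀ hn.ne']
    · obtain ⟨p, hp⟩ := mem_iUnion.1 h
      refine mem_iUnion.2 ⟨p, subset_closure ⟨‖x‖, ⟨hn, by simpa using hxb⟩, _, hp, ex⟩⟩
end
section
def slab {N : ℕ} (ν : Rn N) (a b : ℝ) : Set (Rn N) := {d | |inner ℝ d ν| ≤ a ∧ ‖d‖ ≤ b}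

theorem slab_compact {N : ℕ} (ν : Rn N) (a b : ℝ) : IsCompact (slab ν a b) := by
  have h : slab ν a b = closedBall 0 b ∩ {d | |inner ℝ d ν| ≤ a} := by
    ext d; simp [slab, and_comm]
  rw [h]
  exact (isCompact_closedBall _ _).inter_right (isClosed_le (by fun_prop) (by fun_prop))

theorem mink {n : ℕ} {Q : Set (Rn (n+1))} (hQ : IsCompact Q) {ν : Rn (n+1)} (hν : ‖ν‖ = 1) {δ : ℝ} (hδ0 : 0 ≤ δ) (hδ : δ ≤ 1/2)
    (hfl : Flat δ ν Q) {b D : ℝ} (hb : 0 < b) (hD : 0 < D) {ε : ℝ≥0∞} (hε : ε ≠ 0) :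
    ∀ᶠ s : ℝ in 𝓝[>] 0, cH n * volume (Q + slab ν (b*s) (D*s)) ≤
      oR (s * (2*b + 4*D*δ)) * (μH[(n:ℝ)] Q + ε) := by
  obtain ⟨Ψ, hmp, hin, hno⟩ := exists_split ν hν
  have hΨc : Continuous Ψ := LinearMap.continuous_of_finiteDimensional (Ψ : (ℝ × Rn n) →ₗ[ℝ] Rn (n+1))
  have hΨs : Continuous Ψ.symm := LinearMap.continuous_of_finiteDimensional (Ψ.symm : Rn (n+1) →ₗ[ℝ] (ℝ × Rn n))
  let π : Rn (n+1) → Rn n := fun x => (Ψ.symm x).2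
  have hsplit : ∀ x, ‖x‖^2 = (inner ℝ x ν)^2 + ‖π x‖^2 := by
    intro x
    have h1 := hno (Ψ.symm x).1 (Ψ.symm x).2
    have h2 := hin (Ψ.symm x).1 (Ψ.symm x).2
    rw [Prod.mk.eta, LinearEquiv.apply_symm_apply] at h1 h2
    rw [h1, h2]
  have hπsub : ∀ x y, π x - π y = π (x - y) := fun x y => by simp [π]
  have hπle : ∀ x, ‖π x‖ ≤ ‖x‖ := fun x => by
    apply le_of_sq_le_sq _ (norm_nonneg _)
    rw [hsplit x]; nlinarith [sq_nonneg (inner ℝ x ν : ℝ)]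
  have hxle : ∀ x, ‖x‖ ≤ |inner ℝ x ν| + ‖π x‖ := fun x => by
    apply le_of_sq_le_sq _ (by positivity)
    rw [hsplit x]; nlinarith [sq_abs (inner ℝ x ν : ℝ), mul_nonneg (abs_nonneg (inner ℝ x ν : ℝ)) (norm_nonneg (π x))]
  have hπlip : LipschitzWith 1 π := LipschitzWith.of_dist_le_mul fun x y => by
    rw [dist_eq_norm, dist_eq_norm, hπsub, NNReal.coe_one, one_mul]; exact hπle _
  have hπQ : IsCompact (π '' Q) := hQ.image hπlip.continuous
  have hproj : cH n * volume (π '' Q) ≤ μH[(n:ℝ)] Q := by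
    have := hπlip.hausdorffMeasure_image_le (d := n) (by positivity) Q
    rwa [muH_flat, Measure.smul_apply, smul_eq_mul, ENNReal.coe_one, ENNReal.one_rpow, one_mul] at this
  have hvol : ∀ s : ℝ, 0 < s → volume (Q + slab ν (b*s) (D*s)) ≤ oR (s * (2*b + 4*D*δ)) * volume (cthickening (D*s) (π '' Q)) := by
    intro s hs
    have hM : MeasurableSet (Q + slab ν (b*s) (D*s)) := (hQ.add (slab_compact _ _ _)).measurableSet
    rw [← hmp.measure_preimage hM.nullMeasurableSet, Measure.volume_eq_prod, Measure.prod_apply_symm (hΨc.measurable hM)]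
    calc ∫⁻ w, volume ((fun t => (t, w)) ⁻¹' (Ψ ⁻¹' (Q + slab ν (b*s) (D*s)))) 
        ≤ ∫⁻ w, (cthickening (D*s) (π '' Q)).indicator (fun _ => oR (s * (2*b + 4*D*δ))) w := by
          apply lintegral_mono
          intro w
          beta_reduce
          have hfib : ∀ t, Ψ (t, w) ∈ Q + slab ν (b*s) (D*s) → ∃ z ∈ Q, |t - inner ℝ z ν| ≤ b*s ∧ ‖w - π z‖ ≤ D*s := by
            rintro t ⟨z, hz, d, hd, e⟩
            have e' : d = Ψ (t, w) - z := by rw [← e]; simp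
            refine ⟨z, hz, ?_, ?_⟩
            · have := hd.1
              rwa [e', inner_sub_left, hin] at this
            · refine le_trans ?_ hd.2
              have : w - π z = π d := by rw [e', ← hπsub]; simp [π]
              rw [this]; exact hπle d
          by_cases hw : w ∈ cthickening (D*s) (π '' Q)
          · rw [indicator_of_mem hw]
            refine (Real.volume_le_diam _).trans (ediam_le ?_)
            intro t ht t' ht'
            obtain ⟨z, hz, h1, h2⟩ := hfib t ht
            obtain ⟨z', hz', h1', h2'⟩ := hfib t' ht'
            rw [edist_dist]
            apply ENNReal.ofReal_le_ofReal
            rw [Real.dist_eq]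
            have a1 := hfl.2 z hz z' hz'
            have a2 := hxle (z - z')
            have a3 : ‖π (z - z')‖ ≤ 2 * (D*s) := by
              rw [← hπsub]
              have : π z - π z' = (w - π z') - (w - π z) := by abel
              rw [this]; refine (norm_sub_le _ _).trans (by linarith)
            have a4 : |inner ℝ (z - z') ν| ≤ δ * (|inner ℝ (z - z') ν| + 2*(D*s)) := a1.trans (by gcongr; linarith)
            have a5 : δ * |inner ℝ (z - z') ν| ≤ 1/2 * |inner ℝ (z - z') ν| := by gcongr
            have a6 : |inner ℝ (z - z') ν| ≤ 4*D*δ*s := by linarith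
            rw [inner_sub_left] at a6
            have e : t - t' = (t - inner ℝ z ν) + (inner ℝ z ν - inner ℝ z' ν) - (t' - inner ℝ z' ν) := by ring
            rw [e]
            refine (abs_sub _ _).trans ?_
            linarith [abs_add_le (t - inner ℝ z ν) (inner ℝ z ν - inner ℝ z' ν)]
          · rw [indicator_of_notMem hw]
            have : (fun t => (t, w)) ⁻¹' (Ψ ⁻¹' (Q + slab ν (b*s) (D*s))) = ∅ := by
              rw [eq_empty_iff_forall_notMem]
              intro t ht
              obtain ⟨z, hz, h1, h2⟩ := hfib t ht
              exact hw (mem_cthickening_of_dist_le w (π z) _ _ ⟨z, hz, rfl⟩ (by rwa [dist_eq_norm]))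
            rw [this, measure_empty]
      _ = _ := by rw [lintegral_indicator_const isClosed_cthickening.measurableSet]
  have hlim : Tendsto (fun s : ℝ => volume (cthickening (D*s) (π '' Q))) (𝓝[>] 0) (𝓝 (volume (π '' Q))) := by
    have h1 := tendsto_measure_cthickening_of_isCompact (μ := volume) hπQ
    have h2 : Tendsto (fun s : ℝ => D * s) (𝓝[>] 0) (𝓝 0) := by
      have : Tendsto (fun s : ℝ => D * s) (𝓝 0) (𝓝 (D * 0)) := tendsto_id.const_mul _
      rw [mul_zero] at this
      exact this.mono_left nhdsWithin_le_nhds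
    exact h1.comp h2
  have hlt : volume (π '' Q) < volume (π '' Q) + ε / cH n :=
    ENNReal.lt_add_right hπQ.measure_lt_top.ne (ENNReal.div_ne_zero.2 ⟨hε, cH_ne_top n⟩)
  filter_upwards [hlim.eventually_lt_const hlt, self_mem_nhdsWithin] with s h1 h2
  calc cH n * volume (Q + slab ν (b*s) (D*s)) ≤ cH n * (oR (s * (2*b + 4*D*δ)) * (volume (π '' Q) + ε / cH n)) := by
        gcongr; exact (hvol s h2).trans (by gcongr)
    _ = oR (s * (2*b + 4*D*δ)) * (cH n * volume (π '' Q) + ε) := by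
        rw [mul_left_comm, mul_add (cH n), ENNReal.mul_div_cancel (cH_ne_zero n) (cH_ne_top n)]
    _ ≤ _ := by gcongr
end
section
theorem polar_sep {n : ℕ} (A : Rn (n+1) → ℝ) (b : ℝ → ℝ) (hA : Integrable (fun y : Sph (n+1) => A y) (sg (n+1)))
    (hb : IntegrableOn (fun r => r^n * b r) (Ioi 0)) :
    Integrable (fun x : Rn (n+1) => A (‖x‖⁻¹ • x) * b ‖x‖) ∧
    ∫ x : Rn (n+1), A (‖x‖⁻¹ • x) * b ‖x‖ = (∫ y : Sph (n+1), A y ∂sg (n+1)) * ∫ r in Ioi (0:ℝ), r^n * b r := by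
  have hmp := (volume : Measure (Rn (n+1))).measurePreserving_homeomorphUnitSphereProd
  have hfr : Module.finrank ℝ (Rn (n+1)) - 1 = n := by simp
  rw [hfr] at hmp
  have hemb := (homeomorphUnitSphereProd (Rn (n+1))).measurableEmbedding
  let g : Sph (n+1) × Ioi (0:ℝ) → ℝ := fun p => A p.1 * b p.2
  have hbm : ∀ r : Ioi (0:ℝ), (oR (r.1 ^ n)).toReal • b r = (fun r => r^n * b r) r := by
    intro r
    rw [ENNReal.toReal_ofReal (pow_nonneg r.2.out.le _)]; rfl
  have hb1 : Integrable (fun r : Ioi (0:ℝ) => b r) (Measure.volumeIoiPow n) := by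
    rw [Measure.volumeIoiPow, integrable_withDensity_iff_integrable_smul' (by fun_prop) (by simp)]
    simp_rw [hbm]
    exact (integrableOn_iff_comap_subtypeVal measurableSet_Ioi).1 hb
  have hb2 : ∫ r : Ioi (0:ℝ), b r ∂(Measure.volumeIoiPow n) = ∫ r in Ioi (0:ℝ), r^n * b r := by
    rw [Measure.volumeIoiPow, integral_withDensity_eq_integral_toReal_smul (by fun_prop) (by simp)]
    simp_rw [hbm]
    exact integral_subtype_comap measurableSet_Ioi (fun r => r^n * b r)
  have e : (fun x : ({0}ᶜ : Set (Rn (n+1))) => A (‖(x:Rn (n+1))‖⁻¹ • (x:Rn (n+1))) * b ‖(x:Rn (n+1))‖) = g ∘ homeomorphUnitSphereProd (Rn (n+1)) := by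
    ext x; simp [g]
  have hr0 : (volume : Measure (Rn (n+1))).restrict {0}ᶜ = volume := by
    rw [restrict_compl_singleton]
  constructor
  · have h1 : Integrable g ((sg (n+1)).prod (Measure.volumeIoiPow n)) := hA.mul_prod hb1
    have h2 := (hmp.integrable_comp_emb hemb).2 h1
    rw [← e] at h2
    have h3 := (integrableOn_iff_comap_subtypeVal (f := fun x : Rn (n+1) => A (‖x‖⁻¹ • x) * b ‖x‖) (μ := volume) (measurableSet_singleton (0 : Rn (n+1))).compl).2 h2
    rwa [IntegrableOn, hr0] at h3
  · rw [← hb2, ← integral_prod_mul, ← hr0, ← integral_subtype_comap (measurableSet_singleton (0 : Rn (n+1))).compl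
      (fun x : Rn (n+1) => A (‖x‖⁻¹ • x) * b ‖x‖), e]
    exact hmp.integral_comp hemb g

structure Cut (χ : ℝ → ℝ) (a b : ℝ) : Prop where
  cd : ContDiff ℝ 1 χ
  ha : 0 < a
  hb : b < 1
  supp : ∀ t, t ∉ Icc a b → χ t = 0
  nn : ∀ t, 0 ≤ χ t
  le1 : ∀ t, χ t ≤ 1

def xi {N : ℕ} (e : Rn N) (m : ℕ) (M : ℝ) (χ : ℝ → ℝ) (x : Rn N) : ℝ :=
  M⁻¹ * ((1 + inner ℝ x e / ‖x‖)^m * χ ‖x‖)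

theorem xi_contDiff {N : ℕ} (e : Rn N) (m : ℕ) (M : ℝ) {χ : ℝ → ℝ} {a b : ℝ} (h : Cut χ a b) : ContDiff ℝ 1 (xi e m M χ) := by
  rw [contDiff_iff_contDiffAt]
  intro x
  by_cases hx : x = 0
  · subst hx
    have : xi e m M χ =ᶠ[𝓝 0] fun _ => 0 := by
      filter_upwards [ball_mem_nhds (0 : Rn N) h.ha] with y hy
      rw [mem_ball_zero_iff] at hy
      simp [xi, h.supp ‖y‖ (fun h => by linarith [h.1])]
    exact contDiffAt_const.congr_of_eventuallyEq this
  · have h1 : ContDiffAt ℝ 1 (fun x : Rn N => ‖x‖) x := contDiffAt_norm ℝ hx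
    have h2 : ContDiffAt ℝ 1 (fun x : Rn N => χ ‖x‖) x := h.cd.contDiffAt.comp x h1
    have h3 : ContDiffAt ℝ 1 (fun x : Rn N => (inner ℝ x e : ℝ)) x := contDiffAt_id.inner ℝ contDiffAt_const
    exact contDiffAt_const.mul (((contDiffAt_const.add (h3.div h1 (norm_ne_zero_iff.2 hx))).pow m).mul h2)

theorem xi_supp {N : ℕ} (e : Rn N) (m : ℕ) (M : ℝ) {χ : ℝ → ℝ} {a b : ℝ} (h : Cut χ a b) {x : Rn N} (hx : ‖x‖ ∉ Icc a b) :
    xi e m M χ x = 0 := by simp [xi, h.supp _ hx]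

theorem xi_deriv {N : ℕ} {e : Rn N} (he : ‖e‖ = 1) (m : ℕ) (M : ℝ) {χ : ℝ → ℝ} {a b : ℝ} (h : Cut χ a b) {x : Rn N} (hx : x ≠ 0) :
    fderiv ℝ (xi e m M χ) x e = M⁻¹ * (m * (1 + inner ℝ x e / ‖x‖)^m * (1 - inner ℝ x e / ‖x‖) * (‖x‖⁻¹ * χ ‖x‖)
      + (1 + inner ℝ x e / ‖x‖)^m * (inner ℝ x e / ‖x‖) * deriv χ ‖x‖) := by
  have hn : ‖x‖ ≠ 0 := norm_ne_zero_iff.2 hx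
  have hline : HasDerivAt (fun t : ℝ => x + t • e) e 0 := by
    simpa using ((hasDerivAt_id (0:ℝ)).smul_const e).const_add x
  have hd : DifferentiableAt ℝ (xi e m M χ) x := (xi_contDiff e m M h).differentiable one_ne_zero x
  have e0 : x + (0:ℝ) • e = x := by simp
  have hf : HasDerivAt (fun t : ℝ => xi e m M χ (x + t • e)) (fderiv ℝ (xi e m M χ) x e) 0 := by
    have := hd.hasFDerivAt
    rw [← e0] at this
    have := this.comp_hasDerivAt (0:ℝ) hline
    rwa [e0] at this
  have hin : HasDerivAt (fun t : ℝ => (inner ℝ (x + t • e) e : ℝ)) 1 0 := by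
    have := hline.inner ℝ (hasDerivAt_const (0:ℝ) e)
    simpa [real_inner_self_eq_norm_sq, he] using this
  have hno : HasDerivAt (fun t : ℝ => ‖x + t • e‖) (inner ℝ x e / ‖x‖) 0 := by
    have h1 := hline.norm_sq.sqrt (by rw [e0]; positivity)
    simp only [Real.sqrt_sq (norm_nonneg _), e0] at h1
    convert h1 using 1
    rw [mul_div_mul_left _ _ two_ne_zero]
  have hc : HasDerivAt (fun t : ℝ => 1 + (inner ℝ (x + t • e) e : ℝ) / ‖x + t • e‖) ((1 - (inner ℝ x e / ‖x‖)^2) * ‖x‖⁻¹) 0 := by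
    have := (hin.div hno (by rwa [e0])).const_add 1
    simp only [e0] at this
    have e2 : (1 - (inner ℝ x e / ‖x‖)^2) * ‖x‖⁻¹ = (1 * ‖x‖ - inner ℝ x e * (inner ℝ x e / ‖x‖)) / ‖x‖ ^ 2 := by
      field_simp
    rw [e2]; exact this
  have hχ : HasDerivAt (fun t : ℝ => χ ‖x + t • e‖) (deriv χ ‖x‖ * (inner ℝ x e / ‖x‖)) 0 := by
    have h1 : HasDerivAt χ (deriv χ ‖x‖) ‖x + (0:ℝ) • e‖ := by
      rw [e0]; exact (h.cd.differentiable one_ne_zero ‖x‖).hasDerivAt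
    exact h1.comp (0:ℝ) hno
  have hfin := (((hc.pow m).mul hχ).const_mul M⁻¹)
  have := hf.unique hfin
  rw [this]
  simp only [e0, Pi.pow_apply]
  cases m with
  | zero => simp only [Nat.cast_zero, pow_zero]; ring
  | succ j => simp only [Nat.add_sub_cancel, pow_succ]; ring
end
section
theorem flow_vol {N : ℕ} {e : Rn N} (he : ‖e‖ = 1) {ξ : Rn N → ℝ} (hξ : ContDiff ℝ 1 ξ) {a b : ℝ} (hb : b < 1)
    (hsupp : ∀ x, ‖x‖ ∉ Icc a b → ξ x = 0) {V : Set (Rn N)} (hV : MeasurableSet V) :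
    ∃ L : ℝ, 0 ≤ L ∧ ∀ᶠ s in 𝓝[>] (0:ℝ), s * ∫ y in V ∩ ball 0 1, -(fderiv ℝ ξ y e) ≤
      (1 + s * L) * volume.real ((V ∩ ball 0 1) \ {y | y - (s * ξ y) • e ∈ V}) := by
  have hcs : HasCompactSupport ξ := by
    refine HasCompactSupport.intro (isCompact_closedBall (0 : Rn N) 1) (fun x hx => hsupp x (fun h => hx ?_))
    rw [mem_closedBall_zero_iff]; linarith [h.2]
  obtain ⟨L, hL⟩ := hξ.lipschitzWith_of_hasCompactSupport hcs one_ne_zero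
  obtain ⟨S, hS⟩ := hξ.continuous.bounded_above_of_compact_support hcs
  have hS0 : 0 ≤ S := (norm_nonneg _).trans (hS 0)
  have hFd : ∀ y, |fderiv ℝ ξ y e| ≤ L := by
    intro y
    have h1 := (fderiv ℝ ξ y).le_opNorm e
    have h2 := norm_fderiv_le_of_lipschitz ℝ hL (x₀ := y)
    rw [he, mul_one] at h1
    exact h1.trans h2
  have hFc : Continuous (fun y => -(fderiv ℝ ξ y e)) :=
    ((hξ.continuous_fderiv one_ne_zero).clm_apply continuous_const).neg
  refine ⟨L, L.2, ?_⟩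
  have ev1 : ∀ᶠ s in 𝓝[>] (0:ℝ), s * (L:ℝ) < 1 ∧ b + s * S < 1 := by
    have c1 : Tendsto (fun s : ℝ => s * (L:ℝ)) (𝓝[>] 0) (𝓝 0) := by
      have : Continuous (fun s : ℝ => s * (L:ℝ)) := by fun_prop
      simpa using (this.tendsto 0).mono_left nhdsWithin_le_nhds
    have c2 : Tendsto (fun s : ℝ => b + s * S) (𝓝[>] 0) (𝓝 b) := by
      have : Continuous (fun s : ℝ => b + s * S) := by fun_prop
      simpa using (this.tendsto 0).mono_left nhdsWithin_le_nhds
    exact (c1.eventually_lt_const one_pos).and (c2.eventually_lt_const hb)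
  filter_upwards [ev1, self_mem_nhdsWithin] with s hs hs0
  have hs0 : 0 < s := hs0
  set φ : Rn N → Rn N := fun y => y - (s * ξ y) • e with hφ
  have hφc : Continuous φ := continuous_id.sub ((continuous_const.mul hξ.continuous).smul continuous_const)
  have hinj : Function.Injective φ := by
    intro x y hxy
    by_contra hne
    have h1 : x - y = (s * (ξ x - ξ y)) • e := by
      have : x - (s * ξ x) • e = y - (s * ξ y) • e := hxy
      rw [mul_sub, sub_smul, sub_eq_sub_iff_add_eq_add]
      rw [sub_eq_sub_iff_add_eq_add] at this
      rw [this, add_comm]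
    have h2 : ‖x - y‖ = s * |ξ x - ξ y| := by
      rw [h1, norm_smul, he, mul_one, Real.norm_eq_abs, abs_mul, abs_of_pos hs0]
    have h3 := hL.dist_le_mul x y
    rw [Real.dist_eq, dist_eq_norm] at h3
    have h4 : 0 < ‖x - y‖ := norm_pos_iff.2 (sub_ne_zero.2 hne)
    nlinarith
  let G : Set (Rn N) := V ∩ ball 0 1
  have hG : MeasurableSet G := hV.inter measurableSet_ball
  let W : Set (Rn N) := G ∩ φ ⁻¹' V
  have hW : MeasurableSet W := hG.inter (hφc.measurable hV)
  have hsub : φ '' W ⊆ G := by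
    rintro _ ⟨y, ⟨⟨_, hy1⟩, hy2⟩, rfl⟩
    refine ⟨hy2, ?_⟩
    by_cases h : ‖y‖ ∈ Icc a b
    · rw [mem_ball_zero_iff]
      calc ‖φ y‖ ≤ ‖y‖ + ‖(s * ξ y) • e‖ := norm_sub_le _ _
        _ ≤ b + s * S := by
          rw [norm_smul, he, mul_one, norm_mul, Real.norm_of_nonneg hs0.le]
          exact add_le_add h.2 (mul_le_mul_of_nonneg_left (hS y) hs0.le)
        _ < 1 := hs.2
    · simpa [hφ, hsupp y h] using hy1
  let φ' : Rn N → (Rn N →L[ℝ] Rn N) := fun y => ContinuousLinearMap.id ℝ _ - ((s • fderiv ℝ ξ y).smulRight e)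
  have hder : ∀ y, HasFDerivAt φ (φ' y) y := by
    intro y
    have h1 := ((hξ.differentiable one_ne_zero y).hasFDerivAt.const_mul s).smul_const e
    exact (hasFDerivAt_id y).sub h1
  have hdet : ∀ y, (φ' y).det = 1 + s * (-(fderiv ℝ ξ y e)) := by
    intro y
    have h1 : ((φ' y : Rn N →L[ℝ] Rn N) : Rn N →ₗ[ℝ] Rn N) = LinearMap.transvection (-(s • (fderiv ℝ ξ y : Rn N →ₗ[ℝ] ℝ))) e := by
      ext v
      simp [φ', LinearMap.transvection.apply, sub_eq_add_neg]
    rw [ContinuousLinearMap.det, h1, LinearMap.transvection.det]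
    simp
  have hcv := integral_image_eq_integral_abs_det_fderiv_smul volume hW (fun y _ => (hder y).hasFDerivWithinAt) hinj.injOn (fun _ => (1:ℝ))
  simp only [smul_eq_mul, mul_one] at hcv
  have hfinG : volume G < ⊤ := (measure_mono inter_subset_right).trans_lt measure_ball_lt_top
  have habs : ∀ y, |(φ' y).det| = 1 + s * (-(fderiv ℝ ξ y e)) := by
    intro y
    rw [hdet, abs_of_pos]
    have := abs_le.1 (hFd y)
    nlinarith [this.2]
  simp only [habs] at hcv
  have hint : IntegrableOn (fun y => 1 + s * (-(fderiv ℝ ξ y e))) G := by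
    refine Measure.integrableOn_of_bounded (M := 1 + s * L) hfinG.ne (Continuous.aestronglyMeasurable (by fun_prop)) ?_
    refine ae_of_all _ (fun y => ?_)
    rw [Real.norm_eq_abs, abs_le]
    have := abs_le.1 (hFd y)
    constructor <;> nlinarith [this.1, this.2]
  have hintF : IntegrableOn (fun y => (-(fderiv ℝ ξ y e))) G := by
    refine Measure.integrableOn_of_bounded (M := L) hfinG.ne (hFc.aestronglyMeasurable) ?_
    refine ae_of_all _ (fun y => ?_)
    rw [Real.norm_eq_abs, abs_neg]; exact hFd y
  have hvol : ∫ _y in φ '' W, (1:ℝ) ≤ volume.real G := by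
    rw [setIntegral_const, smul_eq_mul, mul_one]
    exact measureReal_mono hsub hfinG.ne
  have hsplit : ∫ y in G, (1 + s * (-(fderiv ℝ ξ y e))) = (∫ y in W, (1 + s * (-(fderiv ℝ ξ y e)))) + ∫ y in G \ φ ⁻¹' V, (1 + s * (-(fderiv ℝ ξ y e))) := by
    have := integral_inter_add_sdiff (hφc.measurable hV) hint
    exact this.symm
  have htot : ∫ y in G, (1 + s * (-(fderiv ℝ ξ y e))) = volume.real G + s * ∫ y in G, (-(fderiv ℝ ξ y e)) := by
    have hc1 : IntegrableOn (fun _ : Rn N => (1:ℝ)) G := integrableOn_const (hs := hfinG.ne)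
    rw [integral_add hc1 (hintF.const_mul s), setIntegral_const, integral_const_mul]
    simp
  have hbad : ∫ y in G \ φ ⁻¹' V, (1 + s * (-(fderiv ℝ ξ y e))) ≤ (1 + s * L) * volume.real (G \ φ ⁻¹' V) := by
    have hf : volume (G \ φ ⁻¹' V) ≠ ⊤ := (measure_mono sdiff_subset |>.trans_lt hfinG).ne
    calc _ ≤ ∫ y in G \ φ ⁻¹' V, (1 + s * (L:ℝ)) := by
          refine setIntegral_mono_on (hint.mono_set sdiff_subset) (integrableOn_const (hs := hf)) (hG.diff (hφc.measurable hV)) (fun y _ => ?_)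
          have := abs_le.1 (hFd y)
          nlinarith [this.1]
      _ = _ := by rw [setIntegral_const, smul_eq_mul, mul_comm]
  have : s * ∫ y in G, (-(fderiv ℝ ξ y e)) ≤ (1 + s * L) * volume.real (G \ φ ⁻¹' V) := by linarith
  exact this

theorem exists_cut (n : ℕ) (hn : 1 ≤ n) {θ : ℝ} (hθ : θ < 1) : ∃ χ : ℝ → ℝ, ∃ a b : ℝ, Cut χ a b ∧
    θ ≤ n * ∫ ρ in Ioi (0:ℝ), ρ^(n-1) * χ ρ := by
  have hlim : Tendsto (fun η : ℝ => (1 - 2*η)^n - (2*η)^n) (𝓝[>] 0) (𝓝 1) := by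
    have : Continuous (fun η : ℝ => (1 - 2*η)^n - (2*η)^n) := by fun_prop
    have h := (this.tendsto 0).mono_left (nhdsWithin_le_nhds (s := Ioi 0))
    simpa [show n ≠ 0 by omega] using h
  have h2 : ∀ᶠ η in 𝓝[>] (0:ℝ), η < 1/8 := nhdsWithin_le_nhds (Iio_mem_nhds (by norm_num))
  obtain ⟨η, ⟨h1, h2⟩, h3⟩ := ((hlim.eventually_const_lt hθ).and h2).and self_mem_nhdsWithin |>.exists
  have h3 : 0 < η := h3
  let f : ContDiffBump (1/2 : ℝ) := ⟨1/2 - 2*η, 1/2 - η, by linarith, by linarith⟩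
  have hsupp : ∀ t, t ∉ Icc η (1-η) → f t = 0 := by
    intro t ht
    apply f.zero_of_le_dist
    simp only [f, Real.dist_eq]
    by_contra hc
    rw [not_le, abs_lt] at hc
    exact ht ⟨by linarith [hc.1], by linarith [hc.2]⟩
  refine ⟨f, η, 1 - η, ⟨f.contDiff, h3, by linarith, hsupp, fun t => f.nonneg, fun t => f.le_one⟩, ?_⟩
  have hint : Integrable (fun ρ => ρ^(n-1) * f ρ) := by
    refine Continuous.integrable_of_hasCompactSupport (by have := f.continuous; fun_prop) ?_
    exact f.hasCompactSupport.mul_left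
  have hle : ∫ ρ in Ioc (2*η) (1-2*η), ρ^(n-1) ≤ ∫ ρ in Ioi (0:ℝ), ρ^(n-1) * f ρ := by
    calc ∫ ρ in Ioc (2*η) (1-2*η), ρ^(n-1) = ∫ ρ in Ioc (2*η) (1-2*η), ρ^(n-1) * f ρ := by
          refine setIntegral_congr_fun measurableSet_Ioc (fun t ht => ?_)
          have : f t = 1 := by
            apply f.one_of_mem_closedBall
            rw [mem_closedBall, Real.dist_eq, abs_le]
            simp only [f]
            constructor <;> linarith [ht.1, ht.2]
          simp [this]
      _ ≤ _ := by
          refine setIntegral_mono_set hint.integrableOn ?_ ?_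
          · refine (ae_restrict_iff' measurableSet_Ioi).2 (ae_of_all _ (fun t ht => ?_))
            exact mul_nonneg (pow_nonneg (le_of_lt ht) _) f.nonneg
          · exact Eventually.of_forall (fun t ht => lt_trans (by linarith : (0:ℝ) < 2*η) ht.1)
  rw [← intervalIntegral.integral_of_le (by linarith), integral_pow] at hle
  have hn0 : (0:ℝ) < n := by exact_mod_cast hn
  rw [Nat.sub_add_cancel hn] at hle
  have hc : ((n - 1 : ℕ) : ℝ) + 1 = n := by exact_mod_cast Nat.sub_add_cancel hn
  rw [hc, div_le_iff₀ hn0] at hle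
  linarith

theorem cut_ibp {n : ℕ} (hn : 1 ≤ n) {χ : ℝ → ℝ} {a b : ℝ} (h : Cut χ a b) :
    IntegrableOn (fun ρ => ρ^n * deriv χ ρ) (Ioi 0) ∧ IntegrableOn (fun ρ => ρ^n * (ρ⁻¹ * χ ρ)) (Ioi 0) ∧
    ∫ ρ in Ioi (0:ℝ), ρ^n * (ρ⁻¹ * χ ρ) = ∫ ρ in Ioi (0:ℝ), ρ^(n-1) * χ ρ ∧
    ∫ ρ in Ioi (0:ℝ), ρ^n * deriv χ ρ = - (n * ∫ ρ in Ioi (0:ℝ), ρ^(n-1) * χ ρ) := by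
  have hcs : HasCompactSupport χ := HasCompactSupport.intro (isCompact_Icc (a := a) (b := b)) h.supp
  have hd : Continuous (deriv χ) := h.cd.continuous_deriv le_rfl
  have hi1 : Integrable (fun ρ => ρ^n * deriv χ ρ) :=
    Continuous.integrable_of_hasCompactSupport (by fun_prop) hcs.deriv.mul_left
  have hc := h.cd.continuous
  have hi2 : Integrable (fun ρ => ρ^(n-1) * χ ρ) :=
    Continuous.integrable_of_hasCompactSupport (by fun_prop) hcs.mul_left
  have e1 : EqOn (fun ρ : ℝ => ρ^n * (ρ⁻¹ * χ ρ)) (fun ρ => ρ^(n-1) * χ ρ) (Ioi 0) := by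
    intro ρ hρ
    have : ρ ≠ 0 := ne_of_gt hρ
    obtain ⟨j, rfl⟩ : ∃ j, n = j + 1 := ⟨n-1, by omega⟩
    simp only [Nat.add_sub_cancel]
    field_simp
    ring
  refine ⟨hi1.integrableOn, ?_, setIntegral_congr_fun measurableSet_Ioi e1, ?_⟩
  · exact (integrableOn_congr_fun e1 measurableSet_Ioi).2 hi2.integrableOn
  · have hder : ∀ x : ℝ, HasDerivAt (fun ρ => ρ^n * χ ρ) (n * x^(n-1) * χ x + x^n * deriv χ x) x := fun x =>
      (hasDerivAt_pow n x).mul (h.cd.differentiable one_ne_zero x).hasDerivAt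
    have hi3 : Integrable (fun x : ℝ => n * x^(n-1) * χ x + x^n * deriv χ x) := by
      have := (hi2.const_mul (n:ℝ)).add hi1
      refine this.congr (ae_of_all _ (fun x => ?_))
      simp [mul_assoc]
    have hz : Tendsto (fun ρ => ρ^n * χ ρ) atTop (𝓝 0) := by
      refine tendsto_const_nhds.congr' ?_
      filter_upwards [eventually_gt_atTop b] with t ht
      rw [h.supp t (fun h => by linarith [h.2]), mul_zero]
    have := integral_Ioi_of_hasDerivAt_of_tendsto (a := 0) (hder 0).continuousAt.continuousWithinAt (fun x _ => hder x) hi3.integrableOn hz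
    rw [h.supp 0 (fun h' => by linarith [h'.1, h.ha])] at this
    rw [integral_add (by simpa only [mul_assoc, IntegrableOn] using (hi2.const_mul (n:ℝ)).integrableOn (s := Ioi 0)) hi1.integrableOn] at this
    simp_rw [mul_assoc] at this
    rw [integral_const_mul] at this
    linarith

theorem int_F {n : ℕ} (hn : 1 ≤ n) {e : Rn (n+1)} (he : ‖e‖ = 1) (m : ℕ) (M : ℝ) {χ : ℝ → ℝ} {a b : ℝ} (h : Cut χ a b)
    {V : Set (Rn (n+1))} (hV : MeasurableSet V) (hVc : ∀ x, x ≠ 0 → (x ∈ V ↔ ‖x‖⁻¹ • x ∈ V)) :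
    ∫ y in V ∩ ball 0 1, -(fderiv ℝ (xi e m M χ) y e) = M⁻¹ * (∫ ρ in Ioi (0:ℝ), ρ^(n-1) * χ ρ) *
      ∫ y in {y : Sph (n+1) | (y : Rn (n+1)) ∈ V}, (1 + inner ℝ (y : Rn (n+1)) e)^m * ((n+m) * inner ℝ (y : Rn (n+1)) e - m) ∂sg (n+1) := by
  let U : Set (Sph (n+1)) := {y : Sph (n+1) | (y : Rn (n+1)) ∈ V}
  have hU : MeasurableSet U := measurable_subtype_coe hV
  let p1 : Rn (n+1) → ℝ := fun x => m * (1 + inner ℝ x e)^m * (1 - inner ℝ x e)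
  let p2 : Rn (n+1) → ℝ := fun x => (1 + inner ℝ x e)^m * inner ℝ x e
  have key : ∀ p : Rn (n+1) → ℝ, Continuous p → Integrable (fun y : Sph (n+1) => V.indicator p y) (sg (n+1)) := by
    intro p hp
    have : Integrable (fun y : Sph (n+1) => p y) (sg (n+1)) :=
      (hp.comp continuous_subtype_val).integrable_of_hasCompactSupport (HasCompactSupport.of_compactSpace _)
    exact this.indicator hU
  have hp1 : Continuous p1 := by fun_prop
  have hp2 : Continuous p2 := by fun_prop
  obtain ⟨i1, i2, i3, i4⟩ := cut_ibp hn h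
  obtain ⟨a1, b1⟩ := polar_sep (V.indicator p1) (fun ρ => ρ⁻¹ * χ ρ) (key p1 hp1) i2
  obtain ⟨a2, b2⟩ := polar_sep (V.indicator p2) (deriv χ) (key p2 hp2) i1
  have hz : ∀ x : Rn (n+1), x ∉ ball (0 : Rn (n+1)) 1 → fderiv ℝ (xi e m M χ) x = 0 := by
    intro x hx
    have : xi e m M χ =ᶠ[𝓝 x] fun _ => 0 := by
      have : {y : Rn (n+1) | b < ‖y‖} ∈ 𝓝 x := by
        refine (isOpen_lt continuous_const continuous_norm).mem_nhds ?_
        rw [mem_ball_zero_iff, not_lt] at hx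
        exact h.hb.trans_le hx
      filter_upwards [this] with y hy
      exact xi_supp e m M h (fun h' => absurd h'.2 (not_le.2 hy))
    rw [this.fderiv_eq]; simp
  have e1 : ∫ y in V ∩ ball 0 1, -(fderiv ℝ (xi e m M χ) y e) = ∫ y, V.indicator (fun y => -(fderiv ℝ (xi e m M χ) y e)) y := by
    rw [integral_indicator hV]
    refine (setIntegral_eq_of_subset_of_forall_sdiff_eq_zero hV inter_subset_left (fun x hx => ?_)).symm
    rw [hz x (fun hb => hx.2 ⟨hx.1, hb⟩)]; simp
  have e2 : ∫ y, V.indicator (fun y => -(fderiv ℝ (xi e m M χ) y e)) y = ∫ x, -M⁻¹ * (V.indicator p1 (‖x‖⁻¹ • x) * (‖x‖⁻¹ * χ ‖x‖) + V.indicator p2 (‖x‖⁻¹ • x) * deriv χ ‖x‖) := by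
    refine integral_congr_ae ?_
    have : ∀ᵐ x : Rn (n+1), x ≠ 0 := by
      rw [ae_iff]; simp
    filter_upwards [this] with x hx
    have hin : inner ℝ (‖x‖⁻¹ • x) e = inner ℝ x e / ‖x‖ := by
      rw [real_inner_smul_left, inv_mul_eq_div]
    by_cases hxV : x ∈ V
    · rw [indicator_of_mem hxV, indicator_of_mem ((hVc x hx).1 hxV), indicator_of_mem ((hVc x hx).1 hxV), xi_deriv he m M h hx]
      simp only [p1, p2, hin]
      ring
    · rw [indicator_of_notMem hxV, indicator_of_notMem (fun h => hxV ((hVc x hx).2 h)), indicator_of_notMem (fun h => hxV ((hVc x hx).2 h))]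
      simp
  have hind : ∀ p : Rn (n+1) → ℝ, ∫ y : Sph (n+1), V.indicator p y ∂sg (n+1) = ∫ y in U, p y ∂sg (n+1) := by
    intro p
    rw [← integral_indicator hU]
    rfl
  have hi : ∀ p : Rn (n+1) → ℝ, Continuous p → IntegrableOn (fun y : Sph (n+1) => p y) U (sg (n+1)) := by
    intro p hp
    exact ((hp.comp continuous_subtype_val).integrable_of_hasCompactSupport (HasCompactSupport.of_compactSpace _)).integrableOn
  rw [e1, e2, integral_const_mul, integral_add a1 a2, b1, b2, i3, i4, hind, hind]
  have e3 : ∫ y in U, (1 + inner ℝ (y : Rn (n+1)) e)^m * ((n+m) * inner ℝ (y : Rn (n+1)) e - m) ∂sg (n+1)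
     = n * (∫ y in U, p2 y ∂sg (n+1)) - ∫ y in U, p1 y ∂sg (n+1) := by
    rw [← integral_const_mul, ← integral_sub ((hi p2 hp2).const_mul _) (hi p1 hp1)]
    refine integral_congr_ae (ae_of_all _ (fun y => ?_))
    simp only [p1, p2]; ring
  rw [e3]; ring
end
section
theorem pieces {k : ℕ} (hk : 1 ≤ k) {C : Set (Rn (k+2))} (hcone : ∀ t : ℝ, 0 ≤ t → ∀ x ∈ C, t • x ∈ C)
    (hrect : KRectifiable (k+2) k (C ∩ sphere (0 : Rn (k+2)) 1)) {T : Set (Rn (k+2))} (hT : MeasurableSet T) (hTC : T ⊆ C ∩ ball 0 1)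
    (hfin : μH[((k+1:ℕ):ℝ)] T ≠ ⊤) {δ : ℝ} (hδ : 0 < δ) (hδ1 : δ ≤ 1) {ε : ℝ≥0∞} (hε : ε ≠ 0) :
    ∃ J : ℕ, ∃ Q : ℕ → Set (Rn (k+2)), ∃ ν : ℕ → Rn (k+2), (∀ j, IsCompact (Q j) ∧ Q j ⊆ T ∧ ‖ν j‖ = 1 ∧ Flat δ (ν j) (Q j)) ∧
      Pairwise (Function.onFun Disjoint Q) ∧ μH[((k+1:ℕ):ℝ)] (T \ ⋃ j ∈ Finset.range J, Q j) ≤ ε := by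
  obtain ⟨G0, hG0, hG0n⟩ := flat_cover hk hcone hrect hδ hδ1
  let eqv : ℕ ≃ ℕ × ℕ × ℕ := (Denumerable.eqv (ℕ × ℕ × ℕ)).symm
  let G : ℕ → Set (Rn (k+2)) := fun i => G0 (eqv i)
  have hGn : ∀ i, IsClosed (G i) := fun i => (hG0 _).1
  choose ν hν1 hν2 using fun i => (hG0 (eqv i)).2
  have hun : ⋃ i, disjointed G i = ⋃ p, G0 p := by
    rw [iUnion_disjointed]; exact eqv.surjective.iUnion_comp G0
  let μ : Measure (Rn (k+2)) := μH[((k+1:ℕ):ℝ)].restrict T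
  haveI : IsFiniteMeasure μ := ⟨by simpa [μ] using hfin.lt_top⟩
  have hDm : ∀ i, MeasurableSet (T ∩ disjointed G i) := fun i => hT.inter (MeasurableSet.disjointed (fun i => (hGn i).measurableSet) i)
  obtain ⟨ε', hε'0, hε'⟩ := ENNReal.exists_pos_sum_of_countable' hε ℕ
  choose Q hQsub hQc hQlt using fun i => (hDm i).exists_isCompact_sdiff_lt (μ := μ) (measure_ne_top _ _) (hε'0 i).ne'
  have hQT : ∀ i, Q i ⊆ T := fun i => (hQsub i).trans inter_subset_left
  have hμ : ∀ s ⊆ T, μ s = μH[((k+1:ℕ):ℝ)] s := fun s hs => by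
    simp only [μ]; rw [Measure.restrict_eq_self _ hs]
  have hall : μ (T \ ⋃ j, Q j) < ε := by
    have hsub : T \ ⋃ j, Q j ⊆ ((C ∩ ball 0 1) \ ⋃ p, G0 p) ∪ ⋃ i, ((T ∩ disjointed G i) \ Q i) := by
      rintro x ⟨hx, hx2⟩
      by_cases h : x ∈ ⋃ p, G0 p
      · right
        rw [← hun] at h
        obtain ⟨i, hi⟩ := mem_iUnion.1 h
        exact mem_iUnion.2 ⟨i, ⟨hx, hi⟩, fun h' => hx2 (mem_iUnion.2 ⟨i, h'⟩)⟩
      · exact Or.inl ⟨hTC hx, h⟩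
    calc μ (T \ ⋃ j, Q j) ≤ μ ((C ∩ ball 0 1) \ ⋃ p, G0 p) + μ (⋃ i, ((T ∩ disjointed G i) \ Q i)) :=
          (measure_mono hsub).trans (measure_union_le _ _)
      _ ≤ 0 + ∑' i, μ ((T ∩ disjointed G i) \ Q i) := by
          refine add_le_add ?_ (measure_iUnion_le _)
          exact (Measure.restrict_apply_le _ _).trans hG0n.le
      _ ≤ ∑' i, ε' i := by
          rw [zero_add]; exact ENNReal.tsum_le_tsum (fun i => (hQlt i).le)
      _ < ε := hε'
  have hlim : Tendsto (fun J => μ (T \ ⋃ j ∈ Finset.range J, Q j)) atTop (𝓝 (μ (⋂ J : ℕ, (T \ ⋃ j ∈ Finset.range J, Q j)))) := by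
    refine tendsto_measure_iInter_atTop (fun J => ?_) ?_ ⟨0, measure_ne_top _ _⟩
    · exact (hT.diff (Finset.measurableSet_biUnion _ (fun j _ => (hQc j).measurableSet))).nullMeasurableSet
    · intro J J' hJ
      refine sdiff_subset_sdiff_right (biUnion_subset_biUnion_left (fun j hj => ?_))
      simp only [Finset.coe_range, mem_Iio, Finset.mem_range, Finset.mem_coe] at *; omega
  have heq : (⋂ J : ℕ, (T \ ⋃ j ∈ Finset.range J, Q j)) = T \ ⋃ j, Q j := by
    ext x
    simp only [mem_iInter, Set.mem_sdiff, mem_iUnion, Finset.mem_range, not_exists]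
    exact ⟨fun h => ⟨(h 0).1, fun j => (h (j+1)).2 j (by omega)⟩, fun h J => ⟨h.1, fun j _ => h.2 j⟩⟩
  rw [heq] at hlim
  obtain ⟨J, hJ⟩ := (hlim.eventually_lt_const hall).exists
  refine ⟨J, Q, ν, fun j => ⟨hQc j, hQT j, hν1 j, ?_⟩, ?_, ?_⟩
  · have : Q j ⊆ G j := (hQsub j).trans (inter_subset_right.trans (disjointed_subset G j))
    exact ⟨fun x hx => (hν2 j).1 x (this hx), fun x hx y hy => (hν2 j).2 x (this hx) y (this hy)⟩
  · intro i j hij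
    exact (disjoint_disjointed G hij).mono ((hQsub i).trans inter_subset_right) ((hQsub j).trans inter_subset_right)
  · rw [hμ _ sdiff_subset] at hJ
    exact hJ.le

theorem hit_frontier {N : ℕ} {V : Set (Rn N)} (hV : IsOpen V) {y w : Rn N} (hy : y ∈ V) (hw : y - w ∉ V) :
    ∃ t ∈ Icc (0:ℝ) 1, y - t • w ∈ frontier V := by
  by_contra hc
  push Not at hc
  have hcon : IsPreconnected ((fun t : ℝ => y - t • w) '' Icc 0 1) :=
    isPreconnected_Icc.image _ (by fun_prop)
  have h1 : ((fun t : ℝ => y - t • w) '' Icc 0 1) ⊆ V ∪ (closure V)ᶜ := by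
    rintro _ ⟨t, ht, rfl⟩
    by_cases hV' : y - t • w ∈ V
    · exact Or.inl hV'
    · right
      intro hcl
      exact hc t ht (by rw [hV.frontier_eq]; exact ⟨hcl, hV'⟩)
  obtain ⟨x, hx, hx2⟩ := hcon V (closure V)ᶜ hV isClosed_closure.isOpen_compl h1
    ⟨y, ⟨0, by simp, by simp⟩, hy⟩ ⟨y - w, ⟨1, by simp, by simp⟩, fun h => hc 1 (by simp) (by
      rw [one_smul, hV.frontier_eq]; exact ⟨h, hw⟩)⟩
  exact hx2.2 (subset_closure hx2.1)

theorem xi_bounds {N : ℕ} {e : Rn N} (he : ‖e‖ = 1) (m : ℕ) {M : ℝ} (hM : 0 < M)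
    (hMm : ∀ c ∈ Icc (-1:ℝ) 1, (1+c)^m * Real.sqrt (1-c^2) ≤ M) {χ : ℝ → ℝ} {a b : ℝ} (h : Cut χ a b) (y : Rn N) :
    0 ≤ xi e m M χ y ∧ xi e m M χ y ≤ 2^m / M ∧ ∀ ν : Rn N, ‖ν‖ = 1 →
      xi e m M χ y * |inner ℝ e ν| ≤ 1 + (2^m/M) * (|inner ℝ y ν| / ‖y‖) := by
  set c := inner ℝ y e / ‖y‖ with hc
  have hc1 : |c| ≤ 1 := by
    have := abs_real_inner_div_norm_mul_norm_le_one y e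
    rwa [he, mul_one] at this
  obtain ⟨hcl, hcu⟩ := abs_le.1 hc1
  have hχ0 := h.nn ‖y‖
  have hχ1 := h.le1 ‖y‖
  have hp0 : 0 ≤ (1+c)^m := pow_nonneg (by linarith) _
  have hp1 : (1+c)^m ≤ 2^m := pow_le_pow_left₀ (by linarith) (by linarith) _
  have hxi : xi e m M χ y = M⁻¹ * ((1+c)^m * χ ‖y‖) := rfl
  have h0 : 0 ≤ xi e m M χ y := by rw [hxi]; positivity
  have h1 : xi e m M χ y ≤ 2^m / M := by
    rw [hxi, inv_mul_eq_div]
    refine div_le_div_of_nonneg_right ?_ hM.le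
    nlinarith
  refine ⟨h0, h1, fun ν hν => ?_⟩
  by_cases hy : y = 0
  · subst hy
    have : xi e m M χ 0 = 0 := xi_supp e m M h (by rw [norm_zero]; exact fun h' => absurd h'.1 (not_le.2 h.ha))
    rw [this]; simp
  have hyn : 0 < ‖y‖ := norm_pos_iff.2 hy
  have hsq : 0 ≤ 1 - c^2 := by nlinarith
  have hdec : |inner ℝ e ν| ≤ Real.sqrt (1 - c^2) + |inner ℝ y ν| / ‖y‖ := by
    have h2 : inner ℝ e ν = inner ℝ (e - (c/‖y‖) • y) ν + (c/‖y‖) * inner ℝ y ν := by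
      rw [inner_sub_left, real_inner_smul_left]; ring
    have h3 : ‖e - (c/‖y‖) • y‖ = Real.sqrt (1 - c^2) := by
      rw [eq_comm, Real.sqrt_eq_iff_mul_self_eq hsq (norm_nonneg _), ← pow_two, norm_sub_sq_real, he, inner_smul_right, norm_smul, real_inner_comm,
        Real.norm_eq_abs, mul_pow, sq_abs]
      have : inner ℝ y e = c * ‖y‖ := by rw [hc]; field_simp
      rw [this]; field_simp; ring
    rw [h2]
    refine (abs_add_le _ _).trans (add_le_add ?_ ?_)
    · refine (abs_real_inner_le_norm _ _).trans ?_
      rw [hν, mul_one, h3]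
    · rw [abs_mul, abs_div, abs_norm, div_mul_eq_mul_div]
      refine div_le_div_of_nonneg_right ?_ hyn.le
      nlinarith [abs_nonneg (inner ℝ y ν)]
  calc xi e m M χ y * |inner ℝ e ν| ≤ xi e m M χ y * (Real.sqrt (1 - c^2) + |inner ℝ y ν| / ‖y‖) := mul_le_mul_of_nonneg_left hdec h0
    _ = xi e m M χ y * Real.sqrt (1 - c^2) + xi e m M χ y * (|inner ℝ y ν| / ‖y‖) := by ring
    _ ≤ 1 + (2^m/M) * (|inner ℝ y ν| / ‖y‖) := by
      refine add_le_add ?_ (mul_le_mul_of_nonneg_right h1 (by positivity))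
      rw [hxi]
      have h4 := hMm c ⟨hcl, hcu⟩
      have h5 : (1+c)^m * χ ‖y‖ * Real.sqrt (1-c^2) ≤ M := by
        have : 0 ≤ (1+c)^m * Real.sqrt (1-c^2) := by positivity
        nlinarith
      rw [mul_assoc, inv_mul_le_iff₀ hM, mul_one]; exact h5
end
section
theorem bad_cover {N : ℕ} {e : Rn N} (he : ‖e‖ = 1) (m : ℕ) {M : ℝ} (hM : 0 < M)
    (hMm : ∀ c ∈ Icc (-1:ℝ) 1, (1+c)^m * Real.sqrt (1-c^2) ≤ M) {χ : ℝ → ℝ} {a b : ℝ} (h : Cut χ a b)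
    {V T : Set (Rn N)} (hV : IsOpen V) (hVT : ∀ z ∈ frontier V, z ≠ 0 → ‖z‖ < 1 → z ∈ T)
    {δ : ℝ} (hδ : 0 < δ) (J : ℕ) (Q : ℕ → Set (Rn N)) (ν : ℕ → Rn N)
    (hQ : ∀ j, ‖ν j‖ = 1 ∧ Flat δ (ν j) (Q j))
    {s : ℝ} (hs : 0 < s) (hs1 : b + s * (2^m/M) < 1) (hs2 : s * (2^m/M) < a) (hs3 : s * (2^m/M) ≤ δ) :
    (V ∩ ball 0 1) \ {y | y - (s * xi e m M χ y) • e ∈ V} ⊆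
      (⋃ j ∈ Finset.range J, (Q j + slab (ν j) ((1 + (2^m/M) * (2*δ/a)) * s) ((2^m/M) * s))) ∪
      {w | ∃ t ∈ Icc (0:ℝ) ((2^m/M) * s), ∃ x ∈ T \ ⋃ j ∈ Finset.range J, Q j, w = x + t • e} := by
  rintro y ⟨⟨hyV, hy1⟩, hbad⟩
  set S := 2^m/M with hS
  have hS0 : 0 ≤ S := by positivity
  obtain ⟨hx0, hxS, hxν⟩ := xi_bounds he m hM hMm h y
  have hne : ‖y‖ ∈ Icc a b := by
    by_contra hc
    apply hbad
    rw [mem_ofPred_eq, xi_supp e m M h hc]; simpa using hyV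
  obtain ⟨t, ht, hz⟩ := hit_frontier hV hyV hbad
  set d : Rn N := t • (s * xi e m M χ y) • e with hd
  have hcoef0 : 0 ≤ t * (s * xi e m M χ y) := mul_nonneg ht.1 (by positivity)
  have hcoef1 : t * (s * xi e m M χ y) ≤ s * xi e m M χ y := by
    have : 0 ≤ s * xi e m M χ y := by positivity
    nlinarith [ht.2]
  have hcoef2 : t * (s * xi e m M χ y) ≤ S * s := by nlinarith
  have hdn : ‖d‖ = t * (s * xi e m M χ y) := by
    rw [hd, smul_smul, norm_smul, he, mul_one, Real.norm_of_nonneg hcoef0]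
  have hyd : y = (y - d) + d := by abel
  have hzlow : 0 < ‖y - d‖ := by
    have := norm_sub_norm_le y d
    nlinarith [hne.1]
  have hzup : ‖y - d‖ < 1 := by
    have := norm_sub_le y d
    nlinarith [hne.2]
  have hzT : y - d ∈ T := hVT _ hz (norm_pos_iff.1 hzlow) hzup
  by_cases hQj : y - d ∈ ⋃ j ∈ Finset.range J, Q j
  · left
    simp only [mem_iUnion] at hQj ⊢
    obtain ⟨j, hj, hzj⟩ := hQj
    refine ⟨j, hj, ?_⟩
    refine Set.mem_add.2 ⟨y - d, hzj, d, ⟨?_, ?_⟩, by abel⟩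
    · have h1 : |inner ℝ y (ν j)| ≤ 2 * δ := by
        conv_lhs => rw [hyd, inner_add_left]
        have h2 := (hQ j).2.1 _ hzj
        have h3 := abs_real_inner_le_norm d (ν j)
        rw [(hQ j).1, mul_one] at h3
        have h4 := abs_add_le (inner ℝ (y - d) (ν j)) (inner ℝ d (ν j))
        have h5 : δ * ‖y - d‖ ≤ δ := by nlinarith
        linarith
      have h6 : |inner ℝ y (ν j)| / ‖y‖ ≤ 2 * δ / a :=
        div_le_div₀ (by positivity) h1 h.ha hne.1
      have h7 := hxν (ν j) (hQ j).1
      have h8 : S * (|inner ℝ y (ν j)| / ‖y‖) ≤ S * (2 * δ / a) := mul_le_mul_of_nonneg_left h6 hS0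
      have h9 : |inner ℝ d (ν j)| = t * s * (xi e m M χ y * |inner ℝ e (ν j)|) := by
        rw [hd, smul_smul, real_inner_smul_left, abs_mul, abs_of_nonneg hcoef0]; ring
      rw [h9]
      have h10 : 0 ≤ xi e m M χ y * |inner ℝ e (ν j)| := by positivity
      calc t * s * (xi e m M χ y * |inner ℝ e (ν j)|) ≤ s * (xi e m M χ y * |inner ℝ e (ν j)|) :=
            mul_le_mul_of_nonneg_right (by nlinarith [ht.2]) h10
        _ ≤ s * (1 + S * (2 * δ / a)) := mul_le_mul_of_nonneg_left (by linarith) hs.le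
        _ = _ := by ring
    · rw [hdn]; exact hcoef2
  · right
    exact ⟨t * (s * xi e m M χ y), ⟨hcoef0, hcoef2⟩, y - d, ⟨hzT, hQj⟩, by rw [hd, smul_smul]; abel⟩

theorem sweep_vol {k : ℕ} {e : Rn (k+2)} (he : ‖e‖ = 1) {R : Set (Rn (k+2))} {s : ℝ} (hs : 0 < s) :
    cH (k+2) * volume {w | ∃ t ∈ Icc (0:ℝ) s, ∃ x ∈ R, w = x + t • e} ≤ oR (4^(k+2) * s) * μH[((k+1:ℕ):ℝ)] R := by
  have := sweep (k+1) (by omega) R (fun (t:ℝ) (x : Rn (k+2)) => x + t • e) (C := 1) one_pos hs (by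
    intro t _ t' _ x _ x' _
    rw [one_mul]
    refine (dist_add_add_le _ _ _ _).trans ?_
    rw [add_comm]
    refine add_le_add ?_ le_rfl
    rw [dist_eq_norm, ← sub_smul, norm_smul, he, mul_one, Real.norm_eq_abs])
  have hm : (μH[((k+2:ℕ):ℝ)] : Measure (Rn (k+2))) = cH (k+2) • volume := muH_flat _
  have this2 : μH[((k+2:ℕ):ℝ)] {w | ∃ t ∈ Icc (0:ℝ) s, ∃ x ∈ R, w = x + t • e} ≤ oR ((4*1)^(k+2) * s) * μH[((k+1:ℕ):ℝ)] R := this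
  rw [hm] at this2
  simpa using this2
end
section
theorem lower_aux {k : ℕ} (hk : 1 ≤ k) {C : Set (Rn (k+2))} (hcone : ∀ t : ℝ, 0 ≤ t → ∀ x ∈ C, t • x ∈ C)
    (hrect : KRectifiable (k+2) k (C ∩ sphere (0 : Rn (k+2)) 1)) {T : Set (Rn (k+2))} (hT : MeasurableSet T) (hTC : T ⊆ C ∩ ball 0 1)
    (hfin : μH[((k+1:ℕ):ℝ)] T ≠ ⊤) {ι : Type} (I : Finset ι) (V : ι → Set (Rn (k+2))) (e : ι → Rn (k+2))
    (hV : ∀ i ∈ I, IsOpen (V i) ∧ ‖e i‖ = 1 ∧ ∀ z ∈ frontier (V i), z ≠ 0 → ‖z‖ < 1 → z ∈ T)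
    (hdis : (I : Set ι).PairwiseDisjoint V)
    (m : ℕ) {M : ℝ} (hM : 0 < M) (hMm : ∀ c ∈ Icc (-1:ℝ) 1, (1+c)^m * Real.sqrt (1-c^2) ≤ M)
    {χ : ℝ → ℝ} {a b : ℝ} (h : Cut χ a b) {ζ : ℝ} (hζ : 0 < ζ) :
    (cH (k+1)).toReal * ∑ i ∈ I, ∫ y in V i ∩ ball 0 1, -(fderiv ℝ (xi (e i) m M χ) y (e i)) ≤
      (2 + ζ) * ((μH[((k+1:ℕ):ℝ)] T).toReal + ζ) + ζ := by
  set S := (2:ℝ)^m/M with hS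
  have hS0 : 0 < S := by positivity
  have ha := h.ha
  let Γ : ℝ := (cH (k+1)).toReal * ((cH (k+2)).toReal)⁻¹ * (4^(k+2) * S)
  have hΓ0 : 0 ≤ Γ := by positivity
  set δ : ℝ := min (1/2) (ζ / (4*S/a + 4*S)) with hδdef
  have hδ : 0 < δ := by positivity
  have hδ1 : δ ≤ 1/2 := min_le_left _ _
  have hδ2 : 2 * (1 + S * (2*δ/a)) + 4 * S * δ ≤ 2 + ζ := by
    have h1 : δ ≤ ζ / (4*S/a + 4*S) := min_le_right _ _
    rw [le_div_iff₀ (by positivity)] at h1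
    have : 2 * (1 + S * (2*δ/a)) + 4 * S * δ = 2 + δ * (4*S/a + 4*S) := by ring
    linarith
  let ε : ℝ := ζ / (I.card * Γ + 1)
  have hε : 0 < ε := by positivity
  obtain ⟨J, Q, ν, hQ, hQd, hR⟩ := pieces hk hcone hrect hT hTC hfin hδ (by linarith) (ε := oR ε) (by simpa using hε)
  let ε' : ℝ := ζ / (J + 1)
  have hε' : 0 < ε' := by positivity
  have hmink : ∀ᶠ s in 𝓝[>] (0:ℝ), ∀ j ∈ Finset.range J, cH (k+1) * volume (Q j + slab (ν j) ((1 + S * (2*δ/a)) * s) (S * s)) ≤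
      oR (s * (2 * (1 + S * (2*δ/a)) + 4 * S * δ)) * (μH[((k+1:ℕ):ℝ)] (Q j) + oR ε') := by
    rw [Filter.eventually_all_finset]
    intro j _
    exact mink (hQ j).1 (hQ j).2.2.1 hδ.le hδ1 (hQ j).2.2.2 (by positivity) hS0 (by simpa using hε')
  have hflow : ∀ i, ∃ L : ℝ, 0 ≤ L ∧ (i ∈ I → ∀ᶠ s in 𝓝[>] (0:ℝ), s * ∫ y in V i ∩ ball 0 1, -(fderiv ℝ (xi (e i) m M χ) y (e i)) ≤
      (1 + s * L) * volume.real ((V i ∩ ball 0 1) \ {y | y - (s * xi (e i) m M χ y) • e i ∈ V i})) := by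
    intro i
    by_cases hi : i ∈ I
    · obtain ⟨L, hL, h2⟩ := flow_vol (hV i hi).2.1 (xi_contDiff (e i) m M h) h.hb (fun x hx => xi_supp (e i) m M h hx) (hV i hi).1.measurableSet
      exact ⟨L, hL, fun _ => h2⟩
    · exact ⟨0, le_rfl, fun h => absurd h hi⟩
  choose L hL0 hL using hflow
  have hflow2 : ∀ᶠ s in 𝓝[>] (0:ℝ), ∀ i ∈ I, s * ∫ y in V i ∩ ball 0 1, -(fderiv ℝ (xi (e i) m M χ) y (e i)) ≤
      (1 + s * L i) * volume.real ((V i ∩ ball 0 1) \ {y | y - (s * xi (e i) m M χ y) • e i ∈ V i}) := by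
    rw [Filter.eventually_all_finset]
    exact fun i hi => hL i hi
  have hsmall : ∀ᶠ s in 𝓝[>] (0:ℝ), b + s * S < 1 ∧ s * S < a ∧ s * S ≤ δ := by
    have c1 : Tendsto (fun s : ℝ => s * S) (𝓝[>] 0) (𝓝 0) := by
      have : Continuous (fun s : ℝ => s * S) := by fun_prop
      simpa using (this.tendsto 0).mono_left nhdsWithin_le_nhds
    have hb := h.hb
    filter_upwards [c1.eventually_lt_const (show 0 < 1 - b by linarith), c1.eventually_lt_const ha, c1.eventually_lt_const hδ] with s h1 h2 h3
    exact ⟨by linarith, h2, h3.le⟩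
  set Ht := (μH[((k+1:ℕ):ℝ)] T).toReal with hHt
  set B : ℝ := (2 + ζ) * (Ht + ζ) + ζ with hB
  have hHt0 : 0 ≤ Ht := ENNReal.toReal_nonneg
  have hcH := cH_ne_top (k+1)
  have hcH2 := cH_ne_top (k+2)
  have hcH20 := cH_ne_zero (k+2)
  have hmain : ∀ᶠ s in 𝓝[>] (0:ℝ), (cH (k+1)).toReal * ∑ i ∈ I, ∫ y in V i ∩ ball 0 1, -(fderiv ℝ (xi (e i) m M χ) y (e i)) ≤
      (1 + s * ∑ i ∈ I, L i) * B := by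
    filter_upwards [hmink, hflow2, hsmall, self_mem_nhdsWithin] with s hm hf hsm hs
    have hs : 0 < s := hs
    let bad : ι → Set (Rn (k+2)) := fun i => (V i ∩ ball 0 1) \ {y | y - (s * xi (e i) m M χ y) • e i ∈ V i}
    let slb : ℕ → Set (Rn (k+2)) := fun j => Q j + slab (ν j) ((1 + S * (2*δ/a)) * s) (S * s)
    let sw : ι → Set (Rn (k+2)) := fun i => {w | ∃ t ∈ Icc (0:ℝ) (S * s), ∃ x ∈ T \ ⋃ j ∈ Finset.range J, Q j, w = x + t • e i}
    have hbadm : ∀ i ∈ I, MeasurableSet (bad i) := by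
      intro i hi
      refine ((hV i hi).1.measurableSet.inter measurableSet_ball).diff ?_
      have hc := (xi_contDiff (e i) m M h).continuous
      exact ((hV i hi).1.preimage (f := fun y => y - (s * xi (e i) m M χ y) • e i) (by fun_prop)).measurableSet
    have hbadf : ∀ i, volume (bad i) ≠ ⊤ := fun i =>
      ((measure_mono (sdiff_subset.trans inter_subset_right)).trans_lt measure_ball_lt_top).ne
    have hcov : (⋃ i ∈ I, bad i) ⊆ (⋃ j ∈ Finset.range J, slb j) ∪ ⋃ i ∈ I, sw i := by
      refine iUnion₂_subset (fun i hi => ?_)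
      refine (bad_cover (hV i hi).2.1 m hM hMm h (hV i hi).1 (hV i hi).2.2 hδ J Q ν (fun j => ⟨(hQ j).2.2.1, (hQ j).2.2.2⟩) hs hsm.1 hsm.2.1 hsm.2.2).trans ?_
      exact union_subset_union_right _ (subset_iUnion₂ (s := fun i (_ : i ∈ I) => sw i) i hi)
    have hsum : ∑ i ∈ I, volume (bad i) = volume (⋃ i ∈ I, bad i) := by
      rw [measure_biUnion_finset _ hbadm]
      intro i hi j hj hij
      exact (hdis hi hj hij).mono (sdiff_subset.trans inter_subset_left) (sdiff_subset.trans inter_subset_left)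
    have hswle : ∀ i ∈ I, cH (k+1) * volume (sw i) ≤ oR (s * (Γ * ε)) := by
      intro i hi
      have h1 := sweep_vol (hV i hi).2.1 (R := T \ ⋃ j ∈ Finset.range J, Q j) (s := S * s) (by positivity)
      have h2 : volume (sw i) ≤ (cH (k+2))⁻¹ * (oR (4^(k+2) * (S * s)) * oR ε) := by
        have h3 := h1.trans (mul_le_mul' le_rfl hR)
        rw [mul_comm, ← ENNReal.le_div_iff_mul_le (Or.inl hcH20) (Or.inl hcH2)] at h3
        rwa [ENNReal.div_eq_inv_mul] at h3
      refine (mul_le_mul' le_rfl h2).trans (le_of_eq ?_)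
      rw [← ENNReal.ofReal_toReal hcH, ← ENNReal.ofReal_toReal (ENNReal.inv_ne_top.2 hcH20), ENNReal.toReal_inv, ← ENNReal.ofReal_mul (by positivity), ← ENNReal.ofReal_mul (by positivity), ← ENNReal.ofReal_mul (by positivity)]
      congr 1
      simp only [Γ]; ring
    have hQsum : ∑ j ∈ Finset.range J, (μH[((k+1:ℕ):ℝ)] (Q j) + oR ε') ≤ oR (Ht + ζ) := by
      rw [Finset.sum_add_distrib, ENNReal.ofReal_add hHt0 hζ.le]
      refine add_le_add ?_ ?_
      · rw [← measure_biUnion_finset (fun i _ j _ hij => hQd hij) (fun j _ => (hQ j).1.measurableSet), hHt, ENNReal.ofReal_toReal hfin]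
        exact measure_mono (iUnion₂_subset (fun j _ => (hQ j).2.1))
      · rw [Finset.sum_const, Finset.card_range, nsmul_eq_mul, ← ENNReal.ofReal_natCast, ← ENNReal.ofReal_mul (by positivity)]
        refine ENNReal.ofReal_le_ofReal ?_
        simp only [ε']
        rw [mul_div_assoc', div_le_iff₀ (by positivity)]
        nlinarith
    have hcard : (I.card : ℝ) * (Γ * ε) ≤ ζ := by
      simp only [ε]
      rw [mul_div_assoc', mul_div_assoc', div_le_iff₀ (by positivity)]
      nlinarith
    have htot : cH (k+1) * volume (⋃ i ∈ I, bad i) ≤ oR (s * B) := by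
      calc cH (k+1) * volume (⋃ i ∈ I, bad i) ≤ cH (k+1) * ((∑ j ∈ Finset.range J, volume (slb j)) + ∑ i ∈ I, volume (sw i)) := by
            refine mul_le_mul' le_rfl ((measure_mono hcov).trans ((measure_union_le _ _).trans ?_))
            exact add_le_add (measure_biUnion_finset_le _ _) (measure_biUnion_finset_le _ _)
        _ = (∑ j ∈ Finset.range J, cH (k+1) * volume (slb j)) + ∑ i ∈ I, cH (k+1) * volume (sw i) := by
            rw [mul_add, Finset.mul_sum, Finset.mul_sum]
        _ ≤ (∑ j ∈ Finset.range J, oR (s * (2 + ζ)) * (μH[((k+1:ℕ):ℝ)] (Q j) + oR ε')) + ∑ i ∈ I, oR (s * (Γ * ε)) := by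
            refine add_le_add (Finset.sum_le_sum (fun j hj => ?_)) (Finset.sum_le_sum hswle)
            refine (hm j hj).trans (mul_le_mul' (ENNReal.ofReal_le_ofReal ?_) le_rfl)
            exact mul_le_mul_of_nonneg_left hδ2 hs.le
        _ ≤ oR (s * (2 + ζ)) * oR (Ht + ζ) + oR (s * ζ) := by
            rw [← Finset.mul_sum]
            refine add_le_add (mul_le_mul' le_rfl hQsum) ?_
            rw [Finset.sum_const, nsmul_eq_mul, ← ENNReal.ofReal_natCast, ← ENNReal.ofReal_mul (by positivity)]
            refine ENNReal.ofReal_le_ofReal ?_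
            nlinarith
        _ = oR (s * B) := by
            rw [← ENNReal.ofReal_mul (by positivity), ← ENNReal.ofReal_add (by positivity) (by positivity)]
            congr 1; rw [hB]; ring
    have hreal : (cH (k+1)).toReal * ∑ i ∈ I, volume.real (bad i) ≤ s * B := by
      have h1 := ENNReal.toReal_mono ENNReal.ofReal_ne_top htot
      rw [ENNReal.toReal_ofReal (by positivity), ENNReal.toReal_mul, ← hsum, ENNReal.toReal_sum (fun i _ => hbadf i)] at h1
      exact h1
    have hfl : s * ∑ i ∈ I, ∫ y in V i ∩ ball 0 1, -(fderiv ℝ (xi (e i) m M χ) y (e i)) ≤ (1 + s * ∑ i ∈ I, L i) * ∑ i ∈ I, volume.real (bad i) := by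
      rw [Finset.mul_sum, Finset.mul_sum (f := fun i => volume.real (bad i))]
      refine Finset.sum_le_sum (fun i hi => (hf i hi).trans ?_)
      refine mul_le_mul_of_nonneg_right ?_ measureReal_nonneg
      have : L i ≤ ∑ i ∈ I, L i := Finset.single_le_sum (f := L) (fun i _ => hL0 i) hi
      nlinarith
    have hLs : 0 ≤ ∑ i ∈ I, L i := Finset.sum_nonneg (fun i _ => hL0 i)
    have hc0 : 0 ≤ (cH (k+1)).toReal := ENNReal.toReal_nonneg
    have h3 := mul_le_mul_of_nonneg_left hfl hc0
    have h4 : (1 + s * ∑ i ∈ I, L i) * ((cH (k+1)).toReal * ∑ i ∈ I, volume.real (bad i)) ≤ (1 + s * ∑ i ∈ I, L i) * (s * B) :=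
      mul_le_mul_of_nonneg_left hreal (by positivity)
    refine le_of_mul_le_mul_left ?_ hs
    linarith
  have hlim : Tendsto (fun s : ℝ => (1 + s * ∑ i ∈ I, L i) * B) (𝓝[>] 0) (𝓝 B) := by
    have : Continuous (fun s : ℝ => (1 + s * ∑ i ∈ I, L i) * B) := by fun_prop
    simpa using (this.tendsto 0).mono_left (nhdsWithin_le_nhds (s := Ioi 0))
  exact ge_of_tendsto hlim hmain

theorem lower_abs {k : ℕ} (hk : 1 ≤ k) {C : Set (Rn (k+2))} (hcone : ∀ t : ℝ, 0 ≤ t → ∀ x ∈ C, t • x ∈ C)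
    (hrect : KRectifiable (k+2) k (C ∩ sphere (0 : Rn (k+2)) 1)) {T : Set (Rn (k+2))} (hT : MeasurableSet T) (hTC : T ⊆ C ∩ ball 0 1)
    (hfin : μH[((k+1:ℕ):ℝ)] T ≠ ⊤) {ι : Type} (I : Finset ι) (V : ι → Set (Rn (k+2))) (e : ι → Rn (k+2))
    (hV : ∀ i ∈ I, IsOpen (V i) ∧ ‖e i‖ = 1 ∧ ∀ z ∈ frontier (V i), z ≠ 0 → ‖z‖ < 1 → z ∈ T)
    (hVc : ∀ i ∈ I, ∀ x, x ≠ 0 → (x ∈ V i ↔ ‖x‖⁻¹ • x ∈ V i))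
    (hdis : (I : Set ι).PairwiseDisjoint V)
    (m : ℕ) {M : ℝ} (hM : 0 < M) (hMm : ∀ c ∈ Icc (-1:ℝ) 1, (1+c)^m * Real.sqrt (1-c^2) ≤ M) {X : ℝ} (hX0 : 0 ≤ X)
    (hX : X ≤ ∑ i ∈ I, ∫ y in {y : Sph (k+2) | y.1 ∈ V i}, (1 + inner ℝ y.1 (e i))^m * (((k+1:ℕ)+m) * inner ℝ y.1 (e i) - m) ∂sg (k+2)) :
    (cH (k+1)).toReal * X ≤ 2 * (k+1) * M * (μH[((k+1:ℕ):ℝ)] T).toReal := by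
  set Ht := (μH[((k+1:ℕ):ℝ)] T).toReal with hHt
  have hc0 : 0 ≤ (cH (k+1)).toReal := ENNReal.toReal_nonneg
  have key : ∀ θ : ℝ, θ < 1 → 0 < θ → (cH (k+1)).toReal * (θ * X) ≤ 2 * (k+1) * M * Ht := by
    intro θ hθ hθ0
    obtain ⟨χ, a, b, h, hI⟩ := exists_cut (k+1) (by omega) hθ
    set Iχ := ∫ ρ in Ioi (0:ℝ), ρ^(k+1-1) * χ ρ with hIχ
    have h1 : (cH (k+1)).toReal * (M⁻¹ * Iχ * X) ≤ 2 * Ht := by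
      have hlim : Tendsto (fun ζ : ℝ => (2 + ζ) * (Ht + ζ) + ζ) (𝓝[>] 0) (𝓝 (2 * Ht)) := by
        have : Continuous (fun ζ : ℝ => (2 + ζ) * (Ht + ζ) + ζ) := by fun_prop
        simpa using (this.tendsto 0).mono_left (nhdsWithin_le_nhds (s := Ioi 0))
      refine ge_of_tendsto hlim ?_
      filter_upwards [self_mem_nhdsWithin] with ζ hζ
      refine le_trans ?_ (lower_aux hk hcone hrect hT hTC hfin I V e hV hdis m hM hMm h hζ)
      refine mul_le_mul_of_nonneg_left ?_ hc0
      have hpos : 0 ≤ M⁻¹ * Iχ := by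
        have : 0 ≤ Iχ := by
          have : (0:ℝ) < ((k+1:ℕ):ℝ) := by positivity
          by_contra hneg
          push Not at hneg
          nlinarith
        positivity
      refine (mul_le_mul_of_nonneg_left hX hpos).trans (le_of_eq ?_)
      rw [Finset.mul_sum]
      refine Finset.sum_congr rfl (fun i hi => ?_)
      exact (int_F (by omega) (hV i hi).2.1 m M h (hV i hi).1.measurableSet (hVc i hi)).symm
    have h2 : θ * X ≤ ((k+1:ℕ):ℝ) * Iχ * X := mul_le_mul_of_nonneg_right hI hX0
    calc (cH (k+1)).toReal * (θ * X) ≤ (cH (k+1)).toReal * (((k+1:ℕ):ℝ) * Iχ * X) := mul_le_mul_of_nonneg_left h2 hc0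
      _ = (k+1) * M * ((cH (k+1)).toReal * (M⁻¹ * Iχ * X)) := by push_cast; field_simp
      _ ≤ (k+1) * M * (2 * Ht) := mul_le_mul_of_nonneg_left h1 (by positivity)
      _ = _ := by ring
  have hlim : Tendsto (fun θ : ℝ => (cH (k+1)).toReal * (θ * X)) (𝓝[<] 1) (𝓝 ((cH (k+1)).toReal * X)) := by
    have : Continuous (fun θ : ℝ => (cH (k+1)).toReal * (θ * X)) := by fun_prop
    simpa using (this.tendsto 1).mono_left (nhdsWithin_le_nhds (s := Iio 1))
  refine le_of_tendsto hlim ?_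
  have h0 : ∀ᶠ θ in 𝓝[<] (1:ℝ), 0 < θ := nhdsWithin_le_nhds (Ioi_mem_nhds one_pos)
  filter_upwards [self_mem_nhdsWithin, h0] with θ h1 h2 using key θ h1 h2
end
section
def rp {N : ℕ} (r : ℝ) (x : Rn N) : Rn N := (r / ‖x‖) • x

def Om {N : ℕ} (K : Set (Rn N)) (r : ℝ) : Set (Rn N) := {x | x ≠ 0 ∧ rp r x ∉ K}

theorem rp_norm {N : ℕ} {r : ℝ} (hr : 0 < r) {x : Rn N} (hx : x ≠ 0) : ‖rp r x‖ = r := by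
  have : 0 < ‖x‖ := norm_pos_iff.2 hx
  rw [rp, norm_smul, Real.norm_of_nonneg (by positivity)]; field_simp

theorem rp_smul {N : ℕ} {r t : ℝ} (ht : 0 < t) (x : Rn N) : rp r (t • x) = rp r x := by
  rw [rp, rp, norm_smul, Real.norm_of_nonneg ht.le, smul_smul]
  congr 1
  by_cases h : ‖x‖ = 0
  · simp [h]
  · field_simp

theorem rp_self {N : ℕ} {r : ℝ} (hr : 0 < r) {x : Rn N} (hx : ‖x‖ = r) : rp r x = x := by
  rw [rp, hx, div_self hr.ne', one_smul]

theorem eq_smul_rp {N : ℕ} {r : ℝ} (hr : 0 < r) {x : Rn N} (hx : x ≠ 0) : x = (‖x‖ / r) • rp r x := by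
  have : ‖x‖ ≠ 0 := norm_ne_zero_iff.2 hx
  rw [rp, smul_smul]
  have : ‖x‖ / r * (r / ‖x‖) = 1 := by field_simp
  rw [this, one_smul]

theorem rp_cont {N : ℕ} (r : ℝ) : ContinuousOn (rp r) ({0}ᶜ : Set (Rn N)) := by
  intro x hx
  have : ‖x‖ ≠ 0 := norm_ne_zero_iff.2 hx
  refine ContinuousAt.continuousWithinAt ?_
  exact (continuousAt_const.div continuous_norm.continuousAt this).smul continuousAt_id

theorem Om_open {N : ℕ} {K : Set (Rn N)} (hK : IsClosed K) (r : ℝ) : IsOpen (Om K r) := by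
  have := (rp_cont (N := N) r).isOpen_inter_preimage isOpen_compl_singleton hK.isOpen_compl
  convert this using 1
  rfl

theorem sph_sub_Om {N : ℕ} {K : Set (Rn N)} {r : ℝ} (hr : 0 < r) : sphere (0 : Rn N) r \ K ⊆ Om K r := by
  rintro x ⟨hx, hxK⟩
  rw [mem_sphere_zero_iff_norm] at hx
  exact ⟨norm_ne_zero_iff.1 (by rw [hx]; exact hr.ne'), by rwa [rp_self hr hx]⟩

theorem rp_mem {N : ℕ} {K : Set (Rn N)} {r : ℝ} (hr : 0 < r) {x : Rn N} (hx : x ∈ Om K r) : rp r x ∈ sphere (0 : Rn N) r \ K :=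
  ⟨by rw [mem_sphere_zero_iff_norm]; exact rp_norm hr hx.1, hx.2⟩

theorem smul_mem_Om {N : ℕ} {K : Set (Rn N)} {r t : ℝ} (ht : 0 < t) {x : Rn N} (hx : x ∈ Om K r) : t • x ∈ Om K r :=
  ⟨smul_ne_zero ht.ne' hx.1, by rw [rp_smul ht]; exact hx.2⟩

theorem smul_mem_cc {N : ℕ} {K : Set (Rn N)} {r t : ℝ} (ht : 0 < t) {x : Rn N} (hx : x ∈ Om K r) :
    t • x ∈ connectedComponentIn (Om K r) x := by
  have hpre : IsPreconnected ((fun s : ℝ => s • x) '' Ioi 0) := isPreconnected_Ioi.image _ (by fun_prop)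
  refine hpre.subset_connectedComponentIn ⟨1, mem_Ioi.2 one_pos, one_smul _ _⟩ ?_ ⟨t, ht, rfl⟩
  rintro _ ⟨s, hs, rfl⟩
  exact smul_mem_Om hs hx

theorem comp_cone {N : ℕ} {K : Set (Rn N)} {r : ℝ} (hr : 0 < r) {x₀ : Rn N} (hx : x₀ ∈ sphere (0 : Rn N) r \ K) :
    coneOverN N (connectedComponentIn (sphere (0 : Rn N) r \ K) x₀) = connectedComponentIn (Om K r) x₀ := by
  have hxO := sph_sub_Om hr hx
  have hsub : connectedComponentIn (sphere (0 : Rn N) r \ K) x₀ ⊆ connectedComponentIn (Om K r) x₀ :=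
    isPreconnected_connectedComponentIn.subset_connectedComponentIn (mem_connectedComponentIn hx)
      ((connectedComponentIn_subset _ _).trans (sph_sub_Om hr))
  ext z
  constructor
  · rintro ⟨t, ht, y, hy, rfl⟩
    have h1 := hsub hy
    rw [connectedComponentIn_eq h1]
    exact smul_mem_cc ht (connectedComponentIn_subset _ _ h1)
  · intro hz
    have hzO := connectedComponentIn_subset _ _ hz
    have hpre : IsPreconnected (rp r '' connectedComponentIn (Om K r) x₀) :=
      isPreconnected_connectedComponentIn.image _ ((rp_cont r).mono (fun x hx => (connectedComponentIn_subset _ _ hx).1))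
    have h2 : rp r z ∈ connectedComponentIn (sphere (0 : Rn N) r \ K) x₀ := by
      refine hpre.subset_connectedComponentIn ⟨x₀, mem_connectedComponentIn hxO, rp_self hr (by simpa using hx.1)⟩ ?_ ⟨z, hz, rfl⟩
      rintro _ ⟨x, hx, rfl⟩
      exact rp_mem hr (connectedComponentIn_subset _ _ hx)
    exact ⟨‖z‖ / r, div_pos (norm_pos_iff.2 hzO.1) hr, _, h2, eq_smul_rp hr hzO.1⟩

theorem comp_sph {N : ℕ} {K : Set (Rn N)} {r : ℝ} (hr : 0 < r) {x₀ : Rn N} (hx : x₀ ∈ sphere (0 : Rn N) r \ K) :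
    connectedComponentIn (sphere (0 : Rn N) r \ K) x₀ = connectedComponentIn (Om K r) x₀ ∩ sphere 0 r := by
  rw [← comp_cone hr hx]
  ext z
  constructor
  · intro hz
    exact ⟨⟨1, one_pos, z, hz, (one_smul _ _).symm⟩, (connectedComponentIn_subset _ _ hz).1⟩
  · rintro ⟨⟨t, ht, y, hy, rfl⟩, hz⟩
    have hy2 := (connectedComponentIn_subset _ _ hy).1
    rw [mem_sphere_zero_iff_norm] at hy2 hz
    rw [norm_smul, hy2, Real.norm_of_nonneg ht.le] at hz
    have : t = 1 := by
      have : t * r = 1 * r := by rw [one_mul]; exact hz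
      exact mul_right_cancel₀ hr.ne' this
    rwa [this, one_smul]

def comps {N : ℕ} (K : Set (Rn N)) (r : ℝ) : Set (Set (Rn N)) := {V | ∃ x ∈ sphere (0 : Rn N) r \ K, V = connectedComponentIn (Om K r) x}

theorem comps_props {N : ℕ} {K : Set (Rn N)} (hK : IsClosed K) {r : ℝ} (hr : 0 < r) :
    (∀ V ∈ comps K r, IsOpen V ∧ V ⊆ Om K r ∧ (∀ z ∈ frontier V, z ∉ Om K r) ∧ ∀ x, ∀ t : ℝ, 0 < t → (x ∈ V ↔ t • x ∈ V)) ∧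
    (comps K r).PairwiseDisjoint id ∧ (comps K r).Countable ∧ (∀ x ∈ Om K r, ∃ V ∈ comps K r, x ∈ V) := by
  have hO := Om_open hK r
  have hd : (comps K r).PairwiseDisjoint id := by
    rintro _ ⟨x, hx, rfl⟩ _ ⟨y, hy, rfl⟩ hne
    rw [Function.onFun, Set.disjoint_left]
    intro z hz1 hz2
    exact hne ((connectedComponentIn_eq hz1).trans (connectedComponentIn_eq hz2).symm)
  have hop : ∀ V ∈ comps K r, IsOpen V := by
    rintro _ ⟨x, hx, rfl⟩; exact hO.connectedComponentIn
  have hcone : ∀ V ∈ comps K r, ∀ x, ∀ t : ℝ, 0 < t → x ∈ V → t • x ∈ V := by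
    rintro _ ⟨x0, hx0, rfl⟩ x t ht hx
    rw [connectedComponentIn_eq hx]
    exact smul_mem_cc ht (connectedComponentIn_subset _ _ hx)
  refine ⟨fun V hV => ⟨hop V hV, ?_, ?_, fun x t ht => ⟨hcone V hV x t ht, fun h => ?_⟩⟩, hd, ?_, fun x hx => ⟨_, ⟨rp r x, rp_mem hr hx, rfl⟩, ?_⟩⟩
  · obtain ⟨x, hx, rfl⟩ := hV; exact connectedComponentIn_subset _ _
  · intro z hz hzO
    have hV1 := hop V hV
    obtain ⟨x, hx, rfl⟩ := hV
    rw [hV1.frontier_eq] at hz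
    obtain ⟨w, hw1, hw2⟩ := mem_closure_iff.1 hz.1 _ (hO.connectedComponentIn (x := z)) (mem_connectedComponentIn hzO)
    apply hz.2
    rw [connectedComponentIn_eq hw2, ← connectedComponentIn_eq hw1]
    exact mem_connectedComponentIn hzO
  · have := hcone V hV _ t⁻¹ (inv_pos.2 ht) h
    rwa [smul_smul, inv_mul_cancel₀ ht.ne', one_smul] at this
  · refine hd.countable_of_isOpen hop ?_
    rintro _ ⟨x, hx, rfl⟩
    exact ⟨x, mem_connectedComponentIn (sph_sub_Om hr hx)⟩
  · have h1 := rp_mem hr hx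
    have := smul_mem_cc (t := ‖x‖ / r) (div_pos (norm_pos_iff.2 hx.1) hr) (sph_sub_Om hr h1)
    rwa [← eq_smul_rp hr hx.1] at this
end
section
theorem omH_ne_zero {k : ℕ} : omH (k+2) ≠ 0 := by
  intro h0
  have e : (((k+2:ℕ):ℝ) - 1) = ((k+1:ℕ):ℝ) := by push_cast; ring
  rw [omH, e] at h0
  have := sweep (k+1) (by omega) (sphere (0 : Rn (k+2)) 1) (fun (t:ℝ) (x : Rn (k+2)) => t • x) (C := 1) one_pos one_pos (by
    intro t ht t' ht' x hx x' hx'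
    rw [one_mul, dist_eq_norm, dist_eq_norm]
    have : t • x - t' • x' = (t - t') • x + t' • (x - x') := by rw [sub_smul, smul_sub]; abel
    rw [this]
    refine (norm_add_le _ _).trans ?_
    rw [norm_smul, norm_smul, mem_sphere_zero_iff_norm.1 hx, mul_one, Real.norm_eq_abs, Real.norm_of_nonneg ht'.1]
    nlinarith [norm_nonneg (x - x'), ht'.2])
  have this2 : μH[((k+2:ℕ):ℝ)] {w | ∃ t ∈ Icc (0:ℝ) 1, ∃ x ∈ sphere (0 : Rn (k+2)) 1, w = t • x} ≤ oR ((4*1)^(k+2) * 1) * μH[((k+1:ℕ):ℝ)] (sphere (0 : Rn (k+2)) 1) := this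
  rw [h0, mul_zero, muH_flat, Measure.smul_apply, smul_eq_mul, nonpos_iff_eq_zero, mul_eq_zero] at this2
  rcases this2 with h | h
  · exact cH_ne_zero _ h
  · have hb : ball (0 : Rn (k+2)) 1 \ {0} ⊆ {w | ∃ t ∈ Icc (0:ℝ) 1, ∃ x ∈ sphere (0 : Rn (k+2)) 1, w = t • x} := by
      rintro x ⟨hx, hx0⟩
      rw [mem_ball_zero_iff] at hx
      have hxn : ‖x‖ ≠ 0 := norm_ne_zero_iff.2 hx0
      refine ⟨‖x‖, ⟨norm_nonneg _, hx.le⟩, ‖x‖⁻¹ • x, ?_, ?_⟩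
      · rw [mem_sphere_zero_iff_norm, norm_smul, norm_inv, norm_norm, inv_mul_cancel₀ hxn]
      · rw [smul_inv_smul₀ hxn]
    have h1 : volume (ball (0 : Rn (k+2)) 1 \ {0}) = 0 := measure_mono_null hb h
    rw [measure_sdiff_null (measure_singleton _)] at h1
    exact (measure_ball_pos volume (0 : Rn (k+2)) one_pos).ne' h1

theorem emb_smul {N : ℕ} {r : ℝ} (hr : 0 < r) : MeasurableEmbedding (fun y : Sph N => r • (y : Rn N)) :=
  (MeasurableEquiv.smul₀ r hr.ne').measurableEmbedding.comp (MeasurableEmbedding.subtype_coe isClosed_sphere.measurableSet)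

theorem cS_pos {k : ℕ} : cS (k+2) ≠ 0 := by
  rw [cS]
  exact ENNReal.div_ne_zero.2 ⟨omH_ne_zero, measure_ne_top _ _⟩

theorem sg_univ_ne_zero {k : ℕ} : sg (k+2) univ ≠ 0 := by
  rw [Measure.toSphere_apply_univ]
  simp only [ne_eq, mul_eq_zero, not_or]
  refine ⟨by simp, (measure_ball_pos volume _ one_pos).ne'⟩

theorem cS_ne_top {k : ℕ} (hfin : omH (k+2) ≠ ⊤) : cS (k+2) ≠ ⊤ := by
  rw [cS]
  exact ENNReal.div_ne_top hfin sg_univ_ne_zero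

theorem muH_comp {N : ℕ} (hN : 1 ≤ N) (hfin : omH N ≠ ⊤) {r : ℝ} (hr : 0 < r) {V : Set (Rn N)} (hV : MeasurableSet V)
    (hVc : ∀ x, ∀ t : ℝ, 0 < t → (x ∈ V ↔ t • x ∈ V)) :
    (μH[(N:ℝ)-1] : Measure (Rn N)).restrict (V ∩ sphere 0 r) = (cS N * oR (r ^ (N-1))) •
      ((sg N).restrict {y : Sph N | (y : Rn N) ∈ V}).map (fun y : Sph N => r • (y : Rn N)) := by
  rw [← Measure.restrict_restrict hV, muH_sphere_restrict hN hfin hr, Measure.restrict_smul, (emb_smul hr).restrict_map]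
  congr 3
  ext y
  exact (hVc y r hr).symm

theorem wirt_sg {k : ℕ} (hfin : omH (k+2) ≠ ⊤) {K : Set (Rn (k+2))} (hK : IsClosed K) {r : ℝ} (hr : 0 < r) {c : ℝ}
    (hW : ∀ x₀ ∈ sphere (0 : Rn (k+2)) r \ K, WirtingerIneqOn (k+2) (connectedComponentIn (sphere (0 : Rn (k+2)) r \ K) x₀) c)
    {V : Set (Rn (k+2))} (hV : V ∈ comps K r) {g : Rn (k+2) → ℝ} (hg : ∀ (y : Rn (k+2)) (t : ℝ), 0 < t → g (t • y) = g y)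
    (hlip : LocLipOn (k+2) g V)
    (hE : ∫⁻ y in {y : Sph (k+2) | y.1 ∈ V}, oR (‖gradient g (r • y.1)‖ ^ 2) ∂sg (k+2) < ⊤) :
    ∫⁻ y in {y : Sph (k+2) | y.1 ∈ V}, oR ((g y - ⨍ z in {y : Sph (k+2) | y.1 ∈ V}, g z ∂sg (k+2)) ^ 2) ∂sg (k+2) ≤
      oR c * ∫⁻ y in {y : Sph (k+2) | y.1 ∈ V}, oR (‖gradient g (r • y.1)‖ ^ 2) ∂sg (k+2) := by
  obtain ⟨hop, hsub, hfr, hVc⟩ := (comps_props hK hr).1 V hV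
  obtain ⟨x₀, hx₀, hVx⟩ := hV
  have hW0 := hW x₀ hx₀
  rw [comp_sph hr hx₀, ← hVx] at hW0
  have hcone : coneOverN (k+2) (V ∩ sphere 0 r) = V := by
    rw [hVx, ← comp_sph hr hx₀, comp_cone hr hx₀]
  have h1 := hW0 g hg (by rwa [hcone])
  have hm := muH_comp (N := k+2) (by omega) hfin hr hop.measurableSet hVc
  set a : ℝ≥0∞ := cS (k+2) * oR (r ^ (k+2-1)) with ha
  have ha0 : a ≠ 0 := mul_ne_zero cS_pos (by simpa using pow_pos hr _)
  have hat : a ≠ ⊤ := ENNReal.mul_ne_top (cS_ne_top hfin) ENNReal.ofReal_ne_top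
  set U : Set (Sph (k+2)) := {y | (y : Rn (k+2)) ∈ V} with hU
  have hl : ∀ f : Rn (k+2) → ℝ≥0∞, ∫⁻ y in V ∩ sphere 0 r, f y ∂μH[((k+2:ℕ):ℝ)-1] = a * ∫⁻ y in U, f (r • (y : Rn (k+2))) ∂sg (k+2) := by
    intro f
    rw [hm, lintegral_smul_measure, (emb_smul hr).lintegral_map, smul_eq_mul]
  have hav : (⨍ z in V ∩ sphere 0 r, g z ∂μH[((k+2:ℕ):ℝ)-1]) = ⨍ z in U, g z ∂sg (k+2) := by
    rw [average_eq, average_eq, hm, integral_smul_measure, (emb_smul hr).integral_map]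
    simp only [hg _ r hr, measureReal_def, Measure.smul_apply, (emb_smul hr).map_apply, preimage_univ, smul_eq_mul, ENNReal.toReal_mul, mul_inv]
    have : a.toReal ≠ 0 := (ENNReal.toReal_pos ha0 hat).ne'
    field_simp
  rw [hl, hl, hav] at h1
  have h2 := h1 (ENNReal.mul_lt_top hat.lt_top hE)
  simp only [hg _ r hr] at h2
  rw [mul_left_comm, ENNReal.mul_le_mul_iff_right ha0 hat] at h2
  exact h2
end
section
theorem grad_dir {N : ℕ} (b : Rn N) {x : Rn N} (hx : x ≠ 0) :
    HasGradientAt (fun x : Rn N => ‖x‖⁻¹ * inner ℝ b x) (‖x‖⁻¹ • b - (inner ℝ b x / ‖x‖^3) • x) x := by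
  have hn : ‖x‖ ≠ 0 := norm_ne_zero_iff.2 hx
  have h1 : HasFDerivAt (fun x : Rn N => ‖x‖^2) (2 • innerSL ℝ x) x := (hasStrictFDerivAt_norm_sq x).hasFDerivAt
  have h2 := (h1.sqrt (pow_ne_zero 2 hn))
  have e : (fun x : Rn N => √(‖x‖^2)) = fun x => ‖x‖ := by ext x; rw [Real.sqrt_sq (norm_nonneg _)]
  rw [e, Real.sqrt_sq (norm_nonneg _)] at h2
  have h3 := (hasDerivAt_inv hn).comp_hasFDerivAt x h2
  have h4 : HasFDerivAt (fun x : Rn N => inner ℝ b x) (innerSL ℝ b) x := (innerSL ℝ b).hasFDerivAt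
  have h5 := h3.mul h4
  rw [hasGradientAt_iff_hasFDerivAt]
  have e2 : InnerProductSpace.toDual ℝ (Rn N) (‖x‖⁻¹ • b - (inner ℝ b x / ‖x‖^3) • x) = (Inv.inv ∘ fun x : Rn N => ‖x‖) x • innerSL ℝ b + inner ℝ b x • -(‖x‖ ^ 2)⁻¹ • (1 / (2 * ‖x‖)) • (2 • innerSL ℝ x) := by
    ext z
    simp
    field_simp
    ring
  rw [e2]
  exact h5

theorem grad_dir_sq {N : ℕ} (b : Rn N) {x : Rn N} (hx : x ≠ 0) :
    ‖gradient (fun x : Rn N => ‖x‖⁻¹ * inner ℝ b x) x‖^2 = (‖b‖^2 - (‖x‖⁻¹ * inner ℝ b x)^2) / ‖x‖^2 := by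
  have hn : ‖x‖ ≠ 0 := norm_ne_zero_iff.2 hx
  rw [(grad_dir b hx).gradient, norm_sub_sq_real, norm_smul, norm_smul, inner_smul_left, inner_smul_right]
  simp only [norm_inv, norm_div, norm_pow, mul_pow, div_pow, Real.norm_eq_abs, sq_abs, conj_trivial, inv_pow, abs_norm]
  field_simp
  ring

theorem center {k : ℕ} (hfin : omH (k+2) ≠ ⊤) {K : Set (Rn (k+2))} (hK : IsClosed K) {r : ℝ} (hr : 0 < r) {γ τ : ℝ} (hγ : 0 < γ)
    (hτ : 0 < τ) (hτ2 : τ^2 ≤ 1 - (k+1)/γ)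
    (hW : ∀ x₀ ∈ sphere (0 : Rn (k+2)) r \ K, WirtingerIneqOn (k+2) (connectedComponentIn (sphere (0 : Rn (k+2)) r \ K) x₀) (r^2/γ))
    {V : Set (Rn (k+2))} (hV : V ∈ comps K r) :
    ∃ e : Rn (k+2), ‖e‖ = 1 ∧ τ * (sg (k+2)).real {y : Sph (k+2) | y.1 ∈ V} ≤
      ∫ y in {y : Sph (k+2) | y.1 ∈ V}, inner ℝ y.1 e ∂sg (k+2) := by
  set U : Set (Sph (k+2)) := {y | (y : Rn (k+2)) ∈ V} with hU
  obtain ⟨hop, hsub, hfr, hVc⟩ := (comps_props hK hr).1 V hV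
  have hV0 : ∀ x ∈ V, x ≠ 0 := fun x hx => (hsub hx).1
  set s := (sg (k+2)).real U with hs
  by_cases hs0 : s = 0
  · refine ⟨EuclideanSpace.single 0 1, by simp, ?_⟩
    have : sg (k+2) U = 0 := by
      rwa [hs, measureReal_eq_zero_iff] at hs0
    rw [hs0, Measure.restrict_eq_zero.2 this]; simp
  have hspos : 0 < s := lt_of_le_of_ne measureReal_nonneg (Ne.symm hs0)
  have hint : ∀ f : Sph (k+2) → ℝ, Continuous f → IntegrableOn f U (sg (k+2)) := by
    intro f hf
    exact ((hf.continuousOn.integrableOn_compact isCompact_univ).mono_set (subset_univ _))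
  set m : Fin (k+2) → ℝ := fun i => ⨍ z in U, (z : Rn (k+2)) i ∂sg (k+2) with hm
  have hcy : ∀ i, Continuous fun y : Sph (k+2) => y.1 i := fun i => by fun_prop
  have hmi : ∀ i, ∫ y in U, (y : Rn (k+2)) i ∂sg (k+2) = s * m i := by
    intro i
    rw [hm]; simp only
    rw [setAverage_eq, smul_eq_mul, ← hs]; field_simp
  have hkey : ∀ i, ∫ y in U, ((y : Rn (k+2)) i)^2 ∂sg (k+2) - s * (m i)^2 ≤ γ⁻¹ * ∫ y in U, (1 - ((y : Rn (k+2)) i)^2) ∂sg (k+2) := by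
    intro i
    set g : Rn (k+2) → ℝ := fun x => ‖x‖⁻¹ * inner ℝ (EuclideanSpace.single i (1:ℝ)) x with hgd
    have hgy : ∀ y : Sph (k+2), g y = y.1 i := by
      intro y
      have : ‖(y : Rn (k+2))‖ = 1 := mem_sphere_zero_iff_norm.1 y.2
      simp [g, this, EuclideanSpace.inner_single_left]
    have hgg : ∀ y : Sph (k+2), ‖gradient g (r • y.1)‖^2 = (1 - (y.1 i)^2) / r^2 := by
      intro y
      have h1 : ‖(y : Rn (k+2))‖ = 1 := mem_sphere_zero_iff_norm.1 y.2
      have hy0 : r • (y : Rn (k+2)) ≠ 0 := by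
        rw [← norm_ne_zero_iff, norm_smul, h1]; simpa using hr.ne'
      rw [hgd, grad_dir_sq _ hy0, norm_smul, h1, Real.norm_of_nonneg hr.le]
      simp [inner_smul_right, EuclideanSpace.inner_single_left]
      field_simp
    have hlt : ∫⁻ y in U, oR (‖gradient g (r • (y : Rn (k+2)))‖ ^ 2) ∂sg (k+2) < ⊤ := by
      simp only [hgg]
      exact (hint _ (by fun_prop)).lintegral_lt_top
    have h := wirt_sg hfin hK hr hW hV (g := g) (by
      intro y t ht
      simp only [g, norm_smul, inner_smul_right, Real.norm_of_nonneg ht.le]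
      field_simp) (by
      intro x hx
      have : ContDiffAt ℝ 1 g x := by
        refine ((contDiffAt_norm ℝ (hV0 x hx)).inv (norm_ne_zero_iff.2 (hV0 x hx))).mul ?_
        exact (innerSL ℝ (EuclideanSpace.single i (1:ℝ))).contDiff.contDiffAt
      obtain ⟨C, t, ht, hC⟩ := this.exists_lipschitzOnWith
      exact ⟨t, mem_nhdsWithin_of_mem_nhds ht, C, hC⟩) hlt
    simp only [hgg, hgy] at h
    have hn1 : ∀ y : Sph (k+2), 0 ≤ (1 - (y.1 i)^2) / r^2 := fun y => by rw [← hgg]; positivity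
    rw [← ofReal_integral_eq_lintegral_ofReal (hint _ (by fun_prop)) (ae_of_all _ fun y => sq_nonneg _),
      ← ofReal_integral_eq_lintegral_ofReal (hint _ (by fun_prop)) (ae_of_all _ hn1),
      ← ENNReal.ofReal_mul (by positivity), ENNReal.ofReal_le_ofReal_iff (mul_nonneg (by positivity) (integral_nonneg hn1)), integral_div] at h
    have e1 : ∫ y in U, ((y : Rn (k+2)) i - m i)^2 ∂sg (k+2) = ∫ y in U, ((y : Rn (k+2)) i)^2 ∂sg (k+2) - s * (m i)^2 := by
      have : ∀ y : Sph (k+2), (y.1 i - m i)^2 = ((y.1 i)^2 - (2 * m i) * y.1 i) + (m i)^2 := fun y => by ring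
      simp only [this]
      rw [integral_add (hint _ (by fun_prop)) (hint _ (by fun_prop)), integral_sub (hint _ (by fun_prop)) (hint _ (by fun_prop)), integral_const_mul, hmi]
      simp [← hs]; ring
    rw [e1] at h
    refine h.trans (le_of_eq ?_)
    field_simp
  have hsum := Finset.sum_le_sum fun i (_ : i ∈ Finset.univ) => hkey i
  have hsq : ∀ y : Sph (k+2), ∑ i, (y.1 i)^2 = 1 := by
    intro y
    have h1 : ‖(y : Rn (k+2))‖ = 1 := mem_sphere_zero_iff_norm.1 y.2
    rw [← EuclideanSpace.real_norm_sq_eq, h1]; norm_num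
  rw [Finset.sum_sub_distrib, ← Finset.mul_sum, ← Finset.mul_sum, ← integral_finsetSum _ (fun i _ => hint _ (by fun_prop)),
    ← integral_finsetSum _ (fun i _ => hint _ (by fun_prop))] at hsum
  simp only [Finset.sum_sub_distrib, hsq] at hsum
  simp [← hs] at hsum
  set mv : Rn (k+2) := WithLp.toLp 2 m with hmv
  have hmn : ‖mv‖^2 = ∑ i, m i ^2 := by rw [EuclideanSpace.real_norm_sq_eq]
  have hm1 : τ^2 ≤ ‖mv‖^2 := by
    rw [hmn]
    refine hτ2.trans ?_
    have : s * (1 - ∑ i, m i^2) ≤ s * ((k+1)/γ) := by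
      have : γ⁻¹ * (s * ((k:ℝ) + 2 - 1)) = s * ((k+1)/γ) := by field_simp; ring
      rw [this] at hsum; linarith
    have := le_of_mul_le_mul_left this hspos
    linarith
  have hm2 : τ ≤ ‖mv‖ := by nlinarith [norm_nonneg mv]
  have hm0 : ‖mv‖ ≠ 0 := (hτ.trans_le hm2).ne'
  refine ⟨‖mv‖⁻¹ • mv, by rw [norm_smul, norm_inv, norm_norm, inv_mul_cancel₀ hm0], ?_⟩
  have e3 : ∀ y : Sph (k+2), inner ℝ y.1 (‖mv‖⁻¹ • mv) = ∑ i, (‖mv‖⁻¹ * m i) * y.1 i := by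
    intro y
    rw [PiLp.inner_apply]
    refine Finset.sum_congr rfl fun i _ => ?_
    simp [hmv]
  simp only [e3]
  rw [integral_finsetSum _ (fun i _ => hint _ (by fun_prop))]
  simp only [integral_const_mul, hmi]
  have e4 : ∑ i, ‖mv‖⁻¹ * m i * (s * m i) = s * ‖mv‖ := by
    rw [show s * ‖mv‖ = ‖mv‖⁻¹ * s * ‖mv‖^2 by field_simp, hmn, Finset.mul_sum]
    exact Finset.sum_congr rfl fun i _ => by ring
  rw [e4]; nlinarith
end
section
theorem cS_sg {k : ℕ} : omH (k+2) = cS (k+2) * sg (k+2) univ := by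
  rw [cS, ENNReal.div_mul_cancel sg_univ_ne_zero (measure_ne_top _ _)]

theorem coneT {k : ℕ} {K : Set (Rn (k+2))} {r : ℝ} (hr : 0 < r) :
    (Ioo (0 : ℝ) 1 • ((↑) '' {y : Sph (k+2) | r • y.1 ∈ K} : Set (Rn (k+2)))) = (ball 0 1 \ {0}) \ Om K r := by
  ext x
  simp only [Set.mem_smul, mem_image, mem_ofPred_eq, Set.mem_sdiff, mem_ball_zero_iff, mem_singleton_iff, Om, not_and, not_not]
  constructor
  · rintro ⟨t, ht, _, ⟨y, hy, rfl⟩, rfl⟩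
    have h1 : ‖(y : Rn (k+2))‖ = 1 := mem_sphere_zero_iff_norm.1 y.2
    have hn : ‖t • (y : Rn (k+2))‖ = t := by rw [norm_smul, h1, mul_one, Real.norm_of_nonneg ht.1.le]
    refine ⟨⟨by rw [hn]; exact ht.2, norm_ne_zero_iff.1 (by rw [hn]; exact ht.1.ne')⟩, fun _ => ?_⟩
    rw [rp_smul ht.1, rp, h1, div_one]; exact hy
  · rintro ⟨⟨h1, h0⟩, h2⟩
    have hn : 0 < ‖x‖ := norm_pos_iff.2 h0
    refine ⟨‖x‖, ⟨hn, h1⟩, ‖x‖⁻¹ • x, ⟨⟨‖x‖⁻¹ • x, ?_⟩, ?_, rfl⟩, smul_inv_smul₀ hn.ne' x⟩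
    · rw [mem_sphere_zero_iff_norm, norm_smul, norm_inv, norm_norm, inv_mul_cancel₀ hn.ne']
    · simp only [smul_smul]; have := h2 h0; rwa [rp, div_eq_mul_inv] at this

theorem sg_eq_zero {k : ℕ} {K : Set (Rn (k+2))} (hK : IsClosed K) {r : ℝ} (hr : 0 < r)
    (h : μH[((k+1:ℕ):ℝ)] ((ball 0 1 \ {0}) \ Om K r) ≠ ⊤) : sg (k+2) {y | r • (y : Rn (k+2)) ∈ K} = 0 := by
  have hKm : MeasurableSet {y : Sph (k+2) | r • y.1 ∈ K} := (hK.preimage (by fun_prop : Continuous fun y : Sph (k+2) => r • y.1)).measurableSet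
  rw [Measure.toSphere_apply' _ hKm, coneT hr]
  have h2 := (Measure.hausdorffMeasure_zero_or_top (show ((k+1:ℕ):ℝ) < ((k+2:ℕ):ℝ) by push_cast; linarith) ((ball 0 1 \ {0}) \ Om K r)).resolve_right h
  rw [muH_flat, Measure.smul_apply, smul_eq_mul, mul_eq_zero] at h2
  rw [h2.resolve_left (cH_ne_zero _), mul_zero]

theorem lower_r {k : ℕ} (hk : 1 ≤ k) (hfin : omH (k+2) ≠ ⊤) {C K : Set (Rn (k+2))} (hC : IsClosed C)
    (hcone : ∀ t : ℝ, 0 ≤ t → ∀ x ∈ C, t • x ∈ C) (hrect : KRectifiable (k+2) k (C ∩ sphere (0 : Rn (k+2)) 1))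
    (hK : IsClosed K) (hKC : K ⊆ C) {r : ℝ} (hr : 0 < r) {γ τ : ℝ} (hγ : 0 < γ)
    (hτ : 0 < τ) (hτ2 : τ^2 ≤ 1 - (k+1)/γ)
    (hW : ∀ x₀ ∈ sphere (0 : Rn (k+2)) r \ K, WirtingerIneqOn (k+2) (connectedComponentIn (sphere (0 : Rn (k+2)) r \ K) x₀) (r^2/γ))
    (m : ℕ) {M : ℝ} (hM : 0 < M) (hMm : ∀ c ∈ Icc (-1:ℝ) 1, (1+c)^m * Real.sqrt (1-c^2) ≤ M)
    {p lam : ℝ} (hp : 0 ≤ p) (hlam : 0 ≤ lam)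
    (htan : ∀ c ∈ Icc (-1:ℝ) 1, p + lam * (c - τ) ≤ (1+c)^m * (((k+1:ℕ)+m) * c - m)) :
    oR (p / (2*(k+1)*M)) * omH (k+2) ≤ nuC k C {y | r • (y : Rn (k+2)) ∈ K} := by
  have hKm : MeasurableSet {y : Sph (k+2) | r • y.1 ∈ K} := (hK.preimage (by fun_prop : Continuous fun y : Sph (k+2) => r • y.1)).measurableSet
  rw [nuC_apply hC hKm, coneT hr]
  set T : Set (Rn (k+2)) := (ball 0 1 \ {0}) \ Om K r with hT
  have hTC : T ⊆ C := by
    rintro x ⟨⟨h1, h0⟩, h2⟩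
    have h3 : rp r x ∈ K := by
      by_contra h; exact h2 ⟨h0, h⟩
    rw [eq_smul_rp hr h0]
    exact hcone _ (by positivity) _ (hKC h3)
  rw [inter_eq_left.2 hTC]
  have hTm : MeasurableSet T := (measurableSet_ball.diff (measurableSet_singleton _)).diff (Om_open hK r).measurableSet
  by_cases hTt : μH[((k+1:ℕ):ℝ)] T = ⊤
  · rw [hTt]; exact le_top
  have hz := sg_eq_zero hK hr hTt
  obtain ⟨hprop, hdis, hcount, hcov⟩ := comps_props hK hr
  choose e he using fun V : comps K r => center hfin hK hr hγ hτ hτ2 hW V.2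
  have hUm : ∀ V : comps K r, MeasurableSet {y : Sph (k+2) | y.1 ∈ V.1} := fun V => (hprop V V.2).1.measurableSet.preimage measurable_subtype_coe
  have hmain : ∀ I : Finset (comps K r), oR (p / (2*(k+1)*M)) * cH (k+1) * ∑ V ∈ I, sg (k+2) {y : Sph (k+2) | y.1 ∈ V.1} ≤ μH[((k+1:ℕ):ℝ)] T := by
    intro I
    have h := lower_abs hk hcone hrect hTm (subset_inter hTC (sdiff_subset.trans sdiff_subset)) hTt I (fun V => V.1) e
      (fun V _ => ⟨(hprop V V.2).1, (he V).1, fun z hz h0 h1 => ⟨⟨mem_ball_zero_iff.2 h1, h0⟩, (hprop V V.2).2.2.1 z hz⟩⟩)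
      (fun V _ x hx => (hprop V V.2).2.2.2 x _ (inv_pos.2 (norm_pos_iff.2 hx)))
      (fun V _ W _ hVW => hdis V.2 W.2 (fun h => hVW (Subtype.ext h))) m hM hMm
      (X := p * ∑ V ∈ I, (sg (k+2)).real {y : Sph (k+2) | y.1 ∈ V.1}) (mul_nonneg hp (Finset.sum_nonneg fun _ _ => measureReal_nonneg)) (by
        rw [Finset.mul_sum]
        refine Finset.sum_le_sum fun V _ => ?_
        have hint : ∀ f : Sph (k+2) → ℝ, Continuous f → IntegrableOn f {y : Sph (k+2) | y.1 ∈ V.1} (sg (k+2)) := fun f hf =>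
          ((hf.continuousOn.integrableOn_compact isCompact_univ).mono_set (subset_univ _))
        have h1 : ∫ y in {y : Sph (k+2) | y.1 ∈ V.1}, (p - lam * τ + lam * inner ℝ y.1 (e V)) ∂sg (k+2) ≤
            ∫ y in {y : Sph (k+2) | y.1 ∈ V.1}, (1 + inner ℝ y.1 (e V))^m * (((k+1:ℕ)+m) * inner ℝ y.1 (e V) - m) ∂sg (k+2) := by
          refine integral_mono (hint _ (by fun_prop)) (hint _ (by fun_prop)) fun y => ?_
          have h1 : ‖(y : Rn (k+2))‖ = 1 := mem_sphere_zero_iff_norm.1 y.2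
          have h2 := abs_real_inner_le_norm (y : Rn (k+2)) (e V)
          rw [h1, (he V).1, mul_one, abs_le] at h2
          have := htan _ h2
          simp only; linarith
        refine le_trans ?_ h1
        rw [integral_add (hint _ (by fun_prop)) (hint _ (by fun_prop)), integral_const_mul, integral_const]
        simp only [measureReal_restrict_apply MeasurableSet.univ, univ_inter, smul_eq_mul]
        have := mul_le_mul_of_nonneg_left (he V).2 hlam
        linarith)
    have hc0 : 0 ≤ (cH (k+1)).toReal := ENNReal.toReal_nonneg
    rw [← ENNReal.ofReal_toReal hTt, ← ENNReal.ofReal_toReal (cH_ne_top (k+1)), ← ENNReal.ofReal_mul (by positivity),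
      show ∑ V ∈ I, sg (k+2) {y : Sph (k+2) | y.1 ∈ V.1} = oR (∑ V ∈ I, (sg (k+2)).real {y : Sph (k+2) | y.1 ∈ V.1}) by
        rw [ENNReal.ofReal_sum_of_nonneg (fun _ _ => measureReal_nonneg)]
        exact Finset.sum_congr rfl fun V _ => (ofReal_measureReal (measure_ne_top _ _)).symm, ← ENNReal.ofReal_mul (by positivity)]
    refine ENNReal.ofReal_le_ofReal ?_
    have hd : 0 < 2*((k:ℝ)+1)*M := by positivity
    rw [div_mul_eq_mul_div, div_mul_eq_mul_div, div_le_iff₀ hd]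
    linarith
  have huniv : sg (k+2) univ ≤ ∑' V : comps K r, sg (k+2) {y : Sph (k+2) | y.1 ∈ V.1} := by
    have : Countable (comps K r) := hcount.to_subtype
    have hsub : (univ : Set (Sph (k+2))) ⊆ {y | r • (y : Rn (k+2)) ∈ K} ∪ ⋃ V : comps K r, {y : Sph (k+2) | y.1 ∈ V.1} := by
      intro y _
      by_cases hy : r • (y : Rn (k+2)) ∈ K
      · exact Or.inl hy
      · have h1 : ‖(y : Rn (k+2))‖ = 1 := mem_sphere_zero_iff_norm.1 y.2
        obtain ⟨V, hV, hyV⟩ := hcov y ⟨by rw [← norm_ne_zero_iff, h1]; norm_num, by rwa [rp, h1, div_one]⟩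
        exact Or.inr (mem_iUnion.2 ⟨⟨V, hV⟩, hyV⟩)
    refine (measure_mono hsub).trans ((measure_union_le _ _).trans ?_)
    rw [hz, zero_add]
    exact measure_iUnion_le _
  rw [cS_sg]
  calc _ ≤ oR (p / (2*(k+1)*M)) * (cH (k+1) * ∑' V : comps K r, sg (k+2) {y : Sph (k+2) | y.1 ∈ V.1}) := by
        gcongr
        exact cS_le_cH hfin
    _ ≤ _ := by
        rw [← mul_assoc, ENNReal.tsum_eq_iSup_sum, ENNReal.mul_iSup]
        exact iSup_le hmain
end
section
def LipAt {X Y : Type} [PseudoEMetricSpace X] [PseudoEMetricSpace Y] (f : X → Y) (x : X) : Prop := ∃ C : ℝ≥0, ∃ t ∈ 𝓝 x, LipschitzOnWith C f t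

theorem LipAt.continuousAt {X Y : Type} [PseudoEMetricSpace X] [PseudoEMetricSpace Y] {f : X → Y} {x : X} (h : LipAt f x) : ContinuousAt f x := by
  obtain ⟨C, t, ht, hC⟩ := h
  exact hC.continuousOn.continuousAt ht

theorem LipAt.comp {X Y Z : Type} [PseudoEMetricSpace X] [PseudoEMetricSpace Y] [PseudoEMetricSpace Z] {f : Y → Z} {g : X → Y} {x : X}
    (hf : LipAt f (g x)) (hg : LipAt g x) : LipAt (fun x => f (g x)) x := by
  have hc := hg.continuousAt
  obtain ⟨C, t, ht, hC⟩ := hf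
  obtain ⟨D, s, hs, hD⟩ := hg
  exact ⟨C * D, s ∩ g ⁻¹' t, inter_mem hs (hc ht), hC.comp (hD.mono inter_subset_left) fun x hx => hx.2⟩

theorem LipAt.prodMk {X : Type} [PseudoEMetricSpace X] {f g : X → ℝ} {x : X} (hf : LipAt f x) (hg : LipAt g x) : LipAt (fun x => (f x, g x)) x := by
  obtain ⟨C, t, ht, hC⟩ := hf
  obtain ⟨D, s, hs, hD⟩ := hg
  exact ⟨max C D, t ∩ s, inter_mem ht hs, (hC.mono inter_subset_left).prodMk (hD.mono inter_subset_right)⟩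

theorem LipAt.of_contDiff {X Y : Type} [NormedAddCommGroup X] [NormedSpace ℝ X] [NormedAddCommGroup Y] [NormedSpace ℝ Y] {f : X → Y} {x : X} (h : ContDiffAt ℝ 1 f x) : LipAt f x := by
  obtain ⟨C, t, ht, hC⟩ := h.exists_lipschitzOnWith
  exact ⟨C, t, ht, hC⟩

theorem LipAt.mul {X : Type} [PseudoEMetricSpace X] {f g : X → ℝ} {x : X} (hf : LipAt f x) (hg : LipAt g x) : LipAt (fun x => f x * g x) x :=
  LipAt.comp (f := fun p : ℝ × ℝ => p.1 * p.2) (LipAt.of_contDiff (contDiff_fst.mul contDiff_snd).contDiffAt) (hf.prodMk hg)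

theorem LipAt.sub_const {X : Type} [PseudoEMetricSpace X] {f : X → ℝ} {x : X} (hf : LipAt f x) (c : ℝ) : LipAt (fun x => f x - c) x :=
  LipAt.comp (f := fun p : ℝ => p - c) (LipAt.of_contDiff (contDiff_id.sub contDiff_const).contDiffAt) hf

theorem LipAt.const_add {X : Type} [PseudoEMetricSpace X] {f : X → ℝ} {x : X} (hf : LipAt f x) (c : ℝ) : LipAt (fun x => c + f x) x :=
  LipAt.comp (f := fun p : ℝ => c + p) (LipAt.of_contDiff (contDiff_const.add contDiff_id).contDiffAt) hf

theorem LipAt.congr {X Y : Type} [PseudoEMetricSpace X] [PseudoEMetricSpace Y] {f g : X → Y} {x : X} (hf : LipAt f x) (h : g =ᶠ[𝓝 x] f) : LipAt g x := by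
  obtain ⟨C, t, ht, hC⟩ := hf
  refine ⟨C, t ∩ {y | g y = f y}, inter_mem ht h, fun a ha b hb => ?_⟩
  rw [show g a = f a from ha.2, show g b = f b from hb.2]
  exact hC ha.1 hb.1

theorem locLip_iff {N : ℕ} {u : Rn N → ℝ} {s : Set (Rn N)} (hs : IsOpen s) : LocLipOn N u s ↔ ∀ x ∈ s, LipAt u x := by
  refine forall₂_congr fun x hx => ?_
  rw [hs.nhdsWithin_eq hx]
  exact ⟨fun ⟨t, ht, C, hC⟩ => ⟨C, t, ht, hC⟩, fun ⟨C, t, ht, hC⟩ => ⟨t, ht, C, hC⟩⟩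

theorem LipAt.glue {N : ℕ} {F u : Rn N → ℝ} {r : ℝ} {x : Rn N} (hF : LipAt F x) (hu : LipAt u x)
    (he : ∀ z : Rn N, ‖z‖ = r → F z = u z) : LipAt (fun z => if ‖z‖ < r then F z else u z) x := by
  obtain ⟨C, t, ht, hC⟩ := hF
  obtain ⟨D, s, hs, hD⟩ := hu
  obtain ⟨ε, hε, hb⟩ := Metric.mem_nhds_iff.1 (inter_mem ht hs)
  have hC' := (hC.mono (hb.trans inter_subset_left))
  have hD' := (hD.mono (hb.trans inter_subset_right))
  have key : ∀ a ∈ ball x ε, ∀ b ∈ ball x ε, ‖a‖ < r → r ≤ ‖b‖ → dist (F a) (u b) ≤ ((C + D : ℝ≥0) : ℝ) * dist a b := by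
    intro a ha b hb' har hbr
    have hiv := (convex_segment a b).isPreconnected.intermediate_value (left_mem_segment ℝ a b) (right_mem_segment ℝ a b) (f := fun z => ‖z‖) continuous_norm.continuousOn
    obtain ⟨c, hc, hcr⟩ := hiv ⟨har.le, hbr⟩
    have hcb : c ∈ ball x ε := (convex_ball x ε).segment_subset ha hb' hc
    have h1 := hC'.dist_le_mul a ha c hcb
    have h2 := hD'.dist_le_mul c hcb b hb'
    have h3 := dist_add_dist_of_mem_segment hc
    rw [← he c hcr] at h2
    have := dist_triangle (F a) (F c) (u b)
    push_cast
    nlinarith [dist_nonneg (x := a) (y := c), dist_nonneg (x := c) (y := b), C.2, D.2, mul_nonneg D.2 (dist_nonneg (x := a) (y := c)), mul_nonneg C.2 (dist_nonneg (x := c) (y := b))]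
  refine ⟨C + D, ball x ε, ball_mem_nhds _ hε, LipschitzOnWith.of_dist_le_mul fun a ha b hb' => ?_⟩
  split_ifs with h1 h2 h2
  · refine (hC'.dist_le_mul a ha b hb').trans ?_
    gcongr; exact le_self_add
  · exact key a ha b hb' h1 (not_lt.1 h2)
  · rw [dist_comm, dist_comm a b]; exact key b hb' a ha h2 (not_lt.1 h1)
  · refine (hD'.dist_le_mul a ha b hb').trans ?_
    gcongr; exact le_add_self

theorem contDiffAt_rp {N : ℕ} (r : ℝ) {x : Rn N} (hx : x ≠ 0) : ContDiffAt ℝ 1 (rp r) x :=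
  (contDiffAt_const.div (contDiffAt_norm ℝ hx) (norm_ne_zero_iff.2 hx)).smul contDiffAt_id

theorem ae_diff {N : ℕ} {u : Rn N → ℝ} {s : Set (Rn N)} (hs : IsOpen s) (h : LocLipOn N u s) : ∀ᵐ x : Rn N, x ∈ s → DifferentiableAt ℝ u x := by
  rw [locLip_iff hs] at h
  have hc : ∀ x ∈ s, ∃ ε > 0, ∀ᵐ y : Rn N, y ∈ ball x ε → DifferentiableAt ℝ u y := by
    intro x hx
    obtain ⟨C, t, ht, hC⟩ := h x hx
    obtain ⟨ε, hε, hb⟩ := Metric.mem_nhds_iff.1 ht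
    refine ⟨ε, hε, ?_⟩
    filter_upwards [(hC.mono hb).ae_differentiableWithinAt_of_mem (μ := volume)] with y hy hyb
    exact (hy hyb).differentiableAt (isOpen_ball.mem_nhds hyb)
  choose! ε hε hd using hc
  obtain ⟨T, hTs, hTc, hT⟩ := TopologicalSpace.countable_cover_nhdsWithin (s := s) (f := fun x => ball x (ε x)) (fun x hx => mem_nhdsWithin_of_mem_nhds (ball_mem_nhds _ (hε x hx)))
  have := (ae_ball_iff hTc).2 fun x hx => hd x (hTs hx)
  filter_upwards [this] with y hy hys
  obtain ⟨x, hx, hyx⟩ := mem_iUnion₂.1 (hT hys)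
  exact hy x hx hyx
end
section
def gF {N : ℕ} (u : Rn N → ℝ) (r : ℝ) (x : Rn N) : ℝ := u (rp r x)
def mF {N : ℕ} (u : Rn N → ℝ) (K : Set (Rn N)) (r : ℝ) (x : Rn N) : ℝ :=
  ⨍ z in {y : Sph N | (y : Rn N) ∈ connectedComponentIn (Om K r) x}, gF u r z ∂sg N
def FF {N : ℕ} (u : Rn N → ℝ) (K : Set (Rn N)) (r β : ℝ) (x : Rn N) : ℝ :=
  mF u K r x + (gF u r x - mF u K r x) * (‖x‖ / r) ^ β

section
variable {N : ℕ} {u : Rn N → ℝ} {K : Set (Rn N)} {r β : ℝ}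

theorem gF_hom (y : Rn N) (t : ℝ) (ht : 0 < t) : gF u r (t • y) = gF u r y := by rw [gF, gF, rp_smul ht]

theorem mF_eq {x y : Rn N} (h : y ∈ connectedComponentIn (Om K r) x) : mF u K r y = mF u K r x := by
  rw [mF, mF, connectedComponentIn_eq h]

theorem mF_ev (hK : IsClosed K) {x : Rn N} (hx : x ∈ Om K r) : mF u K r =ᶠ[𝓝 x] fun _ => mF u K r x := by
  filter_upwards [(Om_open hK r).connectedComponentIn.mem_nhds (mem_connectedComponentIn hx)] with y hy
  exact mF_eq hy

theorem FF_ev (hK : IsClosed K) {x : Rn N} (hx : x ∈ Om K r) :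
    FF u K r β =ᶠ[𝓝 x] fun z => mF u K r x + (gF u r z - mF u K r x) * (‖z‖ / r) ^ β := by
  filter_upwards [mF_ev (u := u) hK hx] with y hy
  rw [FF, hy]

theorem hnorm {x : Rn N} (hx : x ≠ 0) : HasFDerivAt (fun x : Rn N => ‖x‖) (‖x‖⁻¹ • innerSL ℝ x) x := by
  have hn : ‖x‖ ≠ 0 := norm_ne_zero_iff.2 hx
  have h1 : HasFDerivAt (fun x : Rn N => ‖x‖^2) (2 • innerSL ℝ x) x := (hasStrictFDerivAt_norm_sq x).hasFDerivAt
  have h2 := (h1.sqrt (pow_ne_zero 2 hn))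
  have e : (fun x : Rn N => √(‖x‖^2)) = fun x => ‖x‖ := by ext x; rw [Real.sqrt_sq (norm_nonneg _)]
  rw [e, Real.sqrt_sq (norm_nonneg _)] at h2
  have e2 : ‖x‖⁻¹ • innerSL ℝ x = (1 / (2 * ‖x‖)) • (2 • innerSL ℝ x) := by
    ext z; simp; field_simp
  rw [e2]; exact h2

theorem hpow (hr : 0 < r) {x : Rn N} (hx : x ≠ 0) : HasFDerivAt (fun x : Rn N => (‖x‖ / r)^β) ((β * (‖x‖/r)^β / ‖x‖^2) • innerSL ℝ x) x := by
  have hn : 0 < ‖x‖ := norm_pos_iff.2 hx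
  have h1 := ((hasDerivAt_id ‖x‖).div_const r).rpow_const (p := β) (Or.inl (by simp; exact ⟨hx, hr.ne'⟩))
  have h2 := h1.comp_hasFDerivAt x (hnorm hx)
  have e2 : (β * (‖x‖/r)^β / ‖x‖^2) • innerSL ℝ x = (1 / r * β * (id ‖x‖ / r) ^ (β - 1)) • ‖x‖⁻¹ • innerSL ℝ x := by
    rw [Real.rpow_sub_one (by simp; exact ⟨hx, hr.ne'⟩), smul_smul]
    congr 1; simp only [id]; field_simp
  rw [e2]; exact h2

theorem FF_lip (hK : IsClosed K) (hr : 0 < r) {x : Rn N} (hx : x ∈ Om K r) (hu : LipAt u (rp r x)) : LipAt (FF u K r β) x := by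
  refine LipAt.congr ?_ (FF_ev hK hx)
  refine LipAt.const_add (LipAt.mul (LipAt.sub_const (LipAt.comp hu (LipAt.of_contDiff (contDiffAt_rp r hx.1))) _) (LipAt.of_contDiff ?_)) _
  refine ContDiffAt.rpow_const_of_ne ((contDiffAt_norm ℝ hx.1).div_const _) (div_ne_zero (norm_ne_zero_iff.2 hx.1) hr.ne')

theorem inner_grad {g : Rn N → ℝ} (hg : ∀ (y : Rn N) (t : ℝ), 0 < t → g (t • y) = g y) {x : Rn N} (hd : DifferentiableAt ℝ g x) : inner ℝ (gradient g x) x = 0 := by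
  have h1 := hd.hasGradientAt.hasFDerivAt
  have h2 : HasDerivAt (fun t : ℝ => t • x) x 1 := by simpa using (hasDerivAt_id (1:ℝ)).smul_const x
  have h3 := HasFDerivAt.comp_hasDerivAt (1:ℝ) (f := fun t : ℝ => t • x) (by simpa using h1) h2
  have h4 : HasDerivAt (g ∘ fun t : ℝ => t • x) 0 1 := by
    refine (hasDerivAt_const (1:ℝ) (g x)).congr_of_eventuallyEq ?_
    filter_upwards [lt_mem_nhds (one_pos (α := ℝ))] with t ht
    exact hg x t ht
  have := h3.unique h4
  simpa using this

theorem grad_scale {g : Rn N → ℝ} (hg : ∀ (y : Rn N) (t : ℝ), 0 < t → g (t • y) = g y) (x : Rn N) {t : ℝ} (ht : 0 < t) : gradient g (t • x) = t⁻¹ • gradient g x := by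
  have h := fderiv_comp_smul (𝕜 := ℝ) (f := g) t (x := x)
  rw [show (fun x => g (t • x)) = g by ext y; exact hg y t ht] at h
  rw [gradient, gradient, h]
  simp [ht.ne']

theorem FF_grad (hK : IsClosed K) (hr : 0 < r) {x : Rn N} (hx : x ∈ Om K r) :
    ‖gradient (FF u K r β) x‖^2 ≤ (‖x‖/r)^(2*β) * (‖gradient (gF u r) x‖^2 + β^2 * (gF u r x - mF u K r x)^2 / ‖x‖^2) := by
  have hn : 0 < ‖x‖ := norm_pos_iff.2 hx.1
  have hH : 0 < (‖x‖/r)^β := by positivity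
  have hH2 : (‖x‖/r)^(2*β) = ((‖x‖/r)^β)^2 := by
    rw [mul_comm, Real.rpow_mul (by positivity)]; norm_num
  rw [(FF_ev hK hx).gradient_eq, hH2]
  set m := mF u K r x
  by_cases hd : DifferentiableAt ℝ (gF u r) x
  · have h1 := hd.hasGradientAt.hasFDerivAt
    have h2 := ((h1.sub_const m).mul (hpow (β := β) hr hx.1)).const_add m
    have h3 : HasGradientAt (fun z => m + (gF u r z - m) * (‖z‖ / r) ^ β) ((‖x‖/r)^β • gradient (gF u r) x + ((gF u r x - m) * (β * (‖x‖/r)^β / ‖x‖^2)) • x) x := by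
      rw [hasGradientAt_iff_hasFDerivAt]
      have e : InnerProductSpace.toDual ℝ (Rn N) ((‖x‖/r)^β • gradient (gF u r) x + ((gF u r x - m) * (β * (‖x‖/r)^β / ‖x‖^2)) • x) =
          (gF u r x - m) • (β * (‖x‖/r)^β / ‖x‖^2) • innerSL ℝ x + (‖x‖/r)^β • InnerProductSpace.toDual ℝ (Rn N) (gradient (gF u r) x) := by
        ext z; simp; ring
      rw [e]; exact h2
    rw [h3.gradient, norm_add_sq_real, inner_smul_left, inner_smul_right, inner_grad gF_hom hd, norm_smul, norm_smul]
    simp only [mul_pow, Real.norm_eq_abs, sq_abs, mul_zero, add_zero, div_pow]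
    refine le_of_eq ?_
    field_simp
  · have : ¬ DifferentiableAt ℝ (fun z => m + (gF u r z - m) * (‖z‖ / r) ^ β) x := by
      intro h
      apply hd
      have h2 := ((h.sub_const m).fun_mul ((hpow (β := β) hr hx.1).differentiableAt.fun_inv hH.ne')).const_add m
      refine h2.congr_of_eventuallyEq ?_
      filter_upwards [isOpen_compl_singleton.mem_nhds (show x ∈ ({0}ᶜ : Set (Rn N)) from hx.1)] with z hz
      have hz' : 0 < ‖z‖ := norm_pos_iff.2 hz
      have : 0 < (‖z‖/r)^β := by positivity
      field_simp
      ring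
    rw [gradient, fderiv_zero_of_not_differentiableAt this]
    simp; positivity

theorem gF_grad_le (hr : 0 < r) {x : Rn N} (hx : ‖x‖ = r) (hd : DifferentiableAt ℝ u x) : ‖gradient (gF u r) x‖ ≤ ‖gradient u x‖ := by
  have hx0 : x ≠ 0 := norm_ne_zero_iff.1 (by rw [hx]; exact hr.ne')
  have hn : ‖x‖ ≠ 0 := norm_ne_zero_iff.2 hx0
  have h1 := ((hasDerivAt_inv hn).const_mul r).comp_hasFDerivAt x (hnorm hx0)
  have h2 := h1.smul (hasFDerivAt_id x)
  have e : ((fun y => r * y⁻¹) ∘ fun x : Rn N => ‖x‖) • id = rp (N := N) r := by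
    ext1 y; simp [rp, div_eq_mul_inv]
  rw [e] at h2
  have hd' : DifferentiableAt ℝ u (rp r x) := by rwa [rp_self hr hx]
  have h3 := hd'.hasGradientAt.hasFDerivAt.comp x h2
  have hg : DifferentiableAt ℝ (gF u r) x := h3.differentiableAt
  have h4 := h3.unique hg.hasGradientAt.hasFDerivAt
  have h5 := congrArg (fun l => l (gradient (gF u r) x)) h4
  have ho := inner_grad gF_hom hg
  rw [real_inner_comm] at ho
  simp only [ContinuousLinearMap.comp_apply, rp_self hr hx] at h5
  simp [ho, hx, hr.ne'] at h5
  have h6 := real_inner_le_norm (gradient u x) (gradient (gF u r) x)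
  by_cases h0 : ‖gradient (gF u r) x‖ = 0
  · rw [h0]; positivity
  · have : 0 < ‖gradient (gF u r) x‖ := lt_of_le_of_ne (norm_nonneg _) (Ne.symm h0)
    have h7 : inner ℝ (gradient u x) (gradient (gF u r) x) = ‖gradient (gF u r) x‖^2 := by
      rw [← real_inner_self_eq_norm_sq]
      have e1 : ∀ (f : Rn N → ℝ) (z : Rn N), inner ℝ (gradient f x) z = fderiv ℝ f x z := fun f z => by simp [gradient]
      rw [e1, e1, h5]
    nlinarith
end
end
section
section
variable {k : ℕ} {u : Rn (k+2) → ℝ} {K : Set (Rn (k+2))} {r β : ℝ}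

theorem sph_norm (y : Sph (k+2)) : ‖y.1‖ = 1 := mem_sphere_zero_iff_norm.1 y.2

theorem sph_Om (y : Sph (k+2)) : y.1 ∈ Om K r ↔ r • y.1 ∉ K := by
  rw [Om, mem_ofPred_eq, rp, sph_norm, div_one, and_iff_right]
  exact norm_ne_zero_iff.1 (by rw [sph_norm]; norm_num)

theorem gF_lip (hK : IsClosed K) (hr : 0 < r) (hu : LocLipOn (k+2) u Kᶜ) {x : Rn (k+2)} (hx : x ∈ Om K r) : LipAt u (rp r x) :=
  (locLip_iff hK.isOpen_compl).1 hu _ hx.2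

theorem wirt_sum (hfin : omH (k+2) ≠ ⊤) (hK : IsClosed K) (hr : 0 < r) {c : ℝ} (hu : LocLipOn (k+2) u Kᶜ)
    (hW : ∀ x₀ ∈ sphere (0 : Rn (k+2)) r \ K, WirtingerIneqOn (k+2) (connectedComponentIn (sphere (0 : Rn (k+2)) r \ K) x₀) c)
    (hG : ∫⁻ y in {y : Sph (k+2) | y.1 ∈ Om K r}, oR (‖gradient (gF u r) (r • y.1)‖^2) ∂sg (k+2) < ⊤) :
    ∫⁻ y in {y : Sph (k+2) | y.1 ∈ Om K r}, oR ((gF u r y - mF u K r y)^2) ∂sg (k+2) ≤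
      oR c * ∫⁻ y in {y : Sph (k+2) | y.1 ∈ Om K r}, oR (‖gradient (gF u r) (r • y.1)‖^2) ∂sg (k+2) := by
  obtain ⟨hprop, hdis, hcount, hcov⟩ := comps_props hK hr
  have : Countable (comps K r) := hcount.to_subtype
  have hUm : ∀ V : comps K r, MeasurableSet {y : Sph (k+2) | y.1 ∈ V.1} := fun V => (hprop V V.2).1.measurableSet.preimage measurable_subtype_coe
  have hun : {y : Sph (k+2) | y.1 ∈ Om K r} = ⋃ V : comps K r, {y : Sph (k+2) | y.1 ∈ V.1} := by
    ext y
    simp only [mem_ofPred_eq, mem_iUnion]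
    constructor
    · intro hy
      obtain ⟨V, hV, h⟩ := hcov _ hy
      exact ⟨⟨V, hV⟩, h⟩
    · rintro ⟨V, h⟩
      exact (hprop V V.2).2.1 h
  have hd : Pairwise (Function.onFun Disjoint fun V : comps K r => {y : Sph (k+2) | y.1 ∈ V.1}) := by
    intro V W hVW
    have := hdis V.2 W.2 (fun h => hVW (Subtype.ext h))
    exact Disjoint.preimage _ this
  rw [hun] at hG ⊢
  rw [lintegral_iUnion hUm hd] at hG ⊢
  rw [lintegral_iUnion hUm hd, ← ENNReal.tsum_mul_left]
  refine ENNReal.tsum_le_tsum fun V => ?_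
  have h := wirt_sg hfin hK hr hW V.2 (g := gF u r) gF_hom (by
    rw [locLip_iff (hprop V V.2).1]
    intro x hx
    have hx' := (hprop V V.2).2.1 hx
    exact LipAt.comp (f := u) (g := rp r) (gF_lip hK hr hu hx') (LipAt.of_contDiff (contDiffAt_rp r hx'.1))) (lt_of_le_of_lt (ENNReal.le_tsum V) hG)
  refine le_trans (le_of_eq ?_) h
  refine setLIntegral_congr_fun (hUm V) fun y hy => ?_
  have hy' : (y : Rn (k+2)) ∈ V.1 := hy
  obtain ⟨x, hx, hVx⟩ := V.2
  rw [hVx] at hy' ⊢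
  rw [mF_eq hy', mF]

theorem polar_Om (hr : 0 < r) {f : Rn (k+2) → ℝ≥0∞} (hf : Measurable ((ball 0 r ∩ Om K r).indicator f)) (hK : IsClosed K) :
    ∫⁻ x in ball 0 r ∩ Om K r, f x = ∫⁻ ρ in Ioo (0:ℝ) r, oR (ρ^(k+1)) * ∫⁻ y in {y : Sph (k+2) | y.1 ∈ Om K r}, f (ρ • y.1) ∂sg (k+2) := by
  have hSm : MeasurableSet {y : Sph (k+2) | y.1 ∈ Om K r} := (Om_open hK r).measurableSet.preimage measurable_subtype_coe
  rw [← lintegral_indicator (measurableSet_ball.inter (Om_open hK r).measurableSet), polar_vol (by omega) _ hf,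
    ← lintegral_indicator measurableSet_Ioi, ← lintegral_indicator measurableSet_Ioo]
  congr 1; ext ρ
  by_cases h0 : 0 < ρ
  swap
  · rw [indicator_of_notMem (show ρ ∉ Ioi (0:ℝ) from h0), indicator_of_notMem (fun h => h0 h.1)]
  rw [indicator_of_mem (show ρ ∈ Ioi (0:ℝ) from h0)]
  have hn : ∀ y : Sph (k+2), ‖ρ • y.1‖ = ρ := fun y => by rw [norm_smul, sph_norm, mul_one, Real.norm_of_nonneg h0.le]
  by_cases h1 : ρ < r
  · rw [indicator_of_mem (show ρ ∈ Ioo 0 r from ⟨h0, h1⟩), ← lintegral_indicator hSm]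
    congr 2; ext y
    by_cases hy : (y : Rn (k+2)) ∈ Om K r
    · rw [indicator_of_mem (show y ∈ {y : Sph (k+2) | y.1 ∈ Om K r} from hy), indicator_of_mem (show ρ • y.1 ∈ ball 0 r ∩ Om K r from ⟨by rw [mem_ball_zero_iff, hn]; exact h1, smul_mem_Om h0 hy⟩)]
    · rw [indicator_of_notMem (show y ∉ {y : Sph (k+2) | y.1 ∈ Om K r} from hy), indicator_of_notMem]
      rintro ⟨_, h⟩
      have := smul_mem_Om (inv_pos.2 h0) h
      rw [inv_smul_smul₀ h0.ne'] at this
      exact hy this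
  · rw [indicator_of_notMem (fun h => h1 h.2)]
    have : ∀ y : Sph (k+2), (ball 0 r ∩ Om K r).indicator f (ρ • y.1) = 0 := fun y => indicator_of_notMem (fun h => h1 (by have := mem_ball_zero_iff.1 h.1; rwa [hn] at this)) _
    simp [this]

theorem pow_int (hr : 0 < r) (hβ : 0 < β) : ∫⁻ ρ in Ioo (0:ℝ) r, oR (ρ^(k+1)) * oR ((ρ/r)^(2*β-2)) = oR (r^(k+2)/(2*β+k)) := by
  have he : ∀ ρ ∈ Ioo (0:ℝ) r, oR (ρ^(k+1)) * oR ((ρ/r)^(2*β-2)) = oR (r^(2-2*β) * ρ^(k+2*β-1)) := by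
    intro ρ hρ
    rw [← ENNReal.ofReal_mul (by have := hρ.1; positivity), Real.div_rpow hρ.1.le hr.le, ← Real.rpow_natCast, show (2-2*β) = -(2*β-2) by ring, Real.rpow_neg hr.le,
      show ((k:ℝ)+2*β-1) = ((k+1:ℕ):ℝ) + (2*β-2) by push_cast; ring, Real.rpow_add hρ.1]
    congr 1; field_simp
  have hx : -1 < (k:ℝ)+2*β-1 := by have := Nat.cast_nonneg (α := ℝ) k; linarith
  rw [setLIntegral_congr_fun measurableSet_Ioo he]
  have hii : IntegrableOn (fun ρ : ℝ => r^(2-2*β) * ρ^((k:ℝ)+2*β-1)) (Ioo 0 r) := by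
    have := (intervalIntegral.intervalIntegrable_rpow' (a := 0) (b := r) hx).const_mul (r^(2-2*β))
    rw [intervalIntegrable_iff_integrableOn_Ioo_of_le hr.le] at this
    exact this
  rw [← ofReal_integral_eq_lintegral_ofReal hii (by
    filter_upwards [ae_restrict_mem measurableSet_Ioo] with ρ hρ
    have := hρ.1
    simp only [Pi.zero_apply]; positivity), integral_const_mul, ← integral_Ioc_eq_integral_Ioo, ← intervalIntegral.integral_of_le hr.le, integral_rpow (Or.inl hx)]
  congr 1
  have hk0 : 0 < (k:ℝ)+2*β := by positivity
  rw [sub_add_cancel, Real.zero_rpow hk0.ne', sub_zero, add_comm (2*β), mul_div_assoc', ← Real.rpow_add hr, show 2 - 2*β + (k+2*β) = ((k+2:ℕ):ℝ) by push_cast; ring, Real.rpow_natCast]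

theorem FF_energy (hfin : omH (k+2) ≠ ⊤) (hK : IsClosed K) (hr : 0 < r) (hβ : 0 < β) (hu : LocLipOn (k+2) u Kᶜ)
    (hW : ∀ x₀ ∈ sphere (0 : Rn (k+2)) r \ K, WirtingerIneqOn (k+2) (connectedComponentIn (sphere (0 : Rn (k+2)) r \ K) x₀) (r^2/(β*(β+k))))
    (hG : ∫⁻ y in {y : Sph (k+2) | y.1 ∈ Om K r}, oR (‖gradient (gF u r) (r • y.1)‖^2) ∂sg (k+2) < ⊤) :
    ∫⁻ x in ball 0 r ∩ Om K r, oR (‖gradient (FF u K r β) x‖^2) ≤ oR (r^(k+2)/(β+k)) *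
      ∫⁻ y in {y : Sph (k+2) | y.1 ∈ Om K r}, oR (‖gradient (gF u r) (r • y.1)‖^2) ∂sg (k+2) := by
  have hSm : MeasurableSet {y : Sph (k+2) | y.1 ∈ Om K r} := (Om_open hK r).measurableSet.preimage measurable_subtype_coe
  rw [polar_Om hr ((meas_e _).indicator (measurableSet_ball.inter (Om_open hK r).measurableSet)) hK]
  set G := ∫⁻ y in {y : Sph (k+2) | y.1 ∈ Om K r}, oR (‖gradient (gF u r) (r • y.1)‖^2) ∂sg (k+2) with hGd
  have hws := wirt_sum hfin hK hr hu hW hG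
  have hgm : Measurable fun y : Sph (k+2) => oR (‖gradient (gF u r) (r • y.1)‖^2) := (meas_e (gF u r)).comp (by fun_prop)
  have hin : ∀ ρ ∈ Ioo 0 r, ∫⁻ y in {y : Sph (k+2) | y.1 ∈ Om K r}, oR (‖gradient (FF u K r β) (ρ • y.1)‖^2) ∂sg (k+2) ≤
      oR ((ρ/r)^(2*β-2)) * (oR ((2*β+k)/(β+k)) * G) := by
    intro ρ hρ
    have h0 := hρ.1
    have hb : ∫⁻ y in {y : Sph (k+2) | y.1 ∈ Om K r}, oR (‖gradient (FF u K r β) (ρ • y.1)‖^2) ∂sg (k+2) ≤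
        ∫⁻ y in {y : Sph (k+2) | y.1 ∈ Om K r}, oR ((ρ/r)^(2*β-2)) * (oR (‖gradient (gF u r) (r • y.1)‖^2) + oR (β^2/r^2) * oR ((gF u r y - mF u K r y)^2)) ∂sg (k+2) := by
      refine setLIntegral_mono' hSm fun y hy => ?_
      rw [← ENNReal.ofReal_mul (by positivity), ← ENNReal.ofReal_add (by positivity) (by positivity), ← ENNReal.ofReal_mul (by positivity)]
      refine ENNReal.ofReal_le_ofReal ?_
      refine (FF_grad hK hr (smul_mem_Om h0 hy)).trans (le_of_eq ?_)
      rw [grad_scale gF_hom _ h0, grad_scale gF_hom _ hr, gF_hom _ _ h0, mF_eq (smul_mem_cc h0 hy), norm_smul, norm_smul, norm_smul, sph_norm, Real.rpow_sub (by positivity)]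
      simp only [Real.norm_eq_abs, abs_of_pos h0, abs_of_pos (inv_pos.2 h0), abs_of_pos (inv_pos.2 hr), Real.rpow_two, mul_one]
      field_simp
    refine hb.trans ?_
    rw [lintegral_const_mul' _ _ ENNReal.ofReal_ne_top, lintegral_add_left hgm, lintegral_const_mul' _ _ ENNReal.ofReal_ne_top]
    gcongr
    calc _ ≤ G + oR (β^2/r^2) * (oR (r^2/(β*(β+k))) * G) := by gcongr
      _ = (1 + oR (β^2/r^2 * (r^2/(β*(β+k))))) * G := by rw [ENNReal.ofReal_mul (by positivity)]; ring
      _ = _ := by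
        rw [← ENNReal.ofReal_one, ← ENNReal.ofReal_add (by positivity) (by positivity)]
        congr 2; field_simp; ring
  calc _ ≤ ∫⁻ ρ in Ioo (0:ℝ) r, (oR (ρ^(k+1)) * oR ((ρ/r)^(2*β-2))) * (oR ((2*β+k)/(β+k)) * G) := by
        refine setLIntegral_mono' measurableSet_Ioo fun ρ hρ => ?_
        rw [mul_assoc]; gcongr; exact hin ρ hρ
    _ = _ := by
        rw [lintegral_mul_const' _ _ (ENNReal.mul_ne_top ENNReal.ofReal_ne_top hG.ne), pow_int hr hβ, ← mul_assoc, ← ENNReal.ofReal_mul (by positivity)]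
        congr 2; field_simp

theorem FF_cont (hK : IsClosed K) (hr : 0 < r) (hu : LocLipOn (k+2) u Kᶜ) : ContinuousOn (FF u K r β) (Om K r) := fun x hx =>
  (FF_lip hK hr hx (gF_lip hK hr hu hx)).continuousAt.continuousWithinAt

theorem FF_l2 (hfin : omH (k+2) ≠ ⊤) (hK : IsClosed K) (hr : 0 < r) (hβ : 0 < β) (hu : LocLipOn (k+2) u Kᶜ)
    (hW : ∀ x₀ ∈ sphere (0 : Rn (k+2)) r \ K, WirtingerIneqOn (k+2) (connectedComponentIn (sphere (0 : Rn (k+2)) r \ K) x₀) (r^2/(β*(β+k))))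
    (hG : ∫⁻ y in {y : Sph (k+2) | y.1 ∈ Om K r}, oR (‖gradient (gF u r) (r • y.1)‖^2) ∂sg (k+2) < ⊤)
    (h2 : ∫⁻ y in {y : Sph (k+2) | y.1 ∈ Om K r}, oR ((u (r • y.1))^2) ∂sg (k+2) < ⊤) :
    ∫⁻ x in ball 0 r ∩ Om K r, oR ((FF u K r β x)^2) < ⊤ := by
  have hSm : MeasurableSet {y : Sph (k+2) | y.1 ∈ Om K r} := (Om_open hK r).measurableSet.preimage measurable_subtype_coe
  rw [polar_Om hr ?_ hK]
  swap
  · classical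
    rw [← piecewise_eq_indicator]
    refine ContinuousOn.measurable_piecewise ?_ continuousOn_const (measurableSet_ball.inter (Om_open hK r).measurableSet)
    exact ENNReal.continuous_ofReal.comp_continuousOn (((FF_cont hK hr hu).mono inter_subset_right).pow 2)
  have hws := (wirt_sum hfin hK hr hu hW hG).trans_lt (ENNReal.mul_lt_top ENNReal.ofReal_lt_top hG)
  set A := ∫⁻ y in {y : Sph (k+2) | y.1 ∈ Om K r}, (oR 2 * oR ((u (r • y.1))^2) + oR 2 * oR ((gF u r y - mF u K r y)^2)) ∂sg (k+2) with hA
  have hAt : A < ⊤ := by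
    have hm : AEMeasurable (fun y : Sph (k+2) => oR 2 * oR ((u (r • y.1))^2)) ((sg (k+2)).restrict {y : Sph (k+2) | y.1 ∈ Om K r}) := by
      have : ContinuousOn (fun y : Sph (k+2) => u (r • y.1)) {y : Sph (k+2) | y.1 ∈ Om K r} := by
        intro y hy
        have h := ((locLip_iff hK.isOpen_compl).1 hu _ ((sph_Om y).1 hy)).continuousAt
        exact (ContinuousAt.comp (f := fun y : Sph (k+2) => r • y.1) h (by fun_prop)).continuousWithinAt
      exact ((this.aemeasurable hSm).pow_const 2).ennreal_ofReal.const_mul _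
    rw [hA, lintegral_add_left' hm, lintegral_const_mul' _ _ ENNReal.ofReal_ne_top, lintegral_const_mul' _ _ ENNReal.ofReal_ne_top]
    exact ENNReal.add_lt_top.2 ⟨ENNReal.mul_lt_top ENNReal.ofReal_lt_top h2, ENNReal.mul_lt_top ENNReal.ofReal_lt_top hws⟩
  calc _ ≤ ∫⁻ ρ in Ioo (0:ℝ) r, oR (r^(k+1)) * A := by
        refine setLIntegral_mono' measurableSet_Ioo fun ρ hρ => ?_
        have h0 := hρ.1
        have h1 := hρ.2.le
        gcongr
        refine setLIntegral_mono' hSm fun y hy => ?_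
        rw [← ENNReal.ofReal_mul (by norm_num), ← ENNReal.ofReal_mul (by norm_num), ← ENNReal.ofReal_add (by positivity) (by positivity)]
        refine ENNReal.ofReal_le_ofReal ?_
        have hg : gF u r (y : Rn (k+2)) = u (r • (y : Rn (k+2))) := by rw [gF, rp, sph_norm, div_one]
        rw [FF, gF_hom _ _ h0, mF_eq (smul_mem_cc h0 hy), norm_smul, sph_norm, mul_one, Real.norm_of_nonneg h0.le, ← hg]
        have hh0 : 0 ≤ (ρ/r)^β := by positivity
        have hh1 : (ρ/r)^β ≤ 1 := Real.rpow_le_one (by positivity) ((div_le_one hr).2 h1) hβ.le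
        set h := (ρ/r)^β
        set a := gF u r (y : Rn (k+2))
        set b := mF u K r (y : Rn (k+2))
        have e : b + (a-b)*h = a - (a-b)*(1-h) := by ring
        have e2 : ((a-b)*(1-h))^2 ≤ (a-b)^2 := by
          rw [mul_pow]
          have : (1-h)^2 ≤ 1 := by nlinarith
          nlinarith [sq_nonneg (a-b)]
        rw [e]
        nlinarith [sq_nonneg (a + (a-b)*(1-h))]
    _ < ⊤ := by
        rw [setLIntegral_const]
        exact ENNReal.mul_lt_top (ENNReal.mul_lt_top ENNReal.ofReal_lt_top hAt) (by simp)
end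
end
section
theorem intOn_of {N : ℕ} {f : Rn N → ℝ} {O : Set (Rn N)} (hO : IsOpen O) (hc : ContinuousOn f O)
    (h1 : ∫⁻ x in O, oR (f x ^ 2) < ⊤) (h2 : ∫⁻ x in O, oR (‖gradient f x‖^2) < ⊤) :
    IntegrableOn (fun x => f x ^ 2 + ‖gradient f x‖^2) O := by
  refine ⟨((hc.pow 2).aestronglyMeasurable hO.measurableSet).add ((meas_grad f).norm.pow_const 2).aestronglyMeasurable, ?_⟩
  rw [hasFiniteIntegral_iff_ofReal (by filter_upwards with x; positivity)]
  simp only [ENNReal.ofReal_add (sq_nonneg (f _)) (sq_nonneg (‖gradient f _‖))]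
  rw [lintegral_add_right _ (meas_e f)]
  exact ENNReal.add_lt_top.2 ⟨h1, h2⟩

def coneL {N : ℕ} (K : Set (Rn N)) (r : ℝ) : Set (Rn N) := (K \ ball 0 r) ∪ (closedBall 0 r \ Om K r)

section
variable {k : ℕ} {r β : ℝ}

theorem not_coneL {K : Set (Rn (k+2))} (hr : 0 < r) {x : Rn (k+2)} : x ∉ coneL K r ↔ (‖x‖ < r ∧ x ∈ Om K r) ∨ (r ≤ ‖x‖ ∧ x ∉ K) := by
  have h1 : ‖x‖ = r → (x ∈ Om K r ↔ x ∉ K) := fun h =>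
    ⟨fun h2 => by have := h2.2; rwa [rp_self hr h] at this, fun h2 => sph_sub_Om hr ⟨by rwa [mem_sphere_zero_iff_norm], h2⟩⟩
  simp only [coneL, mem_union, Set.mem_sdiff, mem_ball_zero_iff, mem_closedBall_zero_iff]
  rcases lt_trichotomy ‖x‖ r with h | h | h
  · simp [h, h.le, not_le.2 h]
  · simp [h, h1 h]
  · simp [h.le, not_lt.2 h.le, not_le.2 h]

theorem FF_sph {u : Rn (k+2) → ℝ} {K : Set (Rn (k+2))} (hr : 0 < r) {z : Rn (k+2)} (hz : ‖z‖ = r) : FF u K r β z = u z := by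
  rw [FF, hz, div_self hr.ne', Real.one_rpow, gF, rp_self hr hz]; ring

theorem cone_pair (P : MSPair (k+2)) (hmin : IsGlobalMin (k+2) P) (hfin : omH (k+2) ≠ ⊤) (hr : 0 < r) (hβ : 0 < β)
    {C : Set (Rn (k+2))} (hC : IsClosed C) (hcone : ∀ t : ℝ, 0 ≤ t → ∀ x ∈ C, t • x ∈ C) (hKC : P.K ⊆ C)
    (hW : ∀ x₀ ∈ sphere (0 : Rn (k+2)) r \ P.K, WirtingerIneqOn (k+2) (connectedComponentIn (sphere (0 : Rn (k+2)) r \ P.K) x₀) (r^2/(β*(β+k))))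
    (hG : ∫⁻ y in {y : Sph (k+2) | y.1 ∈ Om P.K r}, oR (‖gradient (gF P.u r) (r • y.1)‖^2) ∂sg (k+2) < ⊤)
    (h2 : ∫⁻ y in {y : Sph (k+2) | y.1 ∈ Om P.K r}, oR ((P.u (r • y.1))^2) ∂sg (k+2) < ⊤) :
    MSEnergy (k+2) P (ball 0 r) ≤ oR (r^(k+2)/(β+k)) *
      (∫⁻ y in {y : Sph (k+2) | y.1 ∈ Om P.K r}, oR (‖gradient (gF P.u r) (r • y.1)‖^2) ∂sg (k+2))
      + oR (r^(k+1)) * nuC k C {y | r • (y : Rn (k+2)) ∈ P.K} := by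
  have hK := P.closed
  have hE := FF_energy hfin hK hr hβ P.lip hW hG
  have hEt := hE.trans_lt (ENNReal.mul_lt_top ENNReal.ofReal_lt_top hG)
  have hL2 := FF_l2 hfin hK hr hβ P.lip hW hG h2
  have hO : IsOpen (ball 0 r ∩ Om P.K r) := isOpen_ball.inter (Om_open hK r)
  let v : Rn (k+2) → ℝ := fun z => if ‖z‖ < r then FF P.u P.K r β z else P.u z
  have hv1 : ∀ x : Rn (k+2), ‖x‖ < r → v =ᶠ[𝓝 x] FF P.u P.K r β := fun x hx => by
    filter_upwards [continuous_norm.continuousAt.eventually (gt_mem_nhds hx)] with z hz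
    simp [v, hz]
  have hv2 : ∀ x : Rn (k+2), r < ‖x‖ → v =ᶠ[𝓝 x] P.u := fun x hx => by
    filter_upwards [continuous_norm.continuousAt.eventually (lt_mem_nhds hx)] with z hz
    simp [v, not_lt.2 hz.le]
  have hcl : IsClosed (coneL P.K r) := (hK.sdiff isOpen_ball).union (isClosed_closedBall.sdiff (Om_open hK r))
  have hout : ∀ x : Rn (k+2), x ∉ P.K → LipAt P.u x := (locLip_iff hK.isOpen_compl).1 P.lip
  let Q : MSPair (k+2) :=
    { K := coneL P.K r
      u := v
      closed := hcl
      lip := by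
        rw [locLip_iff hcl.isOpen_compl]
        intro x hx
        rcases (not_coneL hr).1 hx with ⟨h, hx⟩ | ⟨h, hx⟩
        · exact (FF_lip hK hr hx (gF_lip hK hr P.lip hx)).congr (hv1 x h)
        · rcases h.lt_or_eq with h | h
          · exact (hout x hx).congr (hv2 x h)
          · have hxO : x ∈ Om P.K r := sph_sub_Om hr ⟨by rw [mem_sphere_zero_iff_norm, h], hx⟩
            exact LipAt.glue (FF_lip hK hr hxO (gF_lip hK hr P.lip hxO)) (hout x hx) fun z hz => FF_sph hr hz
      integ := by
        intro R hR
        have hsub : ball 0 R \ coneL P.K r ⊆ ((ball 0 r ∩ Om P.K r) ∪ ({x | r < ‖x‖} ∩ (ball 0 R \ P.K))) ∪ sphere 0 r := by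
          rintro x ⟨hx, hxL⟩
          rcases (not_coneL hr).1 hxL with ⟨h, h'⟩ | ⟨h, h'⟩
          · exact Or.inl (Or.inl ⟨by simpa using h, h'⟩)
          · rcases h.lt_or_eq with h | h
            · exact Or.inl (Or.inr ⟨h, hx, h'⟩)
            · exact Or.inr (by rw [mem_sphere_zero_iff_norm, h])
        refine IntegrableOn.mono_set (IntegrableOn.union (IntegrableOn.union ?_ ?_) ?_) hsub
        · refine (intOn_of hO ((FF_cont hK hr P.lip).mono inter_subset_right) hL2 hEt).congr_fun ?_ hO.measurableSet
          intro x hx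
          have h := hv1 x (by simpa using hx.1)
          simp only
          rw [h.gradient_eq, h.eq_of_nhds]
        · have := (P.integ R hR).mono_set (inter_subset_right (s := {x | r < ‖x‖}))
          refine this.congr_fun ?_ ((isOpen_lt continuous_const continuous_norm).measurableSet.inter (measurableSet_ball.diff hK.measurableSet))
          intro x hx
          simp only
          rw [(hv2 x hx.1).gradient_eq, (hv2 x hx.1).eq_of_nhds]
        · rw [IntegrableOn, Measure.restrict_eq_zero.2 (Measure.addHaar_sphere_of_ne_zero volume _ hr.ne')]
          exact integrable_zero_measure }
  have hcomp : Competitor (k+2) P Q (ball 0 r) := by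
    refine ⟨?_, ?_, ?_⟩
    · ext x
      simp only [Set.mem_sdiff, mem_ball_zero_iff, not_lt]
      refine and_congr_left fun h => ?_
      have := not_coneL (K := P.K) hr (x := x)
      change x ∈ coneL P.K r ↔ _
      rw [← not_iff_not, this]
      simp [h, not_lt.2 h]
    · intro x hx
      simp only [mem_union, not_or, mem_ball_zero_iff] at hx
      simp [Q, v, hx.1.1]
    · intro x hx y hy hne heq
      apply hne
      simp only [mem_union, not_or, mem_ball_zero_iff, not_lt] at hx hy
      have hmem : ∀ w : Rn (k+2), r ≤ ‖w‖ ∧ w ∉ P.K → w ∈ Q.Kᶜ := fun w hw => (not_coneL hr).2 (Or.inr hw)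
      have hyC : y ∈ connectedComponentIn Q.Kᶜ x := by rw [heq]; exact mem_connectedComponentIn (hmem y hy)
      have hxC := mem_connectedComponentIn (hmem x hx)
      let π : Rn (k+2) → Rn (k+2) := fun w => (max 1 (r / ‖w‖)) • w
      have hπ : ∀ w : Rn (k+2), r ≤ ‖w‖ → π w = w := fun w hw => by
        simp only [π]; rw [max_eq_left ((div_le_one (hr.trans_le hw)).2 hw), one_smul]
      have hQ0 : ∀ w ∈ Q.Kᶜ, w ≠ 0 := by
        intro w hw
        rcases (not_coneL hr).1 hw with ⟨h, h'⟩ | ⟨h, h'⟩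
        · exact h'.1
        · exact norm_pos_iff.1 (hr.trans_le h)
      have hπc : ContinuousOn π Q.Kᶜ := fun w hw => by
        have : ‖w‖ ≠ 0 := norm_ne_zero_iff.2 (hQ0 w hw)
        have h1 : ContinuousAt (fun w : Rn (k+2) => r / ‖w‖) w := continuousAt_const.div continuous_norm.continuousAt this
        have h2 : ContinuousAt π w := ContinuousAt.smul (Filter.Tendsto.max tendsto_const_nhds h1) continuousAt_id
        exact h2.continuousWithinAt
      have hpre := (isPreconnected_connectedComponentIn (F := Q.Kᶜ) (x := x)).image π (hπc.mono (connectedComponentIn_subset _ _))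
      refine connectedComponentIn_eq (hpre.subset_connectedComponentIn ⟨x, hxC, hπ x hx.1⟩ ?_ ⟨y, hyC, hπ y hy.1⟩)
      rintro _ ⟨w, hw, rfl⟩
      have hw' := connectedComponentIn_subset _ _ hw
      rcases (not_coneL hr).1 hw' with ⟨h, h'⟩ | ⟨h, h'⟩
      · simp only [π]; rw [max_eq_right ((one_le_div (norm_pos_iff.2 h'.1)).2 h.le)]; exact h'.2
      · rw [hπ w h]; exact h'
  refine (hmin 0 r hr Q hcomp).trans (add_le_add ?_ ?_)
  · have e : ball 0 r \ Q.K = ball 0 r ∩ Om P.K r := by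
      ext x
      simp only [Set.mem_sdiff, mem_inter_iff, mem_ball_zero_iff]
      refine and_congr_right fun h => ?_
      change x ∉ coneL P.K r ↔ _
      rw [not_coneL hr]; simp [h, not_le.2 h]
    rw [e]
    refine le_trans (le_of_eq ?_) hE
    refine setLIntegral_congr_fun hO.measurableSet fun x hx => ?_
    change oR (‖gradient v x‖^2) = _
    rw [(hv1 x (by simpa using hx.1)).gradient_eq]
  · have e1 : (((k+2:ℕ):ℝ)) - 1 = ((k+1:ℕ):ℝ) := by push_cast; ring
    have hms : MeasurableSet {y : Sph (k+2) | r • y.1 ∈ P.K} := (hK.preimage (by fun_prop : Continuous fun y : Sph (k+2) => r • y.1)).measurableSet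
    have hTC : (Ioo (0 : ℝ) 1 • ((↑) '' {y : Sph (k+2) | r • y.1 ∈ P.K} : Set (Rn (k+2)))) ⊆ C := by
      intro x hx
      obtain ⟨t, ht, _, ⟨y, hy, rfl⟩, rfl⟩ := Set.mem_smul.1 hx
      have := hcone (t/r) (div_nonneg ht.1.le hr.le) _ (hKC hy)
      rwa [smul_smul, div_mul_cancel₀ _ hr.ne'] at this
    rw [nuC_apply hC hms, inter_eq_left.2 hTC, coneT hr, e1]
    have hsub : Q.K ∩ ball 0 r ⊆ {0} ∪ r • ((ball 0 1 \ {0}) \ Om P.K r) := by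
      rintro x ⟨hx, hb⟩
      by_cases h0 : x = 0
      · exact Or.inl h0
      refine Or.inr ((mem_smul_set_iff_inv_smul_mem₀ hr.ne' _ _).2 ⟨⟨?_, smul_ne_zero (inv_ne_zero hr.ne') h0⟩, fun h => ?_⟩)
      · rw [mem_ball_zero_iff] at hb ⊢
        rw [norm_smul, norm_inv, Real.norm_of_nonneg hr.le, inv_mul_lt_one₀ hr]; exact hb
      · have := smul_mem_Om hr h
        rw [smul_inv_smul₀ hr.ne'] at this
        exact (not_coneL hr).2 (Or.inl ⟨by simpa using hb, this⟩) hx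
    refine (measure_mono hsub).trans ((measure_union_le _ _).trans ?_)
    have : NullSingletonClass (μH[((k+1:ℕ):ℝ)] : Measure (Rn (k+2))) := Measure.nullSingletonClass_hausdorff _ (by positivity)
    rw [measure_singleton, zero_add, Measure.hausdorffMeasure_smul₀ (by positivity) hr.ne', ENNReal.smul_def, smul_eq_mul, NNReal.rpow_natCast, ENNReal.ofReal_pow hr.le, ENNReal.coe_pow]
    gcongr
    rw [ENNReal.ofReal, ENNReal.coe_le_coe]; apply le_of_eq; ext; simp [abs_of_pos hr, hr.le]

theorem ae_sph {s : Set (Rn (k+2))} (hs : volume s = 0) : ∀ᵐ ρ : ℝ, 0 < ρ → ∀ᵐ y : Sph (k+2) ∂sg (k+2), ρ • y.1 ∉ s := by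
  have hm := measurableSet_toMeasurable volume s
  have h := polar_vol (N := k+2) (by omega) ((toMeasurable volume s).indicator 1) (measurable_one.indicator hm)
  rw [lintegral_indicator_one hm, measure_toMeasurable, hs] at h
  have hmm : Measurable fun p : ℝ × Sph (k+2) => (toMeasurable volume s).indicator (1 : Rn (k+2) → ℝ≥0∞) (p.1 • (p.2 : Rn (k+2))) :=
    (measurable_one.indicator hm).comp (by fun_prop)
  have hmq : Measurable fun ρ : ℝ => oR (ρ^(k+2-1)) * ∫⁻ y : Sph (k+2), (toMeasurable volume s).indicator (1 : Rn (k+2) → ℝ≥0∞) (ρ • y.1) ∂sg (k+2) :=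
    Measurable.mul (by fun_prop) (hmm.lintegral_prod_right' (ν := sg (k+2)))
  rw [eq_comm, lintegral_eq_zero_iff hmq, Filter.EventuallyEq, ae_restrict_iff' measurableSet_Ioi] at h
  filter_upwards [h] with ρ hρ h0
  have := hρ h0
  simp only [Pi.zero_apply, mul_eq_zero, ENNReal.ofReal_eq_zero, not_le.2 (pow_pos (show (0:ℝ) < ρ from h0) _), false_or] at this
  have hmy : Measurable fun y : Sph (k+2) => (toMeasurable volume s).indicator (1 : Rn (k+2) → ℝ≥0∞) (ρ • y.1) := (measurable_one.indicator hm).comp (by fun_prop)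
  rw [lintegral_eq_zero_iff hmy] at this
  filter_upwards [this] with y hy hys
  have hy' : (toMeasurable volume s).indicator (1 : Rn (k+2) → ℝ≥0∞) (ρ • (y : Rn (k+2))) = 0 := hy
  rw [indicator_of_mem (subset_toMeasurable _ _ hys)] at hy'
  simp at hy'

theorem cone_comp (P : MSPair (k+2)) (hmin : IsGlobalMin (k+2) P) (hfin : omH (k+2) ≠ ⊤) (hβ : 0 < β)
    {C : Set (Rn (k+2))} (hC : IsClosed C) (hcone : ∀ t : ℝ, 0 ≤ t → ∀ x ∈ C, t • x ∈ C) (hKC : P.K ⊆ C)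
    (hW : WirtingerCond (k+2) P.K (β*(β+k))) : ∀ᵐ ρ : ℝ, 0 < ρ →
    MSEnergy (k+2) P (ball 0 ρ) ≤ oR (ρ^(k+2)/(β+k)) *
      (∫⁻ y in {y : Sph (k+2) | ρ • y.1 ∉ P.K}, oR (‖gradient P.u (ρ • y.1)‖^2) ∂sg (k+2))
      + oR (ρ^(k+1)) * nuC k C {y | ρ • (y : Rn (k+2)) ∈ P.K} := by
  have hK := P.closed
  have hd := ae_sph (k := k) (s := {x | ¬ (x ∈ P.Kᶜ → DifferentiableAt ℝ P.u x)}) (ae_diff hK.isOpen_compl P.lip)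
  have h2 : ∀ R : ℕ, ∀ᵐ ρ : ℝ, 0 < ρ → ρ < R → ∫⁻ y in {y : Sph (k+2) | ρ • y.1 ∉ P.K}, oR ((P.u (ρ • y.1))^2) ∂sg (k+2) < ⊤ := by
    intro R
    rcases Nat.eq_zero_or_pos R with h0 | hR
    · subst h0; filter_upwards with ρ h1 h2; norm_num at h2; linarith
    have hmS : MeasurableSet (ball (0 : Rn (k+2)) R \ P.K) := measurableSet_ball.diff hK.measurableSet
    have hf : Measurable ((ball (0 : Rn (k+2)) R \ P.K).indicator fun x => oR (P.u x ^ 2)) := by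
      classical
      rw [← piecewise_eq_indicator]
      refine ContinuousOn.measurable_piecewise ?_ continuousOn_const hmS
      refine ENNReal.continuous_ofReal.comp_continuousOn (ContinuousOn.pow (fun x hx => ?_) 2)
      exact ((locLip_iff hK.isOpen_compl).1 P.lip x hx.2).continuousAt.continuousWithinAt
    have hp := polar_vol (N := k+2) (by omega) _ hf
    have hfi : ∫⁻ x in ball (0 : Rn (k+2)) R \ P.K, oR (P.u x ^ 2) < ⊤ := by
      have h := (P.integ R (by exact_mod_cast hR)).2
      rw [hasFiniteIntegral_iff_ofReal (by filter_upwards with x; positivity)] at h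
      exact lt_of_le_of_lt (lintegral_mono fun x => ENNReal.ofReal_le_ofReal (by nlinarith [sq_nonneg ‖gradient P.u x‖])) h
    rw [lintegral_indicator hmS] at hp
    have hmm : Measurable fun p : ℝ × Sph (k+2) => (ball (0 : Rn (k+2)) R \ P.K).indicator (fun x => oR (P.u x ^ 2)) (p.1 • (p.2 : Rn (k+2))) :=
      hf.comp (by fun_prop)
    have := ae_lt_top (Measurable.mul (by fun_prop) hmm.lintegral_prod_right') (hp ▸ hfi).ne
    rw [ae_restrict_iff' measurableSet_Ioi] at this
    filter_upwards [this] with ρ hρ h0 h1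
    have h3 := hρ h0
    have h4 := ENNReal.lt_top_of_mul_ne_top_right h3.ne (ENNReal.ofReal_pos.2 (pow_pos h0 _)).ne'
    have hms : MeasurableSet {y : Sph (k+2) | ρ • y.1 ∉ P.K} := (hK.isOpen_compl.preimage (by fun_prop : Continuous fun y : Sph (k+2) => ρ • y.1)).measurableSet
    rw [← lintegral_indicator hms]
    refine lt_of_le_of_lt (lintegral_mono fun y => ?_) h4
    by_cases hy : ρ • (y : Rn (k+2)) ∈ P.K
    · rw [indicator_of_notMem (show y ∉ {y : Sph (k+2) | ρ • y.1 ∉ P.K} from fun h => h hy)]; exact zero_le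
    · rw [indicator_of_mem (show y ∈ {y : Sph (k+2) | ρ • y.1 ∉ P.K} from hy), indicator_of_mem (show ρ • y.1 ∈ ball 0 (R:ℝ) \ P.K from ⟨?_, hy⟩)]
      rw [mem_ball_zero_iff, norm_smul, sph_norm, mul_one, Real.norm_of_nonneg h0.le]; exact h1
  rw [WirtingerCond] at hW
  filter_upwards [hd, ae_all_iff.2 h2, hW] with ρ hd h2 hW h0
  have heq : {y : Sph (k+2) | y.1 ∈ Om P.K ρ} = {y : Sph (k+2) | ρ • y.1 ∉ P.K} := by ext y; exact sph_Om y
  set E := ∫⁻ y in {y : Sph (k+2) | ρ • y.1 ∉ P.K}, oR (‖gradient P.u (ρ • y.1)‖^2) ∂sg (k+2) with hE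
  by_cases hEt : E = ⊤
  · rw [hEt, ENNReal.mul_top (ENNReal.ofReal_pos.2 (by positivity)).ne', top_add]; exact le_top
  have hGE : ∫⁻ y in {y : Sph (k+2) | y.1 ∈ Om P.K ρ}, oR (‖gradient (gF P.u ρ) (ρ • y.1)‖^2) ∂sg (k+2) ≤ E := by
    rw [heq, hE]
    have hms : MeasurableSet {y : Sph (k+2) | ρ • y.1 ∉ P.K} := (hK.isOpen_compl.preimage (by fun_prop : Continuous fun y : Sph (k+2) => ρ • y.1)).measurableSet
    refine lintegral_mono_ae ((ae_restrict_iff' hms).2 ?_)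
    filter_upwards [hd h0] with y hy hyK
    have hdy : DifferentiableAt ℝ P.u (ρ • (y : Rn (k+2))) := by
      have := not_not.1 hy; exact this hyK
    have := gF_grad_le h0 (u := P.u) (x := ρ • (y : Rn (k+2))) (by rw [norm_smul, sph_norm, mul_one, Real.norm_of_nonneg h0.le]) hdy
    gcongr
  obtain ⟨R, hR⟩ := exists_nat_gt ρ
  refine (cone_pair P hmin hfin h0 hβ hC hcone hKC (hW h0) (hGE.trans_lt (lt_top_iff_ne_top.2 hEt)) (by rw [heq]; exact h2 R h0 hR)).trans ?_
  gcongr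
end
end
section
section
variable {k : ℕ} {r : ℝ}

theorem pow_id (hk : 1 ≤ k) {t : ℝ} (ht : 0 < t) (htr : t < r) : oR ((t^k)⁻¹) = oR ((r^k)⁻¹) + (k : ℝ≥0∞) * ∫⁻ ρ in Ioo t r, oR ((ρ^(k+1))⁻¹) := by
  have hr := ht.trans htr
  have hd : ∀ x ∈ uIcc t r, HasDerivAt (fun ρ : ℝ => -(ρ^k)⁻¹ / k) ((x^(k+1))⁻¹) x := by
    intro x hx
    rw [uIcc_of_le htr.le] at hx
    have hx0 : x ≠ 0 := (ht.trans_le hx.1).ne'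
    have h := (((hasDerivAt_pow k x).inv (pow_ne_zero k hx0)).neg).div_const (k:ℝ)
    have hk0 : (k:ℝ) ≠ 0 := by positivity
    have e : -(-(↑k * x ^ (k - 1)) / (x ^ k) ^ 2) / (k:ℝ) = (x^(k+1))⁻¹ := by
      obtain ⟨j, rfl⟩ : ∃ j, k = j+1 := ⟨k-1, by omega⟩
      simp only [Nat.add_sub_cancel]; field_simp; ring
    rw [e] at h
    exact h
  have hc : ContinuousOn (fun ρ : ℝ => (ρ^(k+1))⁻¹) (uIcc t r) := by
    rw [uIcc_of_le htr.le]
    exact ContinuousOn.inv₀ (by fun_prop) fun x hx => pow_ne_zero _ (ht.trans_le hx.1).ne'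
  have hi := hc.intervalIntegrable (μ := volume)
  have h := intervalIntegral.integral_eq_sub_of_hasDerivAt hd hi
  rw [intervalIntegrable_iff_integrableOn_Ioo_of_le htr.le] at hi
  rw [← ofReal_integral_eq_lintegral_ofReal hi (by
    filter_upwards [ae_restrict_mem measurableSet_Ioo] with ρ hρ
    have := ht.trans hρ.1
    simp only [Pi.zero_apply]; positivity), ← integral_Ioc_eq_integral_Ioo, ← intervalIntegral.integral_of_le htr.le, h,
    ← ENNReal.ofReal_natCast, ← ENNReal.ofReal_mul (by positivity), ← ENNReal.ofReal_add (by positivity)]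
  · congr 1
    have hk0 : (k:ℝ) ≠ 0 := by positivity
    field_simp; ring
  · have : (r^k)⁻¹ ≤ (t^k)⁻¹ := by gcongr
    have e : -(r ^ k)⁻¹ / (k:ℝ) - -(t ^ k)⁻¹ / k = ((t^k)⁻¹ - (r^k)⁻¹)/k := by ring
    rw [e]
    have := sub_nonneg.2 this
    positivity

theorem fub (hk : 1 ≤ k) {f : ℝ → ℝ≥0∞} (hf : Measurable f) :
    ∫⁻ t in Ioo 0 r, oR ((t^k)⁻¹) * f t = oR ((r^k)⁻¹) * (∫⁻ t in Ioo 0 r, f t) +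
      k * ∫⁻ ρ in Ioo 0 r, oR ((ρ^(k+1))⁻¹) * ∫⁻ t in Ioo 0 ρ, f t := by
  have h1 : ∫⁻ t in Ioo 0 r, oR ((t^k)⁻¹) * f t = ∫⁻ t in Ioo 0 r, (oR ((r^k)⁻¹) * f t +
      k * ∫⁻ ρ in Ioo 0 r, (Ioi t).indicator (fun ρ => oR ((ρ^(k+1))⁻¹)) ρ * f t) := by
    refine setLIntegral_congr_fun measurableSet_Ioo fun t ht => ?_
    rw [pow_id hk ht.1 ht.2, add_mul, mul_assoc, lintegral_mul_const _ ((by fun_prop : Measurable fun ρ : ℝ => oR ((ρ^(k+1))⁻¹)).indicator measurableSet_Ioi),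
      lintegral_indicator measurableSet_Ioi, Measure.restrict_restrict measurableSet_Ioi]
    congr 5
    ext x; simp only [mem_Ioo, mem_inter_iff, mem_Ioi]
    constructor
    · rintro ⟨a, b⟩; exact ⟨a, ht.1.trans a, b⟩
    · rintro ⟨a, _, b⟩; exact ⟨a, b⟩
  have hm : Measurable fun p : ℝ × ℝ => (Ioi p.1).indicator (fun ρ => oR ((ρ^(k+1))⁻¹)) p.2 * f p.1 := by
    refine Measurable.mul ?_ (hf.comp measurable_fst)
    have e : (fun p : ℝ × ℝ => (Ioi p.1).indicator (fun ρ => oR ((ρ^(k+1))⁻¹)) p.2) = {p : ℝ × ℝ | p.1 < p.2}.indicator fun p => oR ((p.2^(k+1))⁻¹) := by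
      ext p; simp only [indicator, mem_Ioi, mem_ofPred_eq]
    rw [e]
    exact (by fun_prop : Measurable fun p : ℝ × ℝ => oR ((p.2^(k+1))⁻¹)).indicator (measurableSet_lt measurable_fst measurable_snd)
  rw [h1, lintegral_add_left (hf.const_mul _), lintegral_const_mul _ hf, lintegral_const_mul _ hm.lintegral_prod_right', lintegral_lintegral_swap hm.aemeasurable]
  congr 2
  refine setLIntegral_congr_fun measurableSet_Ioo fun ρ hρ => ?_
  simp only
  rw [← lintegral_const_mul _ hf, ← lintegral_indicator measurableSet_Ioo, ← lintegral_indicator measurableSet_Ioo]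
  congr 1; ext t
  simp only [indicator, mem_Ioo, mem_Ioi]
  have := hρ.2
  by_cases h0 : 0 < t <;> by_cases h2 : t < ρ <;> simp [h0, h2]
  intro h; linarith

theorem ana (hk : 1 ≤ k) (hr : 0 < r) {a ν : ℝ → ℝ≥0∞} (ha : Measurable a) (hν : Measurable ν) {om : ℝ≥0∞} (hom : om ≠ ⊤) {β h : ℝ} (hβ : 0 < β)
    (h1 : ∀ ρ : ℝ, 0 < ρ → ∫⁻ t in Ioo 0 ρ, (oR (t^(k+1)) * a t + oR (t^k) * (((k+1:ℕ):ℝ≥0∞) * ν t)) ≤ oR (ρ^(k+1)) * om)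
    (h2 : ∀ᵐ ρ : ℝ, 0 < ρ → ∫⁻ t in Ioo 0 ρ, (oR (t^(k+1)) * a t + oR (t^k) * (((k+1:ℕ):ℝ≥0∞) * ν t)) ≤
      oR (ρ^(k+2)/(β+k)) * a ρ + oR (ρ^(k+1)) * ν ρ)
    (h3 : ∀ᵐ ρ : ℝ, 0 < ρ → oR h * om ≤ ν ρ) :
    ∫⁻ ρ in Ioo 0 r, oR ρ * a ρ ≤ oR ((k+1)*r) * om ∧
    (0 ≤ h → ∫⁻ ρ in Ioo 0 r, oR ρ * a ρ ≤ oR ((1-h)*(β+k)/β*r) * om) := by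
  set f : ℝ → ℝ≥0∞ := fun t => oR (t^(k+1)) * a t + oR (t^k) * (((k+1:ℕ):ℝ≥0∞) * ν t) with hfd
  have hf : Measurable f := by simp only [hfd]; fun_prop
  have hF := fub (r := r) hk hf
  set X := ∫⁻ ρ in Ioo 0 r, oR ρ * a ρ with hX
  set Y := ∫⁻ ρ in Ioo 0 r, ν ρ with hY
  set Z := ∫⁻ ρ in Ioo 0 r, oR ((ρ^(k+1))⁻¹) * ∫⁻ t in Ioo 0 ρ, f t with hZ
  have hl : ∫⁻ t in Ioo 0 r, oR ((t^k)⁻¹) * f t = X + ((k+1:ℕ):ℝ≥0∞) * Y := by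
    rw [hX, hY, ← lintegral_const_mul _ hν, ← lintegral_add_left (by fun_prop)]
    refine setLIntegral_congr_fun measurableSet_Ioo fun t ht => ?_
    have h0 := ht.1
    simp only [hfd]
    rw [mul_add, ← mul_assoc, ← mul_assoc, ← ENNReal.ofReal_mul (by positivity), ← ENNReal.ofReal_mul (by positivity), inv_mul_cancel₀ (by positivity), ENNReal.ofReal_one, one_mul]
    congr 3; field_simp; ring
  have hb : oR ((r^k)⁻¹) * (∫⁻ t in Ioo 0 r, f t) ≤ oR r * om := by
    refine (mul_le_mul_right (h1 r hr) _).trans (le_of_eq ?_)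
    rw [← mul_assoc, ← ENNReal.ofReal_mul (by positivity)]
    congr 2; field_simp; ring
  have hZ1 : Z ≤ oR r * om := by
    calc Z ≤ ∫⁻ ρ in Ioo 0 r, om := by
          refine setLIntegral_mono' measurableSet_Ioo fun ρ hρ => ?_
          have h0 := hρ.1
          refine (mul_le_mul_right (h1 ρ hρ.1) _).trans (le_of_eq ?_)
          rw [← mul_assoc, ← ENNReal.ofReal_mul (by positivity), inv_mul_cancel₀ (by positivity), ENNReal.ofReal_one, one_mul]
      _ = _ := by rw [setLIntegral_const, Real.volume_Ioo, sub_zero, mul_comm]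
  have hZ2 : Z ≤ oR (1/(β+k)) * X + Y := by
    rw [hX, hY, ← lintegral_const_mul _ (by fun_prop), ← lintegral_add_left (by fun_prop)]
    refine lintegral_mono_ae ((ae_restrict_iff' measurableSet_Ioo).2 ?_)
    filter_upwards [h2] with ρ h2 hρ
    have h0 := hρ.1
    refine (mul_le_mul_right (h2 hρ.1) _).trans (le_of_eq ?_)
    rw [mul_add, ← mul_assoc, ← mul_assoc, ← mul_assoc, ← ENNReal.ofReal_mul (by positivity), ← ENNReal.ofReal_mul (by positivity), ← ENNReal.ofReal_mul (by positivity), inv_mul_cancel₀ (by positivity), ENNReal.ofReal_one, one_mul]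
    congr 3; field_simp; ring
  have hYl : oR h * om * oR r ≤ Y := by
    calc _ = ∫⁻ ρ in Ioo 0 r, oR h * om := by rw [setLIntegral_const, Real.volume_Ioo, sub_zero]
      _ ≤ Y := by
        refine lintegral_mono_ae ((ae_restrict_iff' measurableSet_Ioo).2 ?_)
        filter_upwards [h3] with ρ h3 hρ using h3 hρ.1
  rw [hl] at hF
  have hS : X + ((k+1:ℕ):ℝ≥0∞) * Y ≤ oR ((k+1)*r) * om := by
    rw [hF]
    calc _ ≤ oR r * om + k * (oR r * om) := by gcongr
      _ = _ := by
        rw [ENNReal.ofReal_mul (by positivity), ENNReal.ofReal_add (by positivity) (by positivity), ENNReal.ofReal_natCast, ENNReal.ofReal_one]; ring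
  have hSt : oR ((k+1)*r) * om ≠ ⊤ := ENNReal.mul_ne_top ENNReal.ofReal_ne_top hom
  have hXl : X ≤ oR ((k+1)*r) * om := le_self_add.trans hS
  refine ⟨hXl, fun hh => ?_⟩
  have hXt := ne_top_of_le_ne_top hSt hXl
  have hYt : Y ≠ ⊤ := by
    intro hYt
    rw [hYt, ENNReal.mul_top (by simp), add_top, top_le_iff] at hS
    exact hSt hS
  have hfin : X + ((k+1:ℕ):ℝ≥0∞) * Y ≤ oR r * om + k * (oR (1/(β+k)) * X + Y) := by
    rw [hF]; gcongr
  clear_value X Y Z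
  clear hX hY hZ hl hZ1 hZ2 hF h1 h2 h3 hf hfd hb hS hXl
  lift X to ℝ≥0 using hXt
  lift Y to ℝ≥0 using hYt
  lift om to ℝ≥0 using hom
  simp only [ENNReal.ofReal] at hfin hYl ⊢
  have hfin' : (X:ℝ) + (k+1) * Y ≤ r * om + k * (1/(β+k) * X + Y) := by
    have : X + ((k+1:ℕ):ℝ≥0) * Y ≤ r.toNNReal * om + k * ((1/(β+k)).toNNReal * X + Y) := by exact_mod_cast hfin
    have h' := NNReal.coe_le_coe.2 this
    push_cast at h'
    rwa [Real.coe_toNNReal _ hr.le, Real.coe_toNNReal _ (by positivity)] at h'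
  have hY' : h * om * r ≤ (Y:ℝ) := by
    have : h.toNNReal * om * r.toNNReal ≤ Y := by exact_mod_cast hYl
    have h' := NNReal.coe_le_coe.2 this
    push_cast at h'
    rwa [Real.coe_toNNReal _ hr.le, Real.coe_toNNReal _ hh] at h'
  have hg : (X:ℝ) ≤ (1-h)*(β+k)/β*r * om := by
    have hbk : 0 < β + k := by positivity
    have e : (k:ℝ) * (1/(β+k) * X + Y) = X - β/(β+k) * X + k * Y := by field_simp; ring
    rw [e] at hfin'
    have h4 : β/(β+k) * X ≤ (1-h)*r*om := by linarith
    rw [div_mul_eq_mul_div, div_le_iff₀ hbk] at h4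
    rw [div_mul_eq_mul_div, div_mul_eq_mul_div, le_div_iff₀ hβ]
    linarith
  rw [← ENNReal.coe_mul, ENNReal.coe_le_coe]
  refine NNReal.coe_le_coe.1 (hg.trans ?_)
  push_cast
  gcongr
  exact Real.le_coe_toNNReal _
end
end
section
section

def Good (k : ℕ) (γ h : ℝ) : Prop := ∃ τ : ℝ, 0 < τ ∧ τ^2 ≤ 1 - (k+1)/γ ∧ ∃ (m : ℕ) (M p lam : ℝ), 0 < M ∧
  (∀ c ∈ Icc (-1:ℝ) 1, (1+c)^m * Real.sqrt (1-c^2) ≤ M) ∧ 0 ≤ p ∧ 0 ≤ lam ∧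
  (∀ c ∈ Icc (-1:ℝ) 1, p + lam * (c - τ) ≤ (1+c)^m * (((k+1:ℕ)+m) * c - m)) ∧ h ≤ p / (2*(k+1)*M)

theorem m3_sqrt {c : ℝ} (hc : c ∈ Icc (-1:ℝ) 1) : (1+c)^3 * Real.sqrt (1-c^2) ≤ 3.545 := by
  obtain ⟨h1, h2⟩ := hc
  have h0 : 0 ≤ 1 + c := by linarith
  rw [← Real.sqrt_sq (show (0:ℝ) ≤ (1+c)^3 by positivity), ← Real.sqrt_mul (by positivity)]
  refine Real.sqrt_le_iff.2 ⟨by norm_num, ?_⟩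
  obtain ⟨w, hw⟩ : ∃ w : ℝ, 1 + c = 7/4 * w := ⟨4/7*(1+c), by ring⟩
  have hw0 : 0 ≤ w := by linarith
  have hc' : c = 7/4*w - 1 := by linarith
  have e : ((1+c)^3)^2 * (1-c^2) = (7/4)^7/4 * (8*w^7-7*w^8) := by rw [hc']; ring
  have h3 : 0 ≤ (1-w)^2*(1+2*w+3*w^2+4*w^3+5*w^4+6*w^5+7*w^6) := by positivity
  have h4 : 8*w^7-7*w^8 ≤ 1 := by nlinarith
  rw [e]
  calc (7/4:ℝ)^7/4 * (8*w^7-7*w^8) ≤ (7/4:ℝ)^7/4 * 1 := by gcongr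
    _ ≤ _ := by norm_num

theorem good3 {k : ℕ} (hk : 1 ≤ k) {γ τ h : ℝ} (hτ : 0.86 ≤ τ) (hγ : (k+1)/γ ≤ 1 - τ^2)
    (hh : h ≤ (1+τ)^3*((k+4)*τ-3) / (2*(k+1)*3.545)) : Good k γ h := by
  have hk' : (1:ℝ) ≤ k := by exact_mod_cast hk
  have hq : 0 ≤ (k+4)*τ-3 := by nlinarith
  refine ⟨τ, by linarith, by linarith, 3, 3.545, (1+τ)^3*((k+4)*τ-3), 3*(1+τ)^2*((k+4)*τ-3)+(k+4)*(1+τ)^3, by norm_num, fun c hc => m3_sqrt hc, by positivity, by positivity, fun c hc => ?_, hh⟩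
  obtain ⟨h1, h2⟩ := hc
  have e : (1+c)^3*(((k+1:ℕ)+(3:ℕ))*c-(3:ℕ)) - ((1+τ)^3*((k+4)*τ-3) + (3*(1+τ)^2*((k+4)*τ-3)+(k+4)*(1+τ)^3)*(c-τ))
      = (c-τ)^2*((k+4)*((1+c)^2+2*(1+c)*(1+τ)+3*(1+τ)^2)-(k+7)*((1+c)+2*(1+τ))) := by push_cast; ring
  have h3 : 0 ≤ (k+4)*((1+c)^2+2*(1+c)*(1+τ)+3*(1+τ)^2)-(k+7)*((1+c)+2*(1+τ)) := by
    have hv : 0 ≤ 1 + c := by linarith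
    have ha : (k:ℝ)+7 ≤ 1.6*(k+4) := by linarith
    have hb : 1.6*((1+c)+2*(1+τ)) ≤ (1+c)^2+2*(1+c)*(1+τ)+3*(1+τ)^2 := by nlinarith
    have hc0 : 0 ≤ (1+c)+2*(1+τ) := by linarith
    nlinarith
  have := mul_nonneg (sq_nonneg (c-τ)) h3
  have h3e : (((k+1:ℕ):ℝ)+(3:ℕ)) = (((k+1:ℕ):ℝ)+((3:ℕ):ℝ)) := rfl
  linarith

theorem good0 {k : ℕ} {γ y : ℝ} (hy : 0 < y) (hγ : (k+1)/γ ≤ 1 - (2*y)^2) : Good k γ y := by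
  refine ⟨2*y, by linarith, by linarith, 0, 1, (k+1)*(2*y), k+1, one_pos, fun c hc => ?_, by positivity, by positivity, fun c hc => ?_, ?_⟩
  · rw [pow_zero, one_mul]; exact Real.sqrt_le_one.2 (by nlinarith)
  · push_cast; apply le_of_eq; ring
  · apply le_of_eq; field_simp

theorem num {k : ℕ} (hk : 1 ≤ k) {β : ℝ} (hβ : 1 < β) :
    ∃ h : ℝ, 0 ≤ h ∧ (1-h)*(β+k) ≤ 2^k ∧ (h = 0 ∨ Good k (β*(β+k)) h) := by
  have hk' : (1:ℝ) ≤ k := by exact_mod_cast hk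
  have hb : 0 < β + k := by linarith
  obtain ⟨y, hy⟩ : ∃ y : ℝ, y = 1 - 2^k/(β+k) := ⟨_, rfl⟩
  have hs : (1-y)*(β+k) = 2^k := by rw [hy]; field_simp; ring
  by_cases hy0 : y ≤ 0
  · exact ⟨0, le_rfl, by nlinarith, Or.inl rfl⟩
  push Not at hy0
  refine ⟨y, hy0.le, hs.le, Or.inr ?_⟩
  have h2 : (0:ℝ) < 2^k := by positivity
  have hy1 : y < 1 := by by_contra h; nlinarith
  have key : ∀ q : ℝ, (k+1)*(1-y)^2 ≤ q*(2^k*(2^k-k*(1-y))) → (k+1)/(β*(β+k)) ≤ q := by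
    intro q hq
    rw [div_le_iff₀ (by positivity)]
    have e : 2^k*(2^k-k*(1-y)) = (1-y)^2*(β*(β+k)) := by rw [← hs]; ring
    rw [e] at hq
    have : 0 < (1-y)^2 := by have : 0 < 1-y := by linarith
                             positivity
    nlinarith
  rcases eq_or_ne k 1 with h1 | h1
  · subst h1
    norm_num at key
    rcases le_total y 0.4 with h | h
    · exact good0 hy0 (by push_cast; norm_num; exact key _ (by nlinarith [mul_pos hy0 hy0]))
    rcases le_total y 0.58 with h' | h'
    · exact good3 hk (τ := 0.86) le_rfl (by norm_num; exact key _ (by nlinarith)) (by norm_num at h' ⊢; linarith)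
    rcases le_total y 0.88 with h'' | h''
    · exact good3 hk (τ := 0.942) (by norm_num) (by norm_num; exact key _ (by nlinarith)) (by norm_num at h'' ⊢; linarith)
    · exact good3 hk (τ := 0.99) (by norm_num) (by norm_num; exact key _ (by nlinarith)) (by norm_num at hy1 ⊢; linarith)
  rcases eq_or_ne k 2 with h3 | h3
  · subst h3
    norm_num at key
    rcases le_total y 0.4 with h | h
    · exact good0 hy0 (by push_cast; norm_num; exact key _ (by nlinarith [mul_pos hy0 hy0]))
    rcases le_total y 0.94 with h' | h'
    · exact good3 hk (τ := 0.95) (by norm_num) (by norm_num; exact key _ (by nlinarith)) (by norm_num at h' ⊢; linarith)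
    · exact good3 hk (τ := 0.99) (by norm_num) (by norm_num; exact key _ (by nlinarith)) (by norm_num at hy1 ⊢; linarith)
  have hk3 : 3 ≤ k := by omega
  have hpow : (k:ℝ)+5 ≤ 2^k ∧ 2*(k:ℝ)+2 ≤ 2^k := by
    clear key hs hy hb h1 h3 hk hk' h2
    induction k, hk3 using Nat.le_induction with
    | base => norm_num
    | succ n hn ih => rw [pow_succ]; push_cast; constructor <;> linarith [ih.1, ih.2, (Nat.cast_nonneg n : (0:ℝ) ≤ n)]
  have key2 : (k+1)/(β*(β+k)) ≤ 0.1*(1-y)^2 := by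
    apply key
    have h5 : 5 ≤ 2^k - k*(1-y) := by nlinarith
    have : (k:ℝ)+1 ≤ 0.1 * (2^k*(2^k-k*(1-y))) := by nlinarith
    nlinarith [sq_nonneg (1-y)]
  rcases le_total y 0.4 with h | h
  · exact good0 hy0 (key2.trans (by nlinarith))
  · refine good3 hk (τ := 0.98) (by norm_num) (key2.trans (by nlinarith)) (hy1.le.trans ?_)
    rw [le_div_iff₀ (by positivity)]; norm_num; nlinarith
end
end
section
section
variable {k : ℕ}

def aF (P : MSPair (k+2)) (ρ : ℝ) : ℝ≥0∞ :=
  ∫⁻ y in {y : Sph (k+2) | ρ • y.1 ∉ P.K}, oR (‖gradient P.u (ρ • y.1)‖^2) ∂sg (k+2)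

def eF (P : MSPair (k+2)) : Rn (k+2) → ℝ≥0∞ := (P.Kᶜ).indicator fun x => oR (‖gradient P.u x‖^2)

theorem eF_meas (P : MSPair (k+2)) : Measurable (eF P) :=
  (meas_e P.u).indicator P.closed.isOpen_compl.measurableSet

theorem aF_eq (P : MSPair (k+2)) (ρ : ℝ) : aF P ρ = ∫⁻ y : Sph (k+2), eF P (ρ • y.1) ∂sg (k+2) := by
  have hm : MeasurableSet {y : Sph (k+2) | ρ • y.1 ∉ P.K} :=
    (P.closed.isOpen_compl.preimage (by fun_prop : Continuous fun y : Sph (k+2) => ρ • y.1)).measurableSet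
  rw [aF, ← lintegral_indicator hm]
  rfl

theorem aF_meas (P : MSPair (k+2)) : Measurable (aF P) := by
  simp_rw [funext (aF_eq P)]
  exact Measurable.lintegral_prod_right' (f := fun p : ℝ × Sph (k+2) => eF P (p.1 • (p.2 : Rn (k+2))))
    ((eF_meas P).comp (by fun_prop))

theorem polar_w (P : MSPair (k+2)) (r : ℝ) (w : ℝ → ℝ≥0∞) (hw : Measurable w) :
    ∫⁻ x in ball (0 : Rn (k+2)) r \ P.K, w ‖x‖ * oR (‖gradient P.u x‖^2) =
    ∫⁻ ρ in Ioo 0 r, oR (ρ^(k+1)) * (w ρ * aF P ρ) := by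
  have hm : MeasurableSet (ball (0 : Rn (k+2)) r \ P.K) := measurableSet_ball.diff P.closed.measurableSet
  have hmw : Measurable (fun x : Rn (k+2) => w ‖x‖ * oR (‖gradient P.u x‖^2)) := (hw.comp measurable_norm).mul (meas_e P.u)
  rw [← lintegral_indicator hm, polar_vol (by omega) _ (hmw.indicator hm)]
  rw [← lintegral_indicator measurableSet_Ioi, ← lintegral_indicator measurableSet_Ioo]
  refine lintegral_congr fun ρ => ?_
  by_cases h0 : 0 < ρ
  · rw [indicator_of_mem (show ρ ∈ Ioi (0:ℝ) from h0)]
    have hn : ∀ y : Sph (k+2), ‖ρ • y.1‖ = ρ := fun y => by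
      rw [norm_smul, sph_norm, mul_one, Real.norm_of_nonneg h0.le]
    have hme : Measurable fun y : Sph (k+2) => eF P (ρ • y.1) := (eF_meas P).comp (by fun_prop)
    by_cases h1 : ρ < r
    · rw [indicator_of_mem (show ρ ∈ Ioo 0 r from ⟨h0, h1⟩), aF_eq, ← lintegral_const_mul _ hme]
      congr 1
      refine lintegral_congr fun y => ?_
      by_cases hy : ρ • (y : Rn (k+2)) ∈ P.K
      · rw [indicator_of_notMem (fun h => h.2 hy), eF, indicator_of_notMem (show ρ • (y : Rn (k+2)) ∉ P.Kᶜ from fun h => h hy), mul_zero]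
      · rw [indicator_of_mem (show ρ • (y : Rn (k+2)) ∈ ball (0 : Rn (k+2)) r \ P.K from ⟨by rw [mem_ball_zero_iff, hn]; exact h1, hy⟩), eF, indicator_of_mem (show ρ • (y : Rn (k+2)) ∈ P.Kᶜ from hy), hn]
    · rw [indicator_of_notMem (fun h => h1 h.2)]
      have : ∀ y : Sph (k+2), (ball (0 : Rn (k+2)) r \ P.K).indicator (fun x => w ‖x‖ * oR (‖gradient P.u x‖^2)) (ρ • y.1) = 0 := fun y =>
        indicator_of_notMem (fun h => h1 (by simpa [hn] using h.1)) _
      simp only [this, lintegral_zero, mul_zero]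
  · rw [indicator_of_notMem (show ρ ∉ Ioi (0:ℝ) from h0), indicator_of_notMem (fun h => h0 h.1)]

theorem main_k (hk : 1 ≤ k) (P : MSPair (k+2)) (hmin : IsGlobalMin (k+2) P)
    (hcone : InRectCone (k+2) P.K) {β : ℝ} (hβ : 0 < β) (hW : WirtingerCond (k+2) P.K (β*(β+k)))
    {r : ℝ} (hr : 0 < r) :
    Phi (k+2) P.K P.u r ≤ oR (2^k/β*r) * omH (k+2) := by
  by_cases hom : omH (k+2) = ⊤
  · rw [hom, ENNReal.mul_top]
    · exact le_top
    · exact (ENNReal.ofReal_pos.2 (by positivity)).ne'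
  obtain ⟨C, hC, hKC, hco, hrect⟩ := hcone
  replace hrect : KRectifiable (k+2) k (C ∩ sphere (0 : Rn (k+2)) 1) := hrect
  have hΦ : Phi (k+2) P.K P.u r = ∫⁻ ρ in Ioo 0 r, oR ρ * aF P ρ := by
    have e := polar_w P r (fun t => oR (t ^ ((2:ℝ) - ((k+2:ℕ):ℝ)))) (by fun_prop)
    rw [Phi]
    rw [show (fun x : Rn (k+2) => oR (‖gradient P.u x‖ ^ 2 * ‖x‖ ^ ((2:ℝ) - ((k+2:ℕ):ℝ)))) = fun x => oR (‖x‖ ^ ((2:ℝ) - ((k+2:ℕ):ℝ))) * oR (‖gradient P.u x‖ ^ 2) from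
      funext fun x => by rw [mul_comm, ENNReal.ofReal_mul (by positivity)], e]
    refine setLIntegral_congr_fun measurableSet_Ioo fun ρ hρ => ?_
    have h0 := hρ.1
    rw [← mul_assoc, ← ENNReal.ofReal_mul (by positivity), ← Real.rpow_natCast, ← Real.rpow_add h0]
    congr 2
    have : ((k+1:ℕ):ℝ) + (2 - ((k+2:ℕ):ℝ)) = 1 := by push_cast; ring
    rw [this, Real.rpow_one]
  have hE : ∀ ρ : ℝ, MSEnergy (k+2) P (ball 0 ρ) = ∫⁻ t in Ioo 0 ρ, (oR (t^(k+1)) * aF P t + oR (t^k) * (((k+1:ℕ):ℝ≥0∞) * nuC k C {y | t • (y : Rn (k+2)) ∈ P.K})) := by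
    intro ρ
    have e := polar_w P ρ (fun _ => 1) measurable_const
    simp only [one_mul] at e
    have h1 : ((k+2:ℕ):ℝ) - 1 = ((k+1:ℕ):ℝ) := by push_cast; ring
    rw [MSEnergy, e, h1, (polar_cone hk hC hco hrect P.closed hKC ρ).2, ← lintegral_add_left]
    have := aF_meas P
    fun_prop
  have hν := (polar_cone hk hC hco hrect P.closed hKC r).1
  have H1 : ∀ ρ : ℝ, 0 < ρ → _ := fun ρ hρ => (hE ρ).symm.le.trans (sphere_comp (by omega) P hmin hρ)
  have H2 : ∀ᵐ ρ : ℝ, 0 < ρ → ∫⁻ t in Ioo 0 ρ, (oR (t^(k+1)) * aF P t + oR (t^k) * (((k+1:ℕ):ℝ≥0∞) * nuC k C {y | t • (y : Rn (k+2)) ∈ P.K})) ≤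
      oR (ρ^(k+2)/(β+k)) * aF P ρ + oR (ρ^(k+1)) * nuC k C {y | ρ • (y : Rn (k+2)) ∈ P.K} := by
    filter_upwards [cone_comp P hmin hom hβ hC hco hKC hW] with ρ h hρ
    rw [← hE]; exact h hρ
  rw [hΦ]
  by_cases hb : β ≤ 1
  · refine (ana hk hr (aF_meas P) hν hom hβ H1 H2 (h := 0) (by simp)).1.trans ?_
    gcongr
    rw [le_div_iff₀ hβ]
    have h1 : (k:ℝ)+1 ≤ 2^k := by exact_mod_cast Nat.lt_two_pow_self
    nlinarith [(Nat.cast_nonneg k : (0:ℝ) ≤ k)]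
  · push Not at hb
    obtain ⟨h, hh, hle, hg⟩ := num hk hb
    refine ((ana hk hr (aF_meas P) hν hom hβ H1 H2 (h := h) ?_).2 hh).trans ?_
    · rcases hg with rfl | ⟨τ, hτ, hτ2, m, M, p, lam, hM, hMm, hp, hlam, htan, hhp⟩
      · simp
      filter_upwards [hW] with ρ hW hρ
      refine le_trans ?_ (lower_r hk hom hC hco hrect P.closed hKC hρ (by positivity) hτ hτ2 (hW hρ) m hM hMm hp hlam htan)
      gcongr
    · gcongr
end

theorem final {N : ℕ} (hN : 3 ≤ N) (P : MSPair N) (hmin : IsGlobalMin N P)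
    (hcone : InRectCone N P.K)
    (γ : ℝ) (hγ : 0 < γ) (hW : WirtingerCond N P.K γ)
    (α : ℝ) (hα : α = Real.sqrt (((N : ℝ) - 2) ^ 2 + 4 * γ) - ((N : ℝ) - 2)) :
    ∀ r : ℝ, 0 < r →
      Phi N P.K P.u r ≤ oR (α⁻¹ * 2 ^ (N - 1) * r) *
        μH[(N : ℝ) - 1] (sphere (0 : Rn N) 1) := by
  intro r hr
  obtain ⟨k, rfl⟩ : ∃ k, N = k + 2 := ⟨N - 2, by omega⟩
  have e : ((k+2:ℕ):ℝ) - 2 = k := by push_cast; ring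
  rw [e] at hα
  have hs := Real.sq_sqrt (show 0 ≤ (k:ℝ)^2 + 4*γ by positivity)
  have hs1 : (k:ℝ) < Real.sqrt ((k:ℝ)^2 + 4*γ) := Real.lt_sqrt_of_sq_lt (by linarith)
  have hβ : 0 < α/2 := by linarith
  have hg : γ = α/2*(α/2+k) := by rw [hα]; nlinarith
  have := main_k (by omega) P hmin hcone hβ (hg ▸ hW) hr
  refine this.trans (le_of_eq ?_)
  have h2 : k + 2 - 1 = k + 1 := by omega
  have hα0 : α ≠ 0 := by linarith
  rw [omH, h2, pow_succ]
  congr 3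
  field_simp
end
end

/-- Let `N ≥ 3` and let `(u, K)` be a global Mumford–Shah minimizer in
`ℝ^N` such that `K` satisfies condition (T), is contained in a rectifiable cone and
satisfies the `γ`-Wirtinger condition, `γ > 0`. With `α = √((N-2)² + 4γ) - (N-2)` and
`ω_N = H^{N-1}(S^{N-1})`, for every `r > 0`,
`∫_{B_r ∖ K} |∇u|² |x|^{2-N} dx ≤ α⁻¹ 2^{N-1} ω_N r`. -/
theorem statement13 {N : ℕ} (hN : 3 ≤ N) (P : MSPair N) (hmin : IsGlobalMin N P)
    (hT : CondT N P.K) (hcone : InRectCone N P.K)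
    (γ : ℝ) (hγ : 0 < γ) (hW : WirtingerCond N P.K γ)
    (α : ℝ) (hα : α = Real.sqrt (((N : ℝ) - 2) ^ 2 + 4 * γ) - ((N : ℝ) - 2)) :
    ∀ r : ℝ, 0 < r →
      Phi N P.K P.u r ≤ ENNReal.ofReal (α⁻¹ * 2 ^ (N - 1) * r) *
        μH[(N : ℝ) - 1] (sphere (0 : Rn N) 1) := by
  exact final hN P hmin hcone γ hγ hW α hα
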